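/- For system (1.3) under hypotheses (S1)-(S7) the following statements are equivalent: (a) there exists a continuous mapping k : [0,∞)×C⁰([−r,0];ℝⁿ) → U, completely locally Lipschitz with respect to x, with k(t,0) = 0 for all t ≥ 0, such that the closed-loop system ẋ(t) = f(t, d(t), T_r(t)x, k(t, T_r(t)x)) with output Y(t) = H(t, T_r(t)x) is RGAOS; (b) system (1.3) admits an ORCLF which satisfies the small-control property with q ≡ 0; (c) system (1.3) admits an ORCLF. -/

import Mathlib

open Filter Topology MeasureTheory Set RealInnerProductSpace

noncomputable section

/-- ℝⁿ with the Euclidean norm. -/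
abbrev Euc (n : ℕ) := EuclideanSpace ℝ (Fin n)

/-- The state space C⁰([−r,0];ℝⁿ) with the sup norm. -/
abbrev Hist (n : ℕ) (r : ℝ) := C(Icc (-r) (0:ℝ), Euc n)

/-- Class K∞ functions (on [0,∞)). -/
def IsKinf (a : ℝ → ℝ) : Prop :=
  ContinuousOn a (Ici 0) ∧ StrictMonoOn a (Ici 0) ∧ a 0 = 0 ∧ Tendsto a atTop atTop

/-- Class K⁺: positive continuous functions on [0,∞). -/
def IsKplus (b : ℝ → ℝ) : Prop := ContinuousOn b (Ici 0) ∧ ∀ t, 0 ≤ t → 0 < b t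

/-- Class ℰ: continuous nonnegative integrable functions on [0,∞) tending to 0. -/
def IsClassE (q : ℝ → ℝ) : Prop :=
  ContinuousOn q (Ici 0) ∧ (∀ t, 0 ≤ t → 0 ≤ q t) ∧
    IntegrableOn q (Ici 0) ∧ Tendsto q atTop (𝓝 0)

/-- Continuous positive definite functions on [0,∞). -/
def IsPosDef (ρ : ℝ → ℝ) : Prop :=
  ContinuousOn ρ (Ici 0) ∧ ρ 0 = 0 ∧ (∀ s, 0 < s → 0 < ρ s) ∧ ∀ s, 0 ≤ s → 0 ≤ ρ s

/-- Membership in M_D : measurable selections of values in D. -/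
def InMD {l : ℕ} (D : Set (Euc l)) (d : ℝ → Euc l) : Prop :=
  Measurable d ∧ ∀ t, d t ∈ D

/-- The operator E_h(x;v) of Section 4.II: E_h(x;v)(θ) = x(0)+(θ+h)v for −h < θ ≤ 0 and
E_h(x;v)(θ) = x(θ+h) for −r ≤ θ ≤ −h. -/
def Ehist {n : ℕ} {r : ℝ} (h : ℝ) (x : Hist n r) (v : Euc n) : Hist n r :=
  if hr : -r ≤ 0 then
    { toFun := fun θ => if (θ : ℝ) ≤ -h then x (projIcc (-r) 0 hr ((θ : ℝ) + h))
        else x (projIcc (-r) 0 hr 0) + ((θ : ℝ) + h) • v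
      continuous_toFun := by
        apply Continuous.if_le
        · exact x.continuous.comp (continuous_projIcc.comp (by fun_prop))
        · exact continuous_const.add ((continuous_subtype_val.add continuous_const).smul
            continuous_const)
        · exact continuous_subtype_val
        · exact continuous_const
        · intro θ hθ
          rw [hθ]
          simp }
  else x

/-- The Dini derivative V⁰(t,x;v) of a functional V : [0,∞)×C⁰([−r,0];ℝⁿ) → ℝ:
V⁰(t,x;v) := limsup_{h→0⁺, y→0} (V(t+h, E_h(x;v)+h·y) − V(t,x))/h. -/
def diniH {n : ℕ} {r : ℝ} (V : ℝ → Hist n r → ℝ) (t : ℝ) (x : Hist n r) (v : Euc n) :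
    EReal :=
  Filter.limsup
    (fun p : ℝ × Hist n r =>
      (((V (t + p.1) (Ehist p.1 x v + p.1 • p.2) - V t x) / p.1 : ℝ) : EReal))
    ((𝓝[>] (0:ℝ)) ×ˢ 𝓝 0)

/-- The simplified Dini derivative V⁰(x;v) := limsup_{h→0⁺} (V(E_h(x;v)) − V(x))/h of a
time-independent functional. -/
def diniH0 {n : ℕ} {r : ℝ} (V : Hist n r → ℝ) (x : Hist n r) (v : Euc n) : EReal :=
  Filter.limsup (fun h : ℝ => (((V (Ehist h x v) - V x) / h : ℝ) : EReal)) (𝓝[>] (0:ℝ))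

/-- x : [t₀−r, tmax) → ℝⁿ (with history map φ) is a solution of the RFDE
ẋ(t) = F(t,d(t),T_r(t)x) with initial condition T_r(t₀)x = x₀, in integral form. -/
def IsSolutionRFDE {n l : ℕ} {r : ℝ} (F : ℝ → Euc l → Hist n r → Euc n)
    (d : ℝ → Euc l) (t₀ : ℝ) (x₀ : Hist n r) (tmax : EReal) (x : ℝ → Euc n)
    (φ : ℝ → Hist n r) : Prop :=
  (t₀ : EReal) < tmax ∧
  φ t₀ = x₀ ∧
  (∀ t : ℝ, t₀ ≤ t → (t : EReal) < tmax → ∀ θ : Icc (-r) (0:ℝ), φ t θ = x (t + θ)) ∧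
  ContinuousOn x {s : ℝ | t₀ - r ≤ s ∧ (s : EReal) < tmax} ∧
  (∀ t : ℝ, t₀ ≤ t → (t : EReal) < tmax → x t = x t₀ + ∫ s in t₀..t, F s (d s) (φ s))

/-- A functional V : [0,∞)×C⁰([−r,0];ℝⁿ) → [0,∞) which is
"almost Lipschitz on bounded sets" (Definition 4.5). -/
def AlmostLipschitzOn {n : ℕ} (r : ℝ) (V : ℝ → Hist n r → ℝ) : Prop :=
  ContinuousOn (fun p : ℝ × Hist n r => V p.1 p.2) (Ici 0 ×ˢ univ) ∧
  ∃ LV P G : ℝ → ℝ, Monotone LV ∧ Monotone P ∧ Monotone G ∧ (∀ s, 1 ≤ G s) ∧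
    (∀ R, 0 ≤ R → ∀ t ∈ Icc (0:ℝ) R, ∀ x y : Hist n r, ‖x‖ ≤ R → ‖y‖ ≤ R →
      |V t y - V t x| ≤ LV R * ‖y - x‖) ∧
    (∀ R, 0 ≤ R → ∀ M : ℝ, 0 ≤ M → ∀ x : Hist n r, ‖x‖ ≤ R →
      LipschitzWith (Real.toNNReal M) (fun θ : Icc (-r) (0:ℝ) => x θ) →
      ∀ t ∈ Icc (0:ℝ) R, ∀ h : ℝ, 0 ≤ h → h ≤ 1 / G (R + M) →
        |V (t + h) x - V t x| ≤ h * P R * (1 + M))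

/-- RGAOS (Definition 4.2) of the system ẋ(t) = F(t,d(t),T_r(t)x), Y(t) = H(t,T_r(t)x),
phrased via the existence of a family of unique maximal solutions satisfying robust
forward completeness and properties P1, P2. -/
def RGAOSrfde {n l : ℕ} {Y : Type*} [NormedAddCommGroup Y] [NormedSpace ℝ Y] (r : ℝ)
    (D : Set (Euc l)) (F : ℝ → Euc l → Hist n r → Euc n) (H : ℝ → Hist n r → Y) : Prop :=
  ∃ (X : ℝ → Hist n r → (ℝ → Euc l) → ℝ → Euc n)
    (Φ : ℝ → Hist n r → (ℝ → Euc l) → ℝ → Hist n r)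
    (tmax : ℝ → Hist n r → (ℝ → Euc l) → EReal),
    (∀ t₀ : ℝ, 0 ≤ t₀ → ∀ x₀ d, InMD D d →
      IsSolutionRFDE F d t₀ x₀ (tmax t₀ x₀ d) (X t₀ x₀ d) (Φ t₀ x₀ d) ∧
      ∀ tm y ψ, IsSolutionRFDE F d t₀ x₀ tm y ψ → tm ≤ tmax t₀ x₀ d ∧
        ∀ t : ℝ, t₀ ≤ t → (t : EReal) < tm → ψ t = Φ t₀ x₀ d t) ∧
    -- robust forward completeness
    (∀ T, 0 ≤ T → ∀ s, 0 ≤ s → ∃ M, ∀ t₀ ∈ Icc (0:ℝ) T, ∀ ξ ∈ Icc (0:ℝ) T,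
      ∀ x₀ : Hist n r, ‖x₀‖ ≤ s → ∀ d, InMD D d →
        ((t₀ + ξ : ℝ) : EReal) < tmax t₀ x₀ d ∧ ‖Φ t₀ x₀ d (t₀ + ξ)‖ ≤ M) ∧
    -- P1 (output stability)
    (∀ ε, 0 < ε → ∀ T, 0 ≤ T →
      (∃ M, ∀ t₀ ∈ Icc (0:ℝ) T, ∀ x₀ : Hist n r, ‖x₀‖ ≤ ε → ∀ d, InMD D d →
        ∀ t : ℝ, t₀ ≤ t → (t : EReal) < tmax t₀ x₀ d → ‖H t (Φ t₀ x₀ d t)‖ ≤ M) ∧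
      (∃ δ, 0 < δ ∧ ∀ t₀ ∈ Icc (0:ℝ) T, ∀ x₀ : Hist n r, ‖x₀‖ ≤ δ → ∀ d, InMD D d →
        ∀ t : ℝ, t₀ ≤ t → (t : EReal) < tmax t₀ x₀ d → ‖H t (Φ t₀ x₀ d t)‖ ≤ ε)) ∧
    -- P2 (uniform output attractivity on bounded sets of initial data)
    (∀ ε, 0 < ε → ∀ T, 0 ≤ T → ∀ R, 0 ≤ R → ∃ τ, 0 ≤ τ ∧
      ∀ t₀ ∈ Icc (0:ℝ) T, ∀ x₀ : Hist n r, ‖x₀‖ ≤ R → ∀ d, InMD D d →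
        ∀ t : ℝ, t₀ + τ ≤ t → (t : EReal) < tmax t₀ x₀ d → ‖H t (Φ t₀ x₀ d t)‖ ≤ ε)

/-- URGAOS (Definition 4.3) of the system ẋ(t) = F(t,d(t),T_r(t)x), Y(t) = H(t,T_r(t)x). -/
def URGAOSrfde {n l : ℕ} {Y : Type*} [NormedAddCommGroup Y] [NormedSpace ℝ Y] (r : ℝ)
    (D : Set (Euc l)) (F : ℝ → Euc l → Hist n r → Euc n) (H : ℝ → Hist n r → Y) : Prop :=
  ∃ (X : ℝ → Hist n r → (ℝ → Euc l) → ℝ → Euc n)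
    (Φ : ℝ → Hist n r → (ℝ → Euc l) → ℝ → Hist n r)
    (tmax : ℝ → Hist n r → (ℝ → Euc l) → EReal),
    (∀ t₀ : ℝ, 0 ≤ t₀ → ∀ x₀ d, InMD D d →
      IsSolutionRFDE F d t₀ x₀ (tmax t₀ x₀ d) (X t₀ x₀ d) (Φ t₀ x₀ d) ∧
      ∀ tm y ψ, IsSolutionRFDE F d t₀ x₀ tm y ψ → tm ≤ tmax t₀ x₀ d ∧
        ∀ t : ℝ, t₀ ≤ t → (t : EReal) < tm → ψ t = Φ t₀ x₀ d t) ∧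
    (∀ T, 0 ≤ T → ∀ s, 0 ≤ s → ∃ M, ∀ t₀ ∈ Icc (0:ℝ) T, ∀ ξ ∈ Icc (0:ℝ) T,
      ∀ x₀ : Hist n r, ‖x₀‖ ≤ s → ∀ d, InMD D d →
        ((t₀ + ξ : ℝ) : EReal) < tmax t₀ x₀ d ∧ ‖Φ t₀ x₀ d (t₀ + ξ)‖ ≤ M) ∧
    (∀ ε, 0 < ε →
      (∃ M, ∀ t₀ : ℝ, 0 ≤ t₀ → ∀ x₀ : Hist n r, ‖x₀‖ ≤ ε → ∀ d, InMD D d →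
        ∀ t : ℝ, t₀ ≤ t → (t : EReal) < tmax t₀ x₀ d → ‖H t (Φ t₀ x₀ d t)‖ ≤ M) ∧
      (∃ δ, 0 < δ ∧ ∀ t₀ : ℝ, 0 ≤ t₀ → ∀ x₀ : Hist n r, ‖x₀‖ ≤ δ → ∀ d, InMD D d →
        ∀ t : ℝ, t₀ ≤ t → (t : EReal) < tmax t₀ x₀ d → ‖H t (Φ t₀ x₀ d t)‖ ≤ ε)) ∧
    (∀ ε, 0 < ε → ∀ R, 0 ≤ R → ∃ τ, 0 ≤ τ ∧
      ∀ t₀ : ℝ, 0 ≤ t₀ → ∀ x₀ : Hist n r, ‖x₀‖ ≤ R → ∀ d, InMD D d →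
        ∀ t : ℝ, t₀ + τ ≤ t → (t : EReal) < tmax t₀ x₀ d → ‖H t (Φ t₀ x₀ d t)‖ ≤ ε)

/-- Hypotheses (S1)-(S7) for the control system (1.3). -/
def HypS {n l m : ℕ} {Y : Type*} [NormedAddCommGroup Y] [NormedSpace ℝ Y]
    (r : ℝ) (hr : 0 < r) (D : Set (Euc l)) (U : Set (Euc m))
    (f : ℝ → Euc l → Hist n r → Euc m → Euc n) (H : ℝ → Hist n r → Y) : Prop :=
  -- f(t,d,0,0) = 0, H(t,0) = 0
  (∀ t : ℝ, 0 ≤ t → ∀ d ∈ D, f t d 0 0 = 0) ∧ (∀ t : ℝ, 0 ≤ t → H t 0 = 0) ∧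
  -- (S1)
  (∀ t : ℝ, 0 ≤ t → ContinuousOn
    (fun p : Hist n r × Euc m × Euc l => f t p.2.2 p.1 p.2.1) (univ ×ˢ U ×ˢ D)) ∧
  (∃ L : ℝ → ℝ, ContinuousOn L (Ici 0) ∧ MonotoneOn L (Ici 0) ∧ (∀ s, 0 ≤ s → 0 ≤ L s) ∧
    ∀ t : ℝ, 0 ≤ t → ∀ x y : Hist n r, ∀ d ∈ D, ∀ u ∈ U,
      ⟪x ⟨0, ⟨by linarith, le_rfl⟩⟩ - y ⟨0, ⟨by linarith, le_rfl⟩⟩,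
        f t d x u - f t d y u⟫ ≤ L (t + ‖x‖ + ‖y‖ + ‖u‖) * ‖x - y‖ ^ 2) ∧
  -- (S2)
  (∀ T, 0 ≤ T → ∀ R, 0 ≤ R → ∀ Ru, 0 ≤ Ru → ∃ M, ∀ t ∈ Icc (0:ℝ) T, ∀ d ∈ D,
    ∀ x : Hist n r, ‖x‖ ≤ R → ∀ u ∈ U, ‖u‖ ≤ Ru → ‖f t d x u‖ ≤ M) ∧
  -- (S3)
  (∃ A : Set ℝ, A.Countable ∧ (∀ K : Set ℝ, IsCompact K → (A ∩ K).Finite) ∧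
    ContinuousOn (fun p : ℝ × Hist n r × Euc m × Euc l => f p.1 p.2.2.2 p.2.1 p.2.2.1)
      ((Ici 0 \ A) ×ˢ univ ×ˢ U ×ˢ D) ∧
    ∀ t₀ : ℝ, 0 ≤ t₀ → ∀ x : Hist n r, ∀ u ∈ U, ∀ d ∈ D,
      Tendsto (fun t => f t d x u) (𝓝[>] t₀) (𝓝 (f t₀ d x u))) ∧
  -- (S4)
  (∀ ε, 0 < ε → ∀ t : ℝ, 0 ≤ t → ∃ δ, 0 < δ ∧ ∀ τ : ℝ, 0 ≤ τ → ∀ d ∈ D, ∀ u ∈ U,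
    ∀ x : Hist n r, |τ - t| + ‖x‖ + ‖u‖ < δ → ‖f τ d x u‖ < ε) ∧
  -- (S5)
  (∃ LU : ℝ → ℝ, ContinuousOn LU (Ici 0) ∧ MonotoneOn LU (Ici 0) ∧
    (∀ s, 0 ≤ s → 0 ≤ LU s) ∧
    ∀ t : ℝ, 0 ≤ t → ∀ x : Hist n r, ∀ d ∈ D, ∀ u ∈ U, ∀ v ∈ U,
      ‖f t d x u - f t d x v‖ ≤ LU (t + ‖x‖ + ‖u‖ + ‖v‖) * ‖u - v‖) ∧
  -- (S6)
  IsCompact D ∧ D.Nonempty ∧ IsClosed U ∧ Convex ℝ U ∧ (0 : Euc m) ∈ U ∧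
  -- (S7)
  (∀ T, 0 ≤ T → ∀ R, 0 ≤ R → ∃ LH, 0 ≤ LH ∧ ∀ t ∈ Icc (0:ℝ) T, ∀ τ ∈ Icc (0:ℝ) T,
    ∀ x y : Hist n r, ‖x‖ ≤ R → ‖y‖ ≤ R →
      ‖H t x - H τ y‖ ≤ LH * (|t - τ| + ‖x - y‖))

/-- The conjunction of all requirements of Definition 4.7 for an ORCLF of system (1.3),
with all the data given explicitly. -/
def ORCLFrfde {n l m p : ℕ} {Y : Type*} [NormedAddCommGroup Y] [NormedSpace ℝ Y]
    (r : ℝ) (D : Set (Euc l)) (U : Set (Euc m))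
    (f : ℝ → Euc l → Hist n r → Euc m → Euc n) (H : ℝ → Hist n r → Y)
    (V : ℝ → Hist n r → ℝ) (a₁ a₂ β μ : ℝ → ℝ)
    (Ψ : ℝ → Euc p → Euc m → EReal) (Φ : ℝ → Hist n r → Euc p) (q ρ : ℝ → ℝ) : Prop :=
  AlmostLipschitzOn r V ∧ (∀ t x, 0 ≤ V t x) ∧
  -- property (i)
  IsKinf a₁ ∧ IsKinf a₂ ∧ IsKplus β ∧ IsKplus μ ∧
  (∀ t : ℝ, 0 ≤ t → ∀ x : Hist n r,
    max (a₁ ‖H t x‖) (a₁ (μ t * ‖x‖)) ≤ V t x ∧ V t x ≤ a₂ (β t * ‖x‖)) ∧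
  -- property (ii)
  IsClassE q ∧ IsPosDef ρ ∧
  (∀ t φ u, Ψ t φ u ≠ ⊥) ∧
  (∀ t : ℝ, 0 ≤ t → Ψ t 0 0 = 0) ∧
  (∀ u ∈ U, UpperSemicontinuousOn (fun pr : ℝ × Euc p => Ψ pr.1 pr.2 u)
    (Ici 0 ×ˢ univ)) ∧
  ContinuousOn (fun pr : ℝ × Hist n r => Φ pr.1 pr.2) (Ici 0 ×ˢ univ) ∧
  (∀ T, 0 ≤ T → ∀ R, 0 ≤ R → ∃ L, ∀ t ∈ Icc (0:ℝ) T, ∀ x y : Hist n r,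
    ‖x‖ ≤ R → ‖y‖ ≤ R → ‖Φ t x - Φ t y‖ ≤ L * ‖x - y‖) ∧
  (∀ t : ℝ, 0 ≤ t → Φ t 0 = 0) ∧
  (∀ t : ℝ, 0 ≤ t → ∀ φv : Euc p, (⨅ u : U, Ψ t φv u.1) ≤ ((q t : ℝ) : EReal)) ∧
  (∀ t : ℝ, 0 ≤ t → ∀ x : Hist n r, ∀ (N : ℕ) (u : Fin N → Euc m), (∀ i, u i ∈ U) →
    ∀ lam : Fin N → ℝ, (∀ i, 0 ≤ lam i) → (∑ i, lam i) = 1 → ∀ d ∈ D,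
      diniH V t x (f t d x (∑ i, lam i • u i)) ≤
        ((-ρ (V t x) : ℝ) : EReal) + ⨆ i, Ψ t (Φ t x) (u i))

/-- The "small-control" property of Definition 4.7. -/
def SmallControlRFDE {m p : ℕ} (U : Set (Euc m))
    (Ψ : ℝ → Euc p → Euc m → EReal) (q : ℝ → ℝ) (a γ : ℝ → ℝ) : Prop :=
  IsKinf a ∧ IsKplus γ ∧
  ∀ t : ℝ, 0 ≤ t → ∀ φv : Euc p, ∃ u ∈ U, ‖u‖ ≤ a (γ t * ‖φv‖) ∧
    Ψ t φv u ≤ ((q t : ℝ) : EReal)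

/-- A feedback k : [0,∞)×C⁰([−r,0];ℝⁿ) → U which is continuous, completely locally
Lipschitz with respect to x, and vanishes at 0. -/
def GoodFeedback {n m : ℕ} (r : ℝ) (U : Set (Euc m))
    (kf : ℝ → Hist n r → Euc m) : Prop :=
  (∀ t x, kf t x ∈ U) ∧
  ContinuousOn (fun pr : ℝ × Hist n r => kf pr.1 pr.2) (Ici 0 ×ˢ univ) ∧
  (∀ T, 0 ≤ T → ∀ R, 0 ≤ R → ∃ L, ∀ t ∈ Icc (0:ℝ) T, ∀ x y : Hist n r,
    ‖x‖ ≤ R → ‖y‖ ≤ R → ‖kf t x - kf t y‖ ≤ L * ‖x - y‖) ∧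
  (∀ t : ℝ, 0 ≤ t → kf t 0 = 0)




/-- History segment of a path. -/
def hst {n : ℕ} (r : ℝ) (x : C(ℝ, Euc n)) (t : ℝ) : Hist n r :=
  ⟨fun θ => x (t + θ), by fun_prop⟩

theorem hst_apply {n : ℕ} (r : ℝ) (x : C(ℝ, Euc n)) (t : ℝ) (θ : Icc (-r) (0:ℝ)) :
    hst r x t θ = x (t + θ) := rfl

theorem hst_continuous {n : ℕ} (r : ℝ) (x : C(ℝ, Euc n)) : Continuous (hst r x) := by
  let g : C(ℝ × Icc (-r) (0:ℝ), Euc n) := ⟨fun p => x (p.1 + p.2), by fun_prop⟩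
  exact g.curry.continuous

theorem hst_sub {n : ℕ} (r : ℝ) (x y : C(ℝ, Euc n)) (t : ℝ) :
    hst r (x - y) t = hst r x t - hst r y t := by
  ext θ; simp [hst_apply]

theorem hst_norm_le {n : ℕ} {r : ℝ} {x : C(ℝ, Euc n)} {t C : ℝ} (hC : 0 ≤ C)
    (h : ∀ s ∈ Icc (t - r) t, ‖x s‖ ≤ C) : ‖hst r x t‖ ≤ C := by
  rw [ContinuousMap.norm_le _ hC]
  intro θ
  rw [hst_apply]
  have := θ.2
  exact h _ ⟨by linarith [this.1], by linarith [this.2]⟩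

theorem norm_le_hst {n : ℕ} {r : ℝ} (x : C(ℝ, Euc n)) {t s : ℝ} (h : s ∈ Icc (t - r) t) :
    ‖x s‖ ≤ ‖hst r x t‖ := by
  have := (hst r x t).norm_coe_le_norm ⟨s - t, by constructor <;> linarith [h.1, h.2]⟩
  rw [hst_apply] at this
  simpa using this

theorem ineq_of_ae_deriv {w c : ℝ → ℝ} {a b : ℝ} (hab : a ≤ b) {K : NNReal}
    (hw : LipschitzOnWith K w (Icc a b)) (hc : IntervalIntegrable c volume a b)
    (h : ∀ᵐ t, t ∈ Ioo a b → ∀ w', HasDerivAt w w' t → w' ≤ c t) :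
    w b - w a ≤ ∫ t in a..b, c t := by
  rw [← uIcc_of_le hab] at hw
  have hac := hw.absolutelyContinuousOnInterval
  rw [← hac.integral_deriv_eq_sub]
  apply intervalIntegral.integral_mono_ae_restrict hab hac.intervalIntegrable_deriv hc
  rw [Filter.EventuallyLE, ae_restrict_iff' measurableSet_Icc]
  have h₁ : ∀ᵐ x : ℝ, x ≠ a := by simp [ae_iff, measure_singleton]
  have h₂ : ∀ᵐ x : ℝ, x ≠ b := by simp [ae_iff, measure_singleton]
  filter_upwards [h, hac.ae_differentiableAt, h₁, h₂] with t ht hd ha hb hm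
  exact ht ⟨lt_of_le_of_ne hm.1 (Ne.symm ha), lt_of_le_of_ne hm.2 hb⟩ _
    (hd (by rwa [uIcc_of_le hab])).hasDerivAt

theorem path_sub {n : ℕ} {x : ℝ → Euc n} {g : ℝ → Euc n} {t0 t1 : ℝ}
    (i1 : IntervalIntegrable g volume t0 t1)
    (hx : ∀ t ∈ Icc t0 t1, x t = x t0 + ∫ s in t0..t, g s) {s t : ℝ}
    (hs : s ∈ Icc t0 t1) (ht : t ∈ Icc t0 t1) :
    x t - x s = ∫ u in s..t, g u := by
  have h01 : t0 ≤ t1 := hs.1.trans hs.2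
  have sub : ∀ u ∈ Icc t0 t1, IntervalIntegrable g volume t0 u := fun u hu => by
    apply i1.mono_set
    rw [uIcc_of_le h01, uIcc_of_le hu.1]
    exact Icc_subset_Icc le_rfl hu.2
  rw [hx t ht, hx s hs, add_sub_add_left_eq_sub,
    intervalIntegral.integral_interval_sub_left (sub t ht) (sub s hs)]

theorem path_lip {n : ℕ} {x : ℝ → Euc n} {g : ℝ → Euc n} {t0 t1 M : ℝ}
    (i1 : IntervalIntegrable g volume t0 t1)
    (hx : ∀ t ∈ Icc t0 t1, x t = x t0 + ∫ s in t0..t, g s)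
    (hM : ∀ s ∈ Icc t0 t1, ‖g s‖ ≤ M) {s t : ℝ}
    (hs : s ∈ Icc t0 t1) (ht : t ∈ Icc t0 t1) :
    ‖x t - x s‖ ≤ M * |t - s| := by
  rw [path_sub i1 hx hs ht]
  apply intervalIntegral.norm_integral_le_of_norm_le_const
  intro u hu
  apply hM
  rw [uIoc, mem_Ioc] at hu
  exact ⟨le_trans (le_min hs.1 ht.1) hu.1.le, hu.2.trans (max_le hs.2 ht.2)⟩

theorem path_deriv {n : ℕ} {x : ℝ → Euc n} {g : ℝ → Euc n} {t0 t1 : ℝ} (h01 : t0 ≤ t1)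
    (i1 : IntervalIntegrable g volume t0 t1)
    (hx : ∀ t ∈ Icc t0 t1, x t = x t0 + ∫ s in t0..t, g s) :
    ∀ᵐ t, t ∈ Ioo t0 t1 → HasDerivAt x (g t) t := by
  filter_upwards [i1.ae_hasDerivAt_integral] with t ht hm
  have h1 := ht (by rw [uIcc_of_le h01]; exact Ioo_subset_Icc_self hm) t0 left_mem_uIcc
  have h2 := h1.const_add (x t0)
  apply h2.congr_of_eventuallyEq
  filter_upwards [Ioo_mem_nhds hm.1 hm.2] with s hs
  exact hx s (Ioo_subset_Icc_self hs)

theorem gron_core {n : ℕ} {r : ℝ} (hr : 0 < r) {z : C(ℝ, Euc n)} {t0 t1 : ℝ}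
    {g : ℝ → Euc n} {M L e : ℝ} (hM : ∀ s ∈ Icc t0 t1, ‖g s‖ ≤ M)
    (i1 : IntervalIntegrable g volume t0 t1)
    (hz : ∀ t ∈ Icc t0 t1, z t = z t0 + ∫ s in t0..t, g s)
    (hL : 0 ≤ L) (he : 0 ≤ e)
    (hin : ∀ᵐ s, s ∈ Ioo t0 t1 → ⟪z s, g s⟫ ≤ L * ‖hst r z s‖ ^ 2 + e) :
    ∀ t ∈ Icc t0 t1, ‖hst r z t‖ ^ 2 ≤
      (‖hst r z t0‖ ^ 2 + 2 * e * (t1 - t0)) * Real.exp (2 * L * (t - t0)) := by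
  rcases lt_or_ge t1 t0 with h10 | h01
  · intro t ht; exact absurd (ht.1.trans ht.2) (not_le.2 h10)
  set N : ℝ → ℝ := fun s => ‖hst r z s‖ ^ 2 with hN
  have Nc : Continuous N := by
    have := hst_continuous r z
    fun_prop
  have hM0 : 0 ≤ M := (norm_nonneg _).trans (hM t0 ⟨le_rfl, h01⟩)
  -- bound on z
  obtain ⟨B, hB⟩ := (isCompact_Icc (a := t0) (b := t1)).exists_bound_of_continuousOn
    z.continuous.continuousOn
  have hB0 : 0 ≤ B := (norm_nonneg _).trans (hB t0 ⟨le_rfl, h01⟩)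
  have wl : LipschitzOnWith (Real.toNNReal (2 * B * M)) (fun s => ‖z s‖ ^ 2) (Icc t0 t1) := by
    apply LipschitzOnWith.of_dist_le_mul
    intro s hs t ht
    rw [Real.coe_toNNReal _ (by positivity), Real.dist_eq, Real.dist_eq]
    have h1 := path_lip i1 hz hM ht hs
    have h2 : ‖z s‖ ^ 2 - ‖z t‖ ^ 2 = (‖z s‖ + ‖z t‖) * (‖z s‖ - ‖z t‖) := by ring
    rw [h2, abs_mul, abs_of_nonneg (by positivity : 0 ≤ ‖z s‖ + ‖z t‖)]
    calc (‖z s‖ + ‖z t‖) * |‖z s‖ - ‖z t‖| ≤ (B + B) * (M * |s - t|) := by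
          apply mul_le_mul (add_le_add (hB s hs) (hB t ht))
            ((abs_norm_sub_norm_le _ _).trans h1) (abs_nonneg _) (by positivity)
      _ = _ := by ring
  have key : ∀ s ∈ Icc t0 t1, ‖z s‖ ^ 2 ≤ N t0 + 2 * e * (t1 - t0) +
      ∫ u in t0..s, 2 * L * N u := by
    intro s hs
    have h1 : (fun s => ‖z s‖ ^ 2) s - (fun s => ‖z s‖ ^ 2) t0 ≤
        ∫ u in t0..s, (2 * L * N u + 2 * e) := by
      apply ineq_of_ae_deriv hs.1 (wl.mono (Icc_subset_Icc le_rfl hs.2))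
      · exact Continuous.intervalIntegrable (by fun_prop) _ _
      · filter_upwards [hin, path_deriv h01 i1 hz] with u hu hd hm w' hw'
        have hm' : u ∈ Ioo t0 t1 := ⟨hm.1, hm.2.trans_le hs.2⟩
        have h3 := (hd hm').norm_sq
        rw [hw'.unique h3]
        linarith [hu hm']
    rw [intervalIntegral.integral_add (Continuous.intervalIntegrable (by fun_prop) _ _)
      (by simp), intervalIntegral.integral_const] at h1
    have h2 : ‖z t0‖ ^ 2 ≤ N t0 := by
      have := norm_le_hst (r := r) z (t := t0) (s := t0) ⟨by linarith, le_rfl⟩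
      simp only [hN]; gcongr
    have h3 : (s - t0) • (2 * e) ≤ 2 * e * (t1 - t0) := by
      rw [smul_eq_mul]; nlinarith [hs.2]
    simp only at h1
    linarith
  set I : ℝ → ℝ := fun t => N t0 + 2 * e * (t1 - t0) + ∫ u in t0..t, 2 * L * N u with hI
  have NI : ∀ t ∈ Icc t0 t1, N t ≤ I t := by
    intro t ht
    have hn : ∀ s t, s ≤ t → 0 ≤ ∫ u in s..t, 2 * L * N u := fun s t hst => by
      apply intervalIntegral.integral_nonneg hst
      intro u _; simp only [hN]; positivity
    have hI0 : N t0 ≤ I t := by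
      have := hn t0 t ht.1
      have : 0 ≤ 2 * e * (t1 - t0) := mul_nonneg (by linarith) (by linarith)
      simp only [hI]; linarith
    have hIn : 0 ≤ I t := le_trans (by simp only [hN]; positivity) hI0
    have : ‖hst r z t‖ ≤ Real.sqrt (I t) := by
      apply hst_norm_le (Real.sqrt_nonneg _)
      intro s hs
      apply Real.le_sqrt_of_sq_le
      rcases le_total s t0 with h | h
      · refine le_trans ?_ hI0
        have := norm_le_hst (r := r) z (t := t0) (s := s) ⟨by linarith [hs.1, ht.1], h⟩
        simp only [hN]; gcongr
      · refine (key s ⟨h, hs.2.trans ht.2⟩).trans ?_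
        have h5 := hn s t hs.2
        have h6 : (∫ u in t0..s, 2 * L * N u) + ∫ u in s..t, 2 * L * N u =
            ∫ u in t0..t, 2 * L * N u :=
          intervalIntegral.integral_add_adjacent_intervals
            (Continuous.intervalIntegrable (by fun_prop) _ _)
            (Continuous.intervalIntegrable (by fun_prop) _ _)
        simp only [hI]; linarith
    have h7 : N t ≤ Real.sqrt (I t) ^ 2 := by simp only [hN]; gcongr
    rwa [Real.sq_sqrt hIn] at h7
  have Id : ∀ t, HasDerivAt I (2 * L * N t) t := by
    intro t
    have hc : Continuous (fun u => 2 * L * N u) := by fun_prop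
    have := (hc.integral_hasStrictDerivAt t0 t).hasDerivAt
    exact this.const_add _
  intro t ht
  have := le_gronwallBound_of_liminf_deriv_right_le (f := I) (f' := fun t => 2 * L * N t)
    (δ := I t0) (K := 2 * L) (ε := 0) (a := t0) (b := t1)
    (fun t _ => (Id t).continuousAt.continuousWithinAt)
    (fun x _ r hr' => ((Id x).hasDerivWithinAt.liminf_right_slope_le hr'))
    le_rfl (fun x hx => by
      have := NI x ⟨hx.1, hx.2.le⟩
      have : 2 * L * N x ≤ 2 * L * I x := by gcongr
      linarith) t ht
  rw [gronwallBound_ε0] at this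
  have h8 : I t0 = N t0 + 2 * e * (t1 - t0) := by simp [hI]
  rw [h8] at this
  exact (NI t ht).trans this


/-- The point 0 of the history interval. -/
def zz {r : ℝ} (hr : 0 < r) : Icc (-r) (0:ℝ) := ⟨0, ⟨by linarith, le_rfl⟩⟩

theorem bdd_ii {E : Type*} [NormedAddCommGroup E] {g : ℝ → E} {M : ℝ}
    (hm : AEStronglyMeasurable g volume) (hM : ∀ s, ‖g s‖ ≤ M) (a b : ℝ) :
    IntervalIntegrable g volume a b := by
  rw [intervalIntegrable_iff]
  exact Measure.integrableOn_of_bounded (M := M) (by simp) hm (ae_of_all _ hM)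

/-- constant extension of the initial history -/
def ext0 {n : ℕ} {r : ℝ} (hr : 0 < r) (x0 : Hist n r) (t0 : ℝ) : C(ℝ, Euc n) :=
  ⟨fun t => x0 (projIcc (-r) 0 (by linarith) (t - t0)), by fun_prop⟩

section Exist

variable {n : ℕ} {r : ℝ} (hr : 0 < r) (G : ℝ → Hist n r → Euc n) (x0 : Hist n r) (t0 : ℝ)

theorem ext0_hst : hst r (ext0 hr x0 t0) t0 = x0 := by
  ext1 θ
  rw [hst_apply]
  change x0 (projIcc (-r) 0 _ (t0 + θ - t0)) = x0 θ
  rw [add_sub_cancel_left, projIcc_val]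

theorem ext0_uc : UniformContinuous (ext0 hr x0 t0) := by
  have h1 : UniformContinuous x0 := CompactSpace.uniformContinuous_of_continuous x0.continuous
  have h2 : UniformContinuous (fun t : ℝ => projIcc (-r) 0 (by linarith : -r ≤ 0) (t - t0)) :=
    (LipschitzWith.projIcc (by linarith)).uniformContinuous.comp
      (uniformContinuous_id.sub uniformContinuous_const)
  exact h1.comp h2

variable {G}

theorem del_exists (hm : ∀ φ : ℝ → Hist n r, Continuous φ →
      AEStronglyMeasurable (fun s => G s (φ s)) volume) {M : ℝ} (hM : ∀ s x, ‖G s x‖ ≤ M)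
    {ε : ℝ} (hε : 0 < ε) (t1 : ℝ) :
    ∃ x : C(ℝ, Euc n), ∀ t ≤ t1, x t = ext0 hr x0 t0 t +
      ∫ s in t0..(max t t0), G s (hst r x (s - ε)) := by
  have mm : ∀ x : C(ℝ, Euc n), AEStronglyMeasurable (fun s => G s (hst r x (s - ε))) volume :=
    fun x => hm (fun s => hst r x (s - ε)) ((hst_continuous r x).comp (by fun_prop))
  have cc : ∀ x : C(ℝ, Euc n), Continuous (fun t => ext0 hr x0 t0 t +
      ∫ s in t0..(max t t0), G s (hst r x (s - ε))) := by
    intro x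
    have h1 := intervalIntegral.continuous_primitive
      (fun a b => bdd_ii (mm x) (fun s => hM s _) a b) t0
    exact (ext0 hr x0 t0).continuous.add (h1.comp (by fun_prop))
  let T : C(ℝ, Euc n) → C(ℝ, Euc n) := fun x => ⟨_, cc x⟩
  have Tap : ∀ x t, T x t = ext0 hr x0 t0 t + ∫ s in t0..(max t t0), G s (hst r x (s - ε)) :=
    fun x t => rfl
  have st : ∀ k : ℕ, ∀ t ≤ t0 + k * ε, (T^[k+1] (ext0 hr x0 t0)) t = (T^[k] (ext0 hr x0 t0)) t := by
    intro k
    induction k with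
    | zero =>
      intro t ht
      simp only [CharP.cast_eq_zero, zero_mul, add_zero] at ht
      simp [Tap, max_eq_right ht]
    | succ k ih =>
      intro t ht
      rw [Function.iterate_succ_apply', Function.iterate_succ_apply' (n := k), Tap, Tap]
      congr 1
      rcases le_total t t0 with h | h
      · rw [max_eq_right h]; simp
      rw [max_eq_left h]
      apply intervalIntegral.integral_congr
      intro s hs
      rw [uIcc_of_le h] at hs
      have : hst r (T^[k+1] (ext0 hr x0 t0)) (s - ε) = hst r (T^[k] (ext0 hr x0 t0)) (s - ε) := by
        ext1 θ
        rw [hst_apply, hst_apply]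
        apply ih
        have := θ.2.2
        push_cast at ht
        linarith [hs.2]
      rw [Function.iterate_succ_apply'] at this
      simp only [this]
  obtain ⟨N, hN⟩ := exists_nat_gt ((t1 - t0) / ε)
  rw [div_lt_iff₀ hε] at hN
  refine ⟨T^[N] (ext0 hr x0 t0), fun t ht => ?_⟩
  rw [← Tap, ← Function.iterate_succ_apply' T]
  exact (st N t (by linarith)).symm

theorem exists_sol (hm : ∀ φ : ℝ → Hist n r, Continuous φ →
      AEStronglyMeasurable (fun s => G s (φ s)) volume) {M L : ℝ} (hM : ∀ s x, ‖G s x‖ ≤ M)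
    (hL : 0 ≤ L)
    (hosl : ∀ s x y, ⟪x (zz hr) - y (zz hr), G s x - G s y⟫ ≤ L * ‖x - y‖ ^ 2)
    (hc : ∀ s, Continuous (G s)) {t1 : ℝ} (h01 : t0 ≤ t1) :
    ∃ x : C(ℝ, Euc n), hst r x t0 = x0 ∧
      ∀ t ∈ Icc t0 t1, x t = x t0 + ∫ s in t0..t, G s (hst r x s) := by
  have hM0 : 0 ≤ M := (norm_nonneg _).trans (hM 0 0)
  let ε : ℕ → ℝ := fun j => 1 / ((j : ℝ) + 1)
  have εpos : ∀ j, 0 < ε j := fun j => by simp only [ε]; positivity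
  have εlim : Tendsto ε atTop (𝓝 0) := tendsto_one_div_add_atTop_nhds_zero_nat
  choose x hx using fun j => del_exists hr x0 t0 hm hM (εpos j) t1
  have mm : ∀ j, AEStronglyMeasurable (fun s => G s (hst r (x j) (s - ε j))) volume :=
    fun j => hm (fun s => hst r (x j) (s - ε j)) ((hst_continuous r _).comp (by fun_prop))
  have ii : ∀ j a b, IntervalIntegrable (fun s => G s (hst r (x j) (s - ε j))) volume a b :=
    fun j a b => bdd_ii (mm j) (fun s => hM s _) a b
  have xinit : ∀ j, ∀ t ≤ t0, x j t = ext0 hr x0 t0 t := by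
    intro j t ht
    rw [hx j t (ht.trans h01), max_eq_right ht]; simp
  have extc : ∀ t, t0 ≤ t → ext0 hr x0 t0 t = ext0 hr x0 t0 t0 := by
    intro t ht
    change x0 (projIcc (-r) 0 _ (t - t0)) = x0 (projIcc (-r) 0 _ (t0 - t0))
    rw [projIcc_of_right_le _ (by linarith), projIcc_of_right_le _ (by linarith)]
  have xeq : ∀ j, ∀ t ∈ Icc t0 t1, x j t = x j t0 + ∫ s in t0..t, G s (hst r (x j) (s - ε j)) := by
    intro j t ht
    rw [hx j t ht.2, max_eq_left ht.1, xinit j t0 le_rfl, extc t ht.1]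
  -- modulus
  have modu : ∀ η > 0, ∀ᶠ j in atTop, ∀ u ≤ t1, ‖x j u - x j (u - ε j)‖ ≤ η := by
    intro η hη
    obtain ⟨δ, hδ, hu⟩ := Metric.uniformContinuous_iff.1 (ext0_uc hr x0 t0) (η / 2) (by positivity)
    have e1 : ∀ᶠ j in atTop, ε j < δ := εlim.eventually_lt_const hδ
    have e2 : ∀ᶠ j in atTop, M * ε j < η / 2 := by
      have : Tendsto (fun j => M * ε j) atTop (𝓝 (M * 0)) := εlim.const_mul M
      rw [mul_zero] at this
      exact this.eventually_lt_const (by positivity)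
    filter_upwards [e1, e2] with j h1 h2 u hu1
    have hej := εpos j
    rw [hx j u hu1, hx j (u - ε j) (by linarith), add_sub_add_comm,
      intervalIntegral.integral_interval_sub_left (ii j _ _) (ii j _ _)]
    refine (norm_add_le _ _).trans ?_
    have h3 : ‖ext0 hr x0 t0 u - ext0 hr x0 t0 (u - ε j)‖ < η / 2 := by
      rw [← dist_eq_norm]
      apply hu
      rw [Real.dist_eq]; simpa [abs_of_pos hej] using h1
    have h4 := intervalIntegral.norm_integral_le_of_norm_le_const
      (f := fun s => G s (hst r (x j) (s - ε j))) (a := max (u - ε j) t0) (b := max u t0)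
      (C := M) (fun s _ => hM s _)
    have h5 : |max u t0 - max (u - ε j) t0| ≤ ε j := by
      refine (abs_max_sub_max_le_abs _ _ _).trans ?_
      simp [abs_of_pos hej]
    have h6 : M * |max u t0 - max (u - ε j) t0| ≤ M * ε j := by gcongr
    linarith
  have hmod : ∀ η > 0, ∀ᶠ j in atTop, ∀ u ≤ t1, ‖hst r (x j) u - hst r (x j) (u - ε j)‖ ≤ η := by
    intro η hη
    filter_upwards [modu η hη] with j hj u hu
    rw [ContinuousMap.norm_le _ hη.le]
    intro θ
    have := hj (u + θ) (by linarith [θ.2.2])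
    rw [ContinuousMap.sub_apply, hst_apply, hst_apply]
    have e : u - ε j + (θ:ℝ) = u + θ - ε j := by ring
    rw [e]
    exact this
  -- Cauchy
  have cau : ∀ η > 0, ∃ J : ℕ, ∀ j ≥ J, ∀ k ≥ J, ∀ t ≤ t1, ‖x j t - x k t‖ < η := by
    intro η hη
    have lim : Tendsto (fun a : ℝ => 2 * (8 * L * a ^ 2 + 4 * M * a) * (t1 - t0) *
        Real.exp (2 * (2 * L) * (t1 - t0))) (𝓝[>] 0) (𝓝 0) := by
      have : Continuous (fun a : ℝ => 2 * (8 * L * a ^ 2 + 4 * M * a) * (t1 - t0) *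
        Real.exp (2 * (2 * L) * (t1 - t0))) := by fun_prop
      have h := this.tendsto 0
      simp only [ne_eq, OfNat.ofNat_ne_zero, not_false_eq_true, zero_pow, mul_zero, add_zero,
        zero_mul] at h
      exact h.mono_left nhdsWithin_le_nhds
    obtain ⟨a, ha1, ha0⟩ := ((lim.eventually_lt_const (by positivity : 0 < η ^ 2)).and
      self_mem_nhdsWithin).exists
    obtain ⟨J1, hJ1⟩ := eventually_atTop.1 (modu a ha0)
    obtain ⟨J2, hJ2⟩ := eventually_atTop.1 (hmod a ha0)
    have ha0' : 0 < a := ha0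
    refine ⟨max J1 J2, fun j hj k hk t ht => ?_⟩
    rcases le_total t t0 with h | h
    · rw [xinit j t h, xinit k t h]; simpa using hη
    have hz0 : hst r (x j - x k) t0 = 0 := by
      ext1 θ
      rw [hst_apply, ContinuousMap.sub_apply, xinit j _ (by linarith [θ.2.2]),
        xinit k _ (by linarith [θ.2.2])]
      simp
    have := gron_core hr (z := x j - x k) (t0 := t0) (t1 := t1)
      (g := fun s => G s (hst r (x j) (s - ε j)) - G s (hst r (x k) (s - ε k)))
      (M := M + M) (L := 2 * L) (e := 8 * L * a ^ 2 + 4 * M * a)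
      (fun s _ => (norm_sub_le _ _).trans (add_le_add (hM _ _) (hM _ _)))
      ((ii j _ _).sub (ii k _ _))
      (fun t ht => by
        rw [intervalIntegral.integral_sub (ii j _ _) (ii k _ _), ContinuousMap.sub_apply,
          ContinuousMap.sub_apply, xeq j t ht, xeq k t ht]
        abel) (by positivity) (by positivity)
      (ae_of_all _ fun s hs => by
        have hs1 : s ≤ t1 := hs.2.le
        set A := hst r (x j) (s - ε j)
        set B := hst r (x k) (s - ε k)
        have q1 := hJ2 j (le_of_max_le_right hj) s hs1
        have q2 := hJ2 k (le_of_max_le_right hk) s hs1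
        have q3 := hJ1 j (le_of_max_le_left hj) s hs1
        have q4 := hJ1 k (le_of_max_le_left hk) s hs1
        have A0 : A (zz hr) = x j (s - ε j) := by simp [A, hst_apply, zz]
        have B0 : B (zz hr) = x k (s - ε k) := by simp [B, hst_apply, zz]
        have p1 : ⟪(x j - x k) s, G s A - G s B⟫ = ⟪A (zz hr) - B (zz hr), G s A - G s B⟫ +
            ⟪(x j s - x j (s - ε j)) - (x k s - x k (s - ε k)), G s A - G s B⟫ := by
          rw [← inner_add_left, A0, B0, ContinuousMap.sub_apply]
          congr 1; abel
        have p2 : ⟪(x j s - x j (s - ε j)) - (x k s - x k (s - ε k)), G s A - G s B⟫ ≤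
            (a + a) * (M + M) := by
          refine (real_inner_le_norm _ _).trans ?_
          apply mul_le_mul ((norm_sub_le _ _).trans (add_le_add q3 q4))
            ((norm_sub_le _ _).trans (add_le_add (hM _ _) (hM _ _))) (norm_nonneg _)
            (by positivity)
        have p3 : ‖A - B‖ ≤ ‖hst r (x j - x k) s‖ + 2 * a := by
          have : A - B = hst r (x j - x k) s - ((hst r (x j) s - A) - (hst r (x k) s - B)) := by
            rw [hst_sub]; abel
          rw [this]
          refine (norm_sub_le _ _).trans ?_
          have := norm_sub_le (hst r (x j) s - A) (hst r (x k) s - B)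
          linarith
        have p4 : ‖A - B‖ ^ 2 ≤ 2 * ‖hst r (x j - x k) s‖ ^ 2 + 8 * a ^ 2 := by
          have : ‖A - B‖ ^ 2 ≤ (‖hst r (x j - x k) s‖ + 2 * a) ^ 2 := by gcongr
          nlinarith [sq_nonneg (‖hst r (x j - x k) s‖ - 2 * a)]
        have p5 : L * ‖A - B‖ ^ 2 ≤ L * (2 * ‖hst r (x j - x k) s‖ ^ 2 + 8 * a ^ 2) := by gcongr
        have p6 := hosl s A B
        rw [p1]
        linarith) t ⟨h, ht⟩
    rw [hz0] at this
    simp only [norm_zero, ne_eq, OfNat.ofNat_ne_zero, not_false_eq_true, zero_pow, zero_add]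
      at this
    have h9 : Real.exp (2 * (2 * L) * (t - t0)) ≤ Real.exp (2 * (2 * L) * (t1 - t0)) := by
      gcongr
    have h10 : ‖hst r (x j - x k) t‖ ^ 2 < η ^ 2 := by
      refine this.trans_lt (lt_of_le_of_lt ?_ ha1)
      have : 0 ≤ t1 - t0 := by linarith
      gcongr
    have h11 := norm_le_hst (r := r) (x j - x k) (t := t) (s := t) ⟨by linarith, le_rfl⟩
    rw [ContinuousMap.sub_apply] at h11
    exact h11.trans_lt (lt_of_pow_lt_pow_left₀ 2 hη.le h10)
  -- limit
  have uc : UniformCauchySeqOn (fun j t => x j (min t t1)) atTop univ := by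
    rw [Metric.uniformCauchySeqOn_iff]
    intro η hη
    obtain ⟨J, hJ⟩ := cau η hη
    exact ⟨J, fun j hj k hk t _ => by rw [dist_eq_norm]; exact hJ j hj k hk _ (min_le_right _ _)⟩
  have pt : ∀ t : ℝ, ∃ y, Tendsto (fun j => x j (min t t1)) atTop (𝓝 y) :=
    fun t => cauchySeq_tendsto_of_complete (uc.cauchySeq (mem_univ t))
  choose y hy using pt
  have tu := uc.tendstoUniformlyOn_of_tendsto (fun t _ => hy t)
  have yc : Continuous y := by
    rw [← continuousOn_univ]
    exact tu.continuousOn (Frequently.of_forall fun j =>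
      ((x j).continuous.comp (by fun_prop)).continuousOn)
  let Y : C(ℝ, Euc n) := ⟨y, yc⟩
  have Yl : ∀ t ≤ t1, Tendsto (fun j => x j t) atTop (𝓝 (Y t)) := by
    intro t ht
    have := hy t
    rwa [min_eq_left ht] at this
  have Yu : ∀ η > 0, ∀ᶠ j in atTop, ∀ t ≤ t1, ‖Y t - x j t‖ ≤ η := by
    intro η hη
    rw [Metric.tendstoUniformlyOn_iff] at tu
    filter_upwards [tu η hη] with j hj t ht
    have := hj t (mem_univ _)
    rw [min_eq_left ht, dist_eq_norm] at this
    exact this.le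
  have hYl : ∀ s ≤ t1, Tendsto (fun j => hst r (x j) (s - ε j)) atTop (𝓝 (hst r Y s)) := by
    intro s hs
    rw [Metric.tendsto_atTop']
    intro η hη
    obtain ⟨J, hJ⟩ := eventually_atTop.1 ((hmod (η / 3) (by positivity)).and
      (Yu (η / 3) (by positivity)))
    refine ⟨J, fun j hj => ?_⟩
    have h1 := (hJ j hj.le).1 s hs
    have h2 : ‖hst r Y s - hst r (x j) s‖ ≤ η / 3 := by
      rw [← hst_sub]
      apply hst_norm_le (by positivity)
      intro u hu
      exact (hJ j hj.le).2 u (hu.2.trans hs)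
    rw [dist_eq_norm]
    have : hst r (x j) (s - ε j) - hst r Y s =
      -(hst r (x j) s - hst r (x j) (s - ε j)) - (hst r Y s - hst r (x j) s) := by abel
    rw [this]
    refine (norm_sub_le _ _).trans_lt ?_
    rw [norm_neg]
    linarith
  have Yinit : ∀ t ≤ t0, Y t = ext0 hr x0 t0 t := by
    intro t ht
    refine tendsto_nhds_unique (Yl t (ht.trans h01)) ?_
    simp only [xinit _ t ht]
    exact tendsto_const_nhds
  refine ⟨Y, ?_, ?_⟩
  · rw [← ext0_hst hr x0 t0]
    ext1 θ
    rw [hst_apply, Yinit _ (by linarith [θ.2.2]), ext0_hst]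
    rw [← hst_apply, ext0_hst]
  · intro t ht
    refine tendsto_nhds_unique (Yl t ht.2) ?_
    have e1 : (fun j => x j t) =
      fun j => x j t0 + ∫ s in t0..t, G s (hst r (x j) (s - ε j)) := by
      funext j; exact xeq j t ht
    rw [e1]
    apply (Yl t0 h01).add
    apply intervalIntegral.tendsto_integral_filter_of_dominated_convergence (fun _ => M)
    · exact Eventually.of_forall fun j => (mm j).restrict
    · exact Eventually.of_forall fun j => ae_of_all _ fun s _ => hM s _
    · simp
    · refine ae_of_all _ fun s hs => ?_
      rw [uIoc_of_le ht.1] at hs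
      exact ((hc s).tendsto _).comp (hYl s (hs.2.trans ht.2))
end Exist


/-- Properties of the closed-loop right-hand side. -/
structure CL {n l : ℕ} {r : ℝ} (hr : 0 < r) (D : Set (Euc l))
    (F : ℝ → Euc l → Hist n r → Euc n) : Prop where
  zero : ∀ t, 0 ≤ t → ∀ d ∈ D, F t d 0 = 0
  osl : ∀ R, 0 ≤ R → ∃ L, 0 ≤ L ∧ ∀ t ∈ Icc (0:ℝ) R, ∀ d ∈ D, ∀ x y : Hist n r, ‖x‖ ≤ R →
    ‖y‖ ≤ R → ⟪x (zz hr) - y (zz hr), F t d x - F t d y⟫ ≤ L * ‖x - y‖ ^ 2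
  bdd : ∀ R, 0 ≤ R → ∃ M, 0 ≤ M ∧ ∀ t ∈ Icc (0:ℝ) R, ∀ d ∈ D, ∀ x : Hist n r, ‖x‖ ≤ R →
    ‖F t d x‖ ≤ M
  cont : ∀ t, 0 ≤ t → ∀ d ∈ D, Continuous (F t d)
  meas : ∀ d, InMD D d → ∀ φ : ℝ → Hist n r, Continuous φ →
    AEStronglyMeasurable (fun s => F s (d s) (φ s)) (volume.restrict (Ici 0))
  right : ∀ t, 0 ≤ t → ∀ d ∈ D, ∀ x : Hist n r, ∀ φ : ℝ → Hist n r,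
    Tendsto φ (𝓝[>] t) (𝓝 x) → Tendsto (fun s => F s d (φ s)) (𝓝[>] t) (𝓝 (F t d x))

theorem kf_bound {n m : ℕ} {r : ℝ} {U : Set (Euc m)} {kf : ℝ → Hist n r → Euc m}
    (hk : GoodFeedback r U kf) (R : ℝ) (hR : 0 ≤ R) : ∃ L, 0 ≤ L ∧
    (∀ t ∈ Icc (0:ℝ) R, ∀ x y : Hist n r, ‖x‖ ≤ R → ‖y‖ ≤ R →
      ‖kf t x - kf t y‖ ≤ L * ‖x - y‖) ∧
    (∀ t ∈ Icc (0:ℝ) R, ∀ x : Hist n r, ‖x‖ ≤ R → ‖kf t x‖ ≤ L * R) := by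
  obtain ⟨L, hL⟩ := hk.2.2.1 R hR R hR
  have key : ∀ t ∈ Icc (0:ℝ) R, ∀ x y : Hist n r, ‖x‖ ≤ R → ‖y‖ ≤ R →
      ‖kf t x - kf t y‖ ≤ |L| * ‖x - y‖ := fun t ht x y hx hy =>
    (hL t ht x y hx hy).trans (by gcongr; exact le_abs_self L)
  refine ⟨|L|, abs_nonneg _, key, fun t ht x hx => ?_⟩
  have := key t ht x 0 hx (by simpa using hR)
  rw [hk.2.2.2 t ht.1, sub_zero, sub_zero] at this
  exact this.trans (by gcongr)

theorem euc_tendsto {n : ℕ} {ι : Type*} {lf : Filter ι} {g : ι → Euc n} {y : Euc n}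
    (h : ∀ e : Euc n, ∀ η > 0, ∀ᶠ s in lf, ⟪e, g s - y⟫ ≤ η) : Tendsto g lf (𝓝 y) := by
  have h1 : ∀ e : Euc n, Tendsto (fun s => ⟪e, g s - y⟫) lf (𝓝 0) := by
    intro e
    rw [Metric.tendsto_nhds]
    intro η hη
    filter_upwards [h e (η/2) (by positivity), h (-e) (η/2) (by positivity)] with s a b
    rw [inner_neg_left] at b
    rw [Real.dist_eq, sub_zero, abs_lt]
    constructor <;> linarith
  rw [tendsto_iff_norm_sub_tendsto_zero]
  have h2 : Tendsto (fun s => ∑ i : Fin n, ⟪EuclideanSpace.single i (1:ℝ), g s - y⟫ ^ 2) lf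
      (𝓝 0) := by
    have := tendsto_finsetSum (Finset.univ : Finset (Fin n))
      (fun i _ => (h1 (EuclideanSpace.single i (1:ℝ))).pow 2)
    simpa using this
  have h3 := h2.sqrt
  rw [Real.sqrt_zero] at h3
  refine h3.congr fun s => ?_
  rw [EuclideanSpace.norm_eq]
  congr 1
  refine Finset.sum_congr rfl fun i _ => ?_
  simp [EuclideanSpace.inner_single_left]

theorem CL_of {n l m : ℕ} {Y : Type*} [NormedAddCommGroup Y] [NormedSpace ℝ Y]
    {r : ℝ} (hr : 0 < r) {D : Set (Euc l)} {U : Set (Euc m)}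
    {f : ℝ → Euc l → Hist n r → Euc m → Euc n} {H : ℝ → Hist n r → Y}
    (hS : HypS r hr D U f H) {kf : ℝ → Hist n r → Euc m} (hk : GoodFeedback r U kf) :
    CL hr D (fun t d x => f t d x (kf t x)) := by
  obtain ⟨f0, H0, S1c, ⟨L, Lc, Lm, L0, hL⟩, S2, ⟨A, Ac, Af, S3c, S3r⟩, S4, ⟨LU, LUc, LUm, LU0, hLU⟩,
    Dc, Dn, Ucl, Ucv, U0, S7⟩ := hS
  have kU := hk.1
  refine ⟨?_, ?_, ?_, ?_, ?_, ?_⟩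
  · intro t ht d hd
    simp only [hk.2.2.2 t ht, f0 t ht d hd]
  · intro R hR
    obtain ⟨K, hK, k1, k2⟩ := kf_bound hk R hR
    have a1 : 0 ≤ 3 * R + K * R := by positivity
    have a2 : 0 ≤ 2 * R + 2 * (K * R) := by positivity
    refine ⟨L (3 * R + K * R) + LU (2 * R + 2 * (K * R)) * K,
      add_nonneg (L0 _ a1) (mul_nonneg (LU0 _ a2) hK), ?_⟩
    intro t ht d hd x y hx hy
    have kx := k2 t ht x hx
    have ky := k2 t ht y hy
    have e1 : f t d x (kf t x) - f t d y (kf t y) = (f t d x (kf t x) - f t d y (kf t x)) +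
      (f t d y (kf t x) - f t d y (kf t y)) := by abel
    have e2 := hL t ht.1 x y d hd (kf t x) (kU t x)
    have e3 := hLU t ht.1 y d hd (kf t x) (kU t x) (kf t y) (kU t y)
    have e4 : L (t + ‖x‖ + ‖y‖ + ‖kf t x‖) ≤ L (3 * R + K * R) := by
      apply Lm _ a1 _
      · have := ht.1; exact (by positivity : 0 ≤ t + ‖x‖ + ‖y‖ + ‖kf t x‖)
      · linarith [ht.2]
    have e5 : LU (t + ‖y‖ + ‖kf t x‖ + ‖kf t y‖) ≤ LU (2 * R + 2 * (K * R)) := by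
      apply LUm _ a2 _
      · have := ht.1; exact (by positivity : 0 ≤ t + ‖y‖ + ‖kf t x‖ + ‖kf t y‖)
      · linarith [ht.2]
    have e6 := k1 t ht x y hx hy
    have e7 : ⟪x (zz hr) - y (zz hr), f t d y (kf t x) - f t d y (kf t y)⟫ ≤
        ‖x - y‖ * (LU (2 * R + 2 * (K * R)) * (K * ‖x - y‖)) := by
      refine (real_inner_le_norm _ _).trans ?_
      have := (x - y).norm_coe_le_norm (zz hr)
      rw [ContinuousMap.sub_apply] at this
      apply mul_le_mul this _ (norm_nonneg _) (norm_nonneg _)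
      refine e3.trans ?_
      apply mul_le_mul e5 e6 (norm_nonneg _) (LU0 _ a2)
    have e8 : L (t + ‖x‖ + ‖y‖ + ‖kf t x‖) * ‖x - y‖ ^ 2 ≤ L (3 * R + K * R) * ‖x - y‖ ^ 2 := by
      gcongr
    simp only [e1]
    rw [inner_add_right]
    change ⟪x (zz hr) - y (zz hr), _⟫ ≤ _ at e2
    linarith
  · intro R hR
    obtain ⟨K, hK, k1, k2⟩ := kf_bound hk R hR
    obtain ⟨M, hM⟩ := S2 R hR R hR (K * R) (by positivity)
    exact ⟨|M|, abs_nonneg _, fun t ht d hd x hx =>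
      (hM t ht d hd x hx _ (kU t x) (k2 t ht x hx)).trans (le_abs_self _)⟩
  · intro t ht d hd
    have kc : Continuous (kf t) := by
      have : ContinuousOn ((fun pr : ℝ × Hist n r => kf pr.1 pr.2) ∘ fun x : Hist n r => (t, x))
        univ := hk.2.1.comp (by fun_prop) (fun x _ => ⟨ht, trivial⟩)
      exact continuousOn_univ.1 this
    have : ContinuousOn ((fun p : Hist n r × Euc m × Euc l => f t p.2.2 p.1 p.2.1) ∘
      fun x : Hist n r => (x, kf t x, d)) univ :=
      (S1c t ht).comp (by fun_prop) (fun x _ => ⟨trivial, kU t x, hd⟩)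
    exact continuousOn_univ.1 this
  · intro d hd φ hφ
    have c1 : ContinuousOn (fun p : ℝ × Euc l => f p.1 p.2 (φ p.1) (kf p.1 (φ p.1)))
        ((Ici 0 \ A) ×ˢ D) := by
      have kc : ContinuousOn (fun p : ℝ × Euc l => kf p.1 (φ p.1)) ((Ici 0 \ A) ×ˢ D) := by
        have : ContinuousOn ((fun pr : ℝ × Hist n r => kf pr.1 pr.2) ∘
          fun p : ℝ × Euc l => (p.1, φ p.1)) ((Ici 0 \ A) ×ˢ D) :=
          hk.2.1.comp (by fun_prop) (fun p hp => ⟨hp.1.1, trivial⟩)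
        exact this
      have : ContinuousOn ((fun p : ℝ × Hist n r × Euc m × Euc l => f p.1 p.2.2.2 p.2.1 p.2.2.1) ∘
        fun p : ℝ × Euc l => (p.1, φ p.1, kf p.1 (φ p.1), p.2)) ((Ici 0 \ A) ×ˢ D) :=
        S3c.comp (continuousOn_fst.prodMk ((hφ.comp continuous_fst).continuousOn.prodMk
          (kc.prodMk continuousOn_snd))) (fun p hp => ⟨hp.1, trivial, kU _ _, hp.2⟩)
      exact this
    have ms : MeasurableSet ((Ici 0 \ A) ×ˢ D) :=
      (measurableSet_Ici.diff Ac.measurableSet).prod Dc.measurableSet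
    classical
    have m1 := c1.measurable_piecewise (g := fun _ => 0) continuousOn_const ms
    have m2 := m1.comp (measurable_id.prodMk hd.1)
    refine ⟨_, m2.stronglyMeasurable, ?_⟩
    rw [EventuallyEq, ae_restrict_iff' measurableSet_Ici]
    filter_upwards [(measure_eq_zero_iff_ae_notMem (s := A) (μ := volume)).1 (Ac.measure_zero _)]
      with s hs h0
    simp only [Function.comp, id]
    rw [piecewise_eq_of_mem]
    exact ⟨⟨h0, hs⟩, hd.2 s⟩
  · intro t ht d hd x φ hφ
    have evs : ∀ᶠ s in 𝓝[>] t, s ∈ Ioo t (t + 1) := Ioo_mem_nhdsGT (by linarith)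
    have evb : ∀ᶠ s in 𝓝[>] t, ‖φ s - x‖ ≤ 1 := by
      have := (tendsto_iff_norm_sub_tendsto_zero.1 hφ).eventually_lt_const (zero_lt_one)
      filter_upwards [this] with s hs using hs.le
    have kt : Tendsto (fun s => kf s (φ s)) (𝓝[>] t) (𝓝 (kf t x)) := by
      have c := hk.2.1 (t, x) ⟨ht, trivial⟩
      refine c.tendsto.comp (f := fun s => (s, φ s)) (tendsto_nhdsWithin_iff.2 ⟨?_, ?_⟩)
      · exact (tendsto_nhdsWithin_of_tendsto_nhds tendsto_id).prodMk_nhds hφ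
      · filter_upwards [evs] with s hs
        exact ⟨ht.trans hs.1.le, trivial⟩
    have evk : ∀ᶠ s in 𝓝[>] t, ‖kf s (φ s) - kf t x‖ ≤ 1 := by
      have := (tendsto_iff_norm_sub_tendsto_zero.1 kt).eventually_lt_const (zero_lt_one)
      filter_upwards [this] with s hs using hs.le
    set u := kf t x with hu
    have uU : u ∈ U := kU t x
    -- replace the control
    have d1 : Tendsto (fun s => f s d (φ s) (kf s (φ s)) - f s d (φ s) u) (𝓝[>] t) (𝓝 0) := by
      have b : Tendsto (fun s => LU ((t + 1) + (‖x‖ + 1) + (‖u‖ + 1) + ‖u‖) * ‖kf s (φ s) - u‖)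
          (𝓝[>] t) (𝓝 0) := by
        have := (tendsto_iff_norm_sub_tendsto_zero.1 kt).const_mul
          (LU ((t + 1) + (‖x‖ + 1) + (‖u‖ + 1) + ‖u‖))
        rwa [mul_zero] at this
      refine squeeze_zero_norm' ?_ b
      filter_upwards [evs, evb, evk] with s h1 h2 h3
      have hs0 : 0 ≤ s := ht.trans h1.1.le
      refine (hLU s hs0 (φ s) d hd _ (kU _ _) u uU).trans ?_
      gcongr
      apply LUm
      · exact (by positivity : 0 ≤ s + ‖φ s‖ + ‖kf s (φ s)‖ + ‖u‖)
      · exact (by positivity : 0 ≤ (t + 1) + (‖x‖ + 1) + (‖u‖ + 1) + ‖u‖)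
      · have q1 : ‖φ s‖ ≤ ‖x‖ + 1 := by
          have := norm_add_le (φ s - x) x; rw [sub_add_cancel] at this; linarith
        have q2 : ‖kf s (φ s)‖ ≤ ‖u‖ + 1 := by
          have := norm_add_le (kf s (φ s) - u) u; rw [sub_add_cancel] at this; linarith
        linarith [h1.2]
    have d2 : Tendsto (fun s => f s d (φ s) u) (𝓝[>] t) (𝓝 (f t d x u)) := by
      apply euc_tendsto
      intro e η hη
      let z : ℝ → Hist n r := fun ε => x - ε • ContinuousMap.const _ e
      have zc : Continuous z := by fun_prop
      have z0 : z 0 = x := by ext1 θ; simp [z]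
      have fzc : Tendsto (fun ε => ⟪e, f t d (z ε) u - f t d x u⟫) (𝓝[>] 0) (𝓝 0) := by
        have c : ContinuousOn ((fun p : Hist n r × Euc m × Euc l => f t p.2.2 p.1 p.2.1) ∘
          fun ε : ℝ => (z ε, u, d)) univ :=
          (S1c t ht).comp (by fun_prop) (fun x _ => ⟨trivial, uU, hd⟩)
        have c2 : Continuous fun ε => f t d (z ε) u := continuousOn_univ.1 c
        have c3 : Continuous fun ε => ⟪e, f t d (z ε) u - f t d x u⟫ :=
          continuous_const.inner (c2.sub continuous_const)
        have := c3.tendsto 0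
        rw [z0] at this
        simp only [sub_self, inner_zero_right] at this
        exact this.mono_left nhdsWithin_le_nhds
      set LL := L ((t + 1) + (‖x‖ + 1) + (‖x‖ + ‖e‖) + ‖u‖) with hLL
      have lim2 : Tendsto (fun ε : ℝ => LL * ε * ‖e‖ ^ 2) (𝓝[>] 0) (𝓝 0) := by
        have : Continuous (fun ε : ℝ => LL * ε * ‖e‖ ^ 2) := by fun_prop
        have := this.tendsto 0
        simp only [mul_zero, zero_mul] at this
        exact this.mono_left nhdsWithin_le_nhds
      obtain ⟨ε, ⟨⟨hε1, hε2⟩, hε3⟩⟩ := (((fzc.eventually_lt_const (by positivity : 0 < η / 4)).and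
        (lim2.eventually_lt_const (by positivity : 0 < η / 4))).and
        (Ioo_mem_nhdsGT (zero_lt_one))).exists
      have hε0 : 0 < ε := hε3.1
      obtain ⟨M, hM⟩ := S2 (t + 1) (by linarith) (‖x‖ + 1 + ‖e‖) (by positivity) ‖u‖ (by positivity)
      have t1 : Tendsto (fun s => ⟪e, f s d (z ε) u - f t d (z ε) u⟫) (𝓝[>] t) (𝓝 0) := by
        have := (S3r t ht (z ε) u uU d hd).sub_const (f t d (z ε) u)
        rw [sub_self] at this
        have := (tendsto_const_nhds (x := e)).inner (𝕜 := ℝ) this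
        rwa [inner_zero_right] at this
      have nφ : Tendsto (fun s => ‖φ s - x‖) (𝓝[>] t) (𝓝 0) :=
        tendsto_iff_norm_sub_tendsto_zero.1 hφ
      have t2 : Tendsto (fun s => LL * (‖φ s - x‖ + ε * ‖e‖) ^ 2 / ε + ‖φ s - x‖ * (2 * M) / ε)
          (𝓝[>] t) (𝓝 (LL * ε * ‖e‖ ^ 2)) := by
        have := ((((nφ.add_const (ε * ‖e‖)).pow 2).const_mul LL).div_const ε).add
          ((nφ.mul_const (2 * M)).div_const ε)
        convert this using 2
        field_simp
        ring
      filter_upwards [evs, evb, t1.eventually_lt_const (by positivity : 0 < η / 4),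
        t2.eventually_lt_const hε2] with s h1 h2 h3 h4
      have hs0 : 0 ≤ s := ht.trans h1.1.le
      have nz : ‖z ε‖ ≤ ‖x‖ + ‖e‖ := by
        refine (norm_sub_le _ _).trans ?_
        gcongr
        rw [norm_smul, Real.norm_eq_abs, abs_of_pos hε0]
        have : ‖ContinuousMap.const (Icc (-r) (0:ℝ)) e‖ ≤ ‖e‖ := by
          rw [ContinuousMap.norm_le _ (norm_nonneg _)]; intro θ; simp
        nlinarith [norm_nonneg e, hε3.2, norm_nonneg (ContinuousMap.const (Icc (-r) (0:ℝ)) e)]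
      have nφs : ‖φ s‖ ≤ ‖x‖ + 1 := by
        have := norm_add_le (φ s - x) x; rw [sub_add_cancel] at this; linarith
      have key := hL s hs0 (φ s) (z ε) d hd u uU
      change ⟪φ s (zz hr) - z ε (zz hr), _⟫ ≤ _ at key
      have hz : φ s (zz hr) - z ε (zz hr) = (φ s - x) (zz hr) + ε • e := by
        simp [z]; abel
      rw [hz, inner_add_left, real_inner_smul_left] at key
      have b1 : ‖φ s - z ε‖ ≤ ‖φ s - x‖ + ε * ‖e‖ := by
        have : φ s - z ε = (φ s - x) + ε • ContinuousMap.const _ e := by simp [z]; abel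
        rw [this]
        refine (norm_add_le _ _).trans ?_
        gcongr
        rw [norm_smul, Real.norm_eq_abs, abs_of_pos hε0]
        gcongr
        rw [ContinuousMap.norm_le _ (norm_nonneg _)]; intro θ; simp
      have b2 : L (s + ‖φ s‖ + ‖z ε‖ + ‖u‖) ≤ LL := by
        apply Lm
        · exact (by positivity : 0 ≤ s + ‖φ s‖ + ‖z ε‖ + ‖u‖)
        · exact (by positivity : 0 ≤ (t + 1) + (‖x‖ + 1) + (‖x‖ + ‖e‖) + ‖u‖)
        · linarith [h1.2]
      have LL0 : 0 ≤ LL := L0 _ (by positivity)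
      have b3 : L (s + ‖φ s‖ + ‖z ε‖ + ‖u‖) * ‖φ s - z ε‖ ^ 2 ≤
          LL * (‖φ s - x‖ + ε * ‖e‖) ^ 2 := by
        apply mul_le_mul b2 _ (by positivity) LL0
        gcongr
      have m1 := hM s ⟨hs0, h1.2.le⟩ d hd (φ s) (by linarith [norm_nonneg e]) u uU le_rfl
      have m2 := hM s ⟨hs0, h1.2.le⟩ d hd (z ε) (by linarith) u uU le_rfl
      have b4 : -(‖φ s - x‖ * (2 * M)) ≤
          ⟪(φ s - x) (zz hr), f s d (φ s) u - f s d (z ε) u⟫ := by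
        have := abs_real_inner_le_norm ((φ s - x) (zz hr)) (f s d (φ s) u - f s d (z ε) u)
        have c1 := (φ s - x).norm_coe_le_norm (zz hr)
        have c2 := norm_sub_le (f s d (φ s) u) (f s d (z ε) u)
        have c3 : ‖(φ s - x) (zz hr)‖ * ‖f s d (φ s) u - f s d (z ε) u‖ ≤
          ‖φ s - x‖ * (2 * M) := mul_le_mul c1 (by linarith) (norm_nonneg _) (norm_nonneg _)
        have := (abs_le.1 this).1
        linarith
      have b5 : ⟪e, f s d (φ s) u - f s d (z ε) u⟫ ≤
          LL * (‖φ s - x‖ + ε * ‖e‖) ^ 2 / ε + ‖φ s - x‖ * (2 * M) / ε := by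
        rw [← add_div, le_div_iff₀ hε0]
        linarith
      have e1 : f s d (φ s) u - f t d x u = (f s d (φ s) u - f s d (z ε) u) +
        (f s d (z ε) u - f t d (z ε) u) + (f t d (z ε) u - f t d x u) := by abel
      rw [e1, inner_add_right, inner_add_right]
      linarith
    have := d1.add d2
    rw [zero_add] at this
    refine this.congr fun s => ?_
    simp


/-- Solutions as globally continuous functions. -/
def PSol {n l : ℕ} {r : ℝ} (F : ℝ → Euc l → Hist n r → Euc n) (d : ℝ → Euc l) (t0 t1 : ℝ)
    (x : C(ℝ, Euc n)) : Prop :=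
  ∀ t ∈ Icc t0 t1, x t = x t0 + ∫ s in t0..t, F s (d s) (hst r x s)

section PS
variable {n l : ℕ} {r : ℝ} {hr : 0 < r} {D : Set (Euc l)}
    {F : ℝ → Euc l → Hist n r → Euc n}

theorem hst_bdd (x : C(ℝ, Euc n)) (a b : ℝ) : ∃ R, 0 ≤ R ∧ b ≤ R ∧ ∀ s ∈ Icc a b, ‖hst r x s‖ ≤ R := by
  obtain ⟨C, hC⟩ := isCompact_Icc.exists_bound_of_continuousOn (s := Icc a b)
    (hst_continuous r x).continuousOn
  refine ⟨max (max C 0) b, ?_, le_max_right _ _, fun s hs => (hC s hs).trans ?_⟩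
  · exact (le_max_right C 0).trans (le_max_left _ _)
  · exact (le_max_left C 0).trans (le_max_left _ _)

theorem cl_ii (hc : CL hr D F) {d : ℝ → Euc l} (hd : InMD D d) (x : C(ℝ, Euc n)) {a b : ℝ}
    (ha : 0 ≤ a) (hb : 0 ≤ b) :
    IntervalIntegrable (fun s => F s (d s) (hst r x s)) volume a b := by
  wlog hab : a ≤ b generalizing a b
  · exact (this hb ha (le_of_not_ge hab)).symm
  rw [intervalIntegrable_iff, uIoc_of_le hab]
  obtain ⟨R, R0, hbR, hR⟩ := hst_bdd (r := r) x a b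
  obtain ⟨M, M0, hM⟩ := hc.bdd R R0
  refine Integrable.of_bound (C := M) 
    ((hc.meas d hd _ (hst_continuous r x)).mono_measure
      (Measure.restrict_mono (s := Ioc a b) (s' := Ici 0)
        (fun s hs => mem_Ici.2 (ha.trans hs.1.le)) le_rfl)) ?_
  rw [ae_restrict_iff' measurableSet_Ioc]
  exact ae_of_all _ fun s hs => hM s ⟨ha.trans hs.1.le, hs.2.trans hbR⟩ _ (hd.2 s) _
    (hR s ⟨hs.1.le, hs.2⟩)

theorem PSol.mono {d : ℝ → Euc l} {t0 t1 t2 : ℝ} {x : C(ℝ, Euc n)} (h : PSol F d t0 t1 x)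
    (h2 : t2 ≤ t1) : PSol F d t0 t2 x := fun t ht => h t ⟨ht.1, ht.2.trans h2⟩

theorem PSol.shift (hc : CL hr D F) {d : ℝ → Euc l} (hd : InMD D d) {t0 t1 t2 : ℝ}
    {x : C(ℝ, Euc n)} (h0 : 0 ≤ t0) (h : PSol F d t0 t1 x) (h2 : t0 ≤ t2) :
    PSol F d t2 t1 x := by
  intro t ht
  have := path_sub (cl_ii hc hd x h0 (h0.trans (h2.trans (ht.1.trans ht.2)))) h
    (s := t2) (t := t) ⟨h2, ht.1.trans ht.2⟩ ⟨h2.trans ht.1, ht.2⟩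
  rw [← this]; abel

theorem PSol.congr_d {d d' : ℝ → Euc l} {t0 t1 : ℝ} {x : C(ℝ, Euc n)} (h : PSol F d t0 t1 x)
    (hd : ∀ s ∈ Ico t0 t1, d s = d' s) : PSol F d' t0 t1 x := by
  intro t ht
  rw [h t ht]
  congr 1
  rw [intervalIntegral.integral_of_le ht.1, intervalIntegral.integral_of_le ht.1,
    integral_Ioc_eq_integral_Ioo, integral_Ioc_eq_integral_Ioo]
  refine setIntegral_congr_fun measurableSet_Ioo fun s hs => ?_
  rw [hd s ⟨hs.1.le, hs.2.trans_le ht.2⟩]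

theorem PSol.dist (hc : CL hr D F) {d : ℝ → Euc l} (hd : InMD D d)
    {t0 t1 T R L : ℝ} {x y : C(ℝ, Euc n)} (h0 : 0 ≤ t0) (hx : PSol F d t0 t1 x)
    (hy : PSol F d t0 t1 y) (hT : t1 ≤ T) (hxR : ∀ s ∈ Icc t0 t1, ‖hst r x s‖ ≤ R)
    (hyR : ∀ s ∈ Icc t0 t1, ‖hst r y s‖ ≤ R) (hL0 : 0 ≤ L)
    (hL : ∀ t ∈ Icc (0:ℝ) T, ∀ d ∈ D, ∀ x y : Hist n r, ‖x‖ ≤ R →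
    ‖y‖ ≤ R → ⟪x (zz hr) - y (zz hr), F t d x - F t d y⟫ ≤ L * ‖x - y‖ ^ 2) :
    ∀ t ∈ Icc t0 t1, ‖hst r x t - hst r y t‖ ≤
      Real.exp (L * (t - t0)) * ‖hst r x t0 - hst r y t0‖ := by
  intro t ht
  have h01 : t0 ≤ t1 := ht.1.trans ht.2
  have h1 : 0 ≤ t1 := h0.trans h01
  obtain ⟨M, M0, hM⟩ := hc.bdd (max R t1) (h1.trans (le_max_right _ _))
  have mem : ∀ s ∈ Icc t0 t1, s ∈ Icc 0 (max R t1) :=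
    fun s hs => ⟨h0.trans hs.1, hs.2.trans (le_max_right _ _)⟩
  have := gron_core hr (z := x - y) (t0 := t0) (t1 := t1)
    (g := fun s => F s (d s) (hst r x s) - F s (d s) (hst r y s)) (M := M + M) (L := L) (e := 0)
    (fun s hs => (norm_sub_le _ _).trans (add_le_add
      (hM s (mem s hs) _ (hd.2 s) _ ((hxR s hs).trans (le_max_left _ _))) (hM s (mem s hs) _ (hd.2 s) _ ((hyR s hs).trans (le_max_left _ _)))))
    ((cl_ii hc hd x h0 h1).sub (cl_ii hc hd y h0 h1))
    (fun t ht => by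
      rw [intervalIntegral.integral_sub (cl_ii hc hd x h0 (h0.trans ht.1))
        (cl_ii hc hd y h0 (h0.trans ht.1)), ContinuousMap.sub_apply,
        ContinuousMap.sub_apply, hx t ht, hy t ht]
      abel) hL0 le_rfl
    (ae_of_all _ fun s hs => by
      have hs' := Ioo_subset_Icc_self hs
      have := hL s ⟨h0.trans hs'.1, hs'.2.trans hT⟩ (d s) (hd.2 s) _ _ (hxR s hs') (hyR s hs')
      rw [add_zero, hst_sub]
      convert this using 2
      simp [hst_apply, zz]) t ht
  rw [hst_sub, hst_sub, mul_zero, zero_mul, add_zero] at this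
  apply le_of_sq_le_sq _ (by positivity)
  rw [mul_pow, ← Real.exp_nat_mul, mul_comm (Real.exp _)]
  rw [show ((2:ℕ):ℝ) * (L * (t - t0)) = 2 * L * (t - t0) by push_cast; ring]
  exact this

theorem PSol.unique (hc : CL hr D F) {d : ℝ → Euc l} (hd : InMD D d)
    {t0 t1 : ℝ} {x y : C(ℝ, Euc n)} (h0 : 0 ≤ t0) (hx : PSol F d t0 t1 x)
    (hy : PSol F d t0 t1 y) (he : hst r x t0 = hst r y t0) :
    ∀ t ∈ Icc t0 t1, hst r x t = hst r y t := by
  intro t ht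
  obtain ⟨R1, _, h1, hR1⟩ := hst_bdd (r := r) x t0 t1
  obtain ⟨R2, R20, h2, hR2⟩ := hst_bdd (r := r) y t0 t1
  obtain ⟨L, L0, hL⟩ := hc.osl (max R1 R2) (R20.trans (le_max_right _ _))
  have := hx.dist hc hd h0 hy (h1.trans (le_max_left R1 R2))
    (fun s hs => (hR1 s hs).trans (le_max_left R1 R2))
    (fun s hs => (hR2 s hs).trans (le_max_right R1 R2)) L0 hL t ht
  rw [he, sub_self, norm_zero, mul_zero] at this
  exact sub_eq_zero.1 (norm_le_zero_iff.1 this)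

theorem PSol.concat (hc : CL hr D F) {d : ℝ → Euc l} (hd : InMD D d) {t0 t1 t2 : ℝ}
    {x : C(ℝ, Euc n)} (h0 : 0 ≤ t0) (h01 : t0 ≤ t1) (h : PSol F d t0 t1 x)
    (h' : PSol F d t1 t2 x) : PSol F d t0 t2 x := by
  intro t ht
  rcases le_total t t1 with h1 | h1
  · exact h t ⟨ht.1, h1⟩
  · rw [h' t ⟨h1, ht.2⟩, h t1 ⟨h01, le_rfl⟩, add_assoc,
      intervalIntegral.integral_add_adjacent_intervals (cl_ii hc hd x h0 (h0.trans h01))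
        (cl_ii hc hd x (h0.trans h01) (h0.trans ht.1))]

theorem PSol.zero (hc : CL hr D F) {d : ℝ → Euc l} (hd : InMD D d) {t0 t1 : ℝ} (h0 : 0 ≤ t0) :
    PSol F d t0 t1 (0 : C(ℝ, Euc n)) := by
  intro t ht
  have e : ∀ s, hst r (0 : C(ℝ, Euc n)) s = 0 := fun s => by ext1 θ; rw [hst_apply]; simp
  rw [intervalIntegral.integral_congr (g := fun _ => 0)]
  · simp
  · intro s hs
    rw [uIcc_of_le ht.1] at hs
    simp only [e]
    exact hc.zero s (h0.trans hs.1) _ (hd.2 s)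

theorem psol_of_rfde (hr : 0 < r) {d : ℝ → Euc l} {t0 : ℝ} {x0 : Hist n r} {tm : EReal}
    {x : ℝ → Euc n} {φ : ℝ → Hist n r} (h : IsSolutionRFDE F d t0 x0 tm x φ) {t1 : ℝ} (h01 : t0 ≤ t1)
    (h1 : (t1 : EReal) < tm) :
    ∃ X : C(ℝ, Euc n), hst r X t0 = x0 ∧ (∀ t ∈ Icc t0 t1, hst r X t = φ t) ∧ PSol F d t0 t1 X := by
  obtain ⟨_, hi, hh, hcn, heq⟩ := h
  have hle : t0 - r ≤ t1 := by linarith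
  have lt : ∀ t ≤ t1, (t : EReal) < tm := fun t ht => lt_of_le_of_lt (by exact_mod_cast ht) h1
  have cr : Continuous ((Icc (t0 - r) t1).domRestrict x) := by
    rw [← continuousOn_iff_continuous_domRestrict]
    exact hcn.mono fun s hs => ⟨hs.1, lt s hs.2⟩
  let X : C(ℝ, Euc n) := ⟨IccExtend hle ((Icc (t0 - r) t1).domRestrict x), cr.Icc_extend'⟩
  have Xe : ∀ s ∈ Icc (t0 - r) t1, X s = x s := fun s hs => by
    change IccExtend hle ((Icc (t0 - r) t1).domRestrict x) s = _
    rw [IccExtend_of_mem _ _ hs]; rfl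
  have hX : ∀ t ∈ Icc t0 t1, hst r X t = φ t := by
    intro t ht
    ext1 θ
    rw [hst_apply, hh t ht.1 (lt t ht.2), Xe]
    exact ⟨by linarith [θ.2.1, ht.1], by linarith [θ.2.2, ht.2]⟩
  refine ⟨X, by rw [hX t0 ⟨le_rfl, h01⟩, hi], hX, fun t ht => ?_⟩
  rw [Xe t ⟨by linarith [ht.1], ht.2⟩, Xe t0 ⟨by linarith, h01⟩, heq t ht.1 (lt t ht.2)]
  congr 1
  apply intervalIntegral.integral_congr
  intro s hs
  rw [uIcc_of_le ht.1] at hs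
  simp only [hX s ⟨hs.1, hs.2.trans ht.2⟩]

theorem psol_of_rfde_top (hr : 0 < r) {d : ℝ → Euc l} {t0 : ℝ} {x0 : Hist n r} {tm : EReal}
    {x : ℝ → Euc n} {φ : ℝ → Hist n r} (h : IsSolutionRFDE F d t0 x0 tm x φ)
    (htm : ∀ t : ℝ, (t : EReal) < tm) :
    ∃ X : C(ℝ, Euc n), hst r X t0 = x0 ∧ (∀ t, t0 ≤ t → hst r X t = φ t) ∧
      ∀ t1, PSol F d t0 t1 X := by
  obtain ⟨_, hi, hh, hcn, heq⟩ := h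
  have hcn' : ContinuousOn x (Ici (t0 - r)) := hcn.mono fun s hs => ⟨hs, htm s⟩
  let X : C(ℝ, Euc n) := ⟨fun s => x (max s (t0 - r)),
    hcn'.comp_continuous (by fun_prop) (fun s => mem_Ici.2 (le_max_right _ _))⟩
  have Xe : ∀ s, t0 - r ≤ s → X s = x s := fun s hs => by
    change x (max s (t0 - r)) = _
    rw [max_eq_left hs]
  have hX : ∀ t, t0 ≤ t → hst r X t = φ t := by
    intro t ht
    ext1 θ
    rw [hst_apply, hh t ht (htm t), Xe]
    linarith [θ.2.1]
  refine ⟨X, by rw [hX t0 le_rfl, hi], hX, fun t1 t ht => ?_⟩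
  rw [Xe t (by linarith [ht.1]), Xe t0 (by linarith), heq t ht.1 (htm t)]
  congr 1
  apply intervalIntegral.integral_congr
  intro s hs
  rw [uIcc_of_le ht.1] at hs
  simp only [hX s hs.1]

theorem rfde_of_psol {d : ℝ → Euc l} {t0 : ℝ} {x : C(ℝ, Euc n)} (h : ∀ t1, PSol F d t0 t1 x) :
    IsSolutionRFDE F d t0 (hst r x t0) ⊤ x (hst r x) :=
  ⟨EReal.coe_lt_top _, rfl, fun _ _ _ _ => rfl, x.continuous.continuousOn,
    fun t ht _ => h t t ⟨ht, le_rfl⟩⟩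

/-- comparison of the shifted history with the extrapolated one -/
theorem hst_Ehist (hr : 0 < r) (x : C(ℝ, Euc n)) (t h : ℝ) (v : Euc n) (h0 : 0 ≤ h) {C : ℝ}
    (hC : ∀ s ∈ Icc 0 h, ‖x (t + s) - x t - s • v‖ ≤ C) :
    ‖hst r x (t + h) - Ehist h (hst r x t) v‖ ≤ C := by
  have C0 : 0 ≤ C := (norm_nonneg _).trans (hC 0 ⟨le_rfl, h0⟩)
  rw [ContinuousMap.norm_le _ C0]
  intro θ
  have hr' : -r ≤ 0 := by linarith
  rw [ContinuousMap.sub_apply, hst_apply, Ehist, dif_pos hr']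
  simp only [ContinuousMap.coe_mk]
  split_ifs with hθ
  · rw [hst_apply, projIcc_of_mem hr' ⟨by linarith [θ.2.1], by linarith⟩]
    simp only
    rw [show t + h + (θ:ℝ) = t + (θ + h) by ring, sub_self, norm_zero]; exact C0
  · rw [hst_apply, projIcc_of_mem hr' ⟨hr', le_rfl⟩]
    simp only [add_zero]
    have := hC (θ + h) ⟨by linarith, by linarith [θ.2.2]⟩
    rw [show t + h + (θ:ℝ) = t + (θ + h) by ring, ← sub_sub]; exact this

/-- If `x` has right derivative `v` at `t`, the history is `E_h + o(h)`. -/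
theorem hst_Ehist_tendsto (hr : 0 < r) (x : C(ℝ, Euc n)) (t : ℝ) (v : Euc n)
    (hd : HasDerivWithinAt x v (Ici t) t) :
    Tendsto (fun h : ℝ => h⁻¹ • (hst r x (t + h) - Ehist h (hst r x t) v)) (𝓝[>] 0) (𝓝 0) := by
  rw [Metric.tendsto_nhdsWithin_nhds]
  intro ε hε
  rw [hasDerivWithinAt_iff_isLittleO, Asymptotics.isLittleO_iff] at hd
  have := hd (by positivity : 0 < ε / 2)
  rw [Filter.Eventually, Metric.mem_nhdsWithin_iff] at this
  obtain ⟨δ, hδ, hb⟩ := this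
  refine ⟨δ, hδ, fun h h0 hh => ?_⟩
  have h0' : 0 < h := h0
  rw [Real.dist_eq, sub_zero, abs_of_pos h0'] at hh
  rw [dist_zero_right, norm_smul, norm_inv, Real.norm_eq_abs, abs_of_pos h0']
  have := hst_Ehist hr x t h v h0'.le (C := ε / 2 * h) (fun s hs => by
    have := hb (a := t + s) ⟨by rw [Metric.mem_ball, Real.dist_eq]; simp [abs_of_nonneg hs.1]; linarith [hs.2],
      by simpa using hs.1⟩
    simp only [mem_ofPred_eq, add_sub_cancel_left, Real.norm_eq_abs, abs_of_nonneg hs.1] at this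
    refine this.trans ?_
    have := hs.2
    gcongr)
  calc h⁻¹ * _ ≤ h⁻¹ * (ε / 2 * h) := by gcongr
    _ = ε / 2 := by field_simp
    _ < ε := by linarith
end PS

/-- Choice of continuous monotone bounding functions. -/
theorem lemmaM (P : ℝ → ℝ → Prop) (mono : ∀ R R' C C', R' ≤ R → C ≤ C' → P R C → P R' C')
    (ex : ∀ R, 0 ≤ R → ∃ C, P R C) :
    ∃ c : ℝ → ℝ, Monotone c ∧ Continuous c ∧ (∀ t, 0 ≤ c t) ∧
      (∀ R, 0 ≤ R → ∃ K, 0 ≤ K ∧ ∀ s ∈ Icc 0 R, ∀ t ∈ Icc 0 R, |c s - c t| ≤ K * |s - t|) ∧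
      ∀ R, P R (c R) := by
  choose C hC using fun k : ℕ => ex k (by positivity)
  let b : ℝ → ℝ := fun R => ∑ k ∈ Finset.range (⌈R⌉₊ + 1), |C k|
  have bm : Monotone b := by
    intro x y hxy
    apply Finset.sum_le_sum_of_subset_of_nonneg
    · intro k hk
      rw [Finset.mem_range] at *
      have := Nat.ceil_mono hxy
      omega
    · intros; positivity
  have b0 : ∀ x, 0 ≤ b x := fun x => Finset.sum_nonneg fun _ _ => abs_nonneg _
  have bP : ∀ R, P R (b R) := fun R => by
    refine mono _ _ _ _ (Nat.le_ceil R) ?_ (hC ⌈R⌉₊)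
    refine (le_abs_self _).trans ?_
    exact Finset.single_le_sum (f := fun k => |C k|) (fun _ _ => abs_nonneg _)
      (Finset.mem_range.2 (Nat.lt_succ_self _))
  have bi : ∀ x y, IntervalIntegrable b volume x y := fun x y => bm.intervalIntegrable
  let c : ℝ → ℝ := fun t => ∫ s in t..(t + 1), b s
  have cs : ∀ t, c t = ∫ s in (0:ℝ)..1, b (s + t) := fun t => by
    rw [intervalIntegral.integral_comp_add_right]
    simp [c, add_comm]
  have bi' : ∀ t, IntervalIntegrable (fun s => b (s + t)) volume 0 1 := fun t =>
    (bm.comp (fun x y h => by simpa using h : Monotone fun s => s + t)).intervalIntegrable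
  have cl : ∀ R, ∀ s ∈ Icc 0 R, ∀ t ∈ Icc 0 R, |c s - c t| ≤ (2 * b (R + 1)) * |s - t| := by
    intro R s hs t ht
    have e : c s - c t = (∫ u in s..t, b u) - ∫ u in (s+1)..(t+1), b u := by
      simp only [c]
      rw [← intervalIntegral.integral_add_adjacent_intervals (bi s t) (bi t (s+1)),
        ← intervalIntegral.integral_add_adjacent_intervals (bi t (s + 1)) (bi (s+1) (t+1))]
      ring
    rw [e]
    refine (abs_sub _ _).trans ?_
    have k : ∀ x y, x ∈ Icc 0 (R+1) → y ∈ Icc 0 (R+1) → |∫ u in x..y, b u| ≤ b (R+1) * |y - x| := by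
      intro x y hx hy
      rw [← Real.norm_eq_abs]
      apply intervalIntegral.norm_integral_le_of_norm_le_const
      intro u hu
      rw [Real.norm_eq_abs, abs_of_nonneg (b0 u)]
      apply bm
      exact (hu.2).trans (max_le hx.2 hy.2)
    have k1 := k s t ⟨hs.1, by linarith [hs.2]⟩ ⟨ht.1, by linarith [ht.2]⟩
    have k2 := k (s+1) (t+1) ⟨by linarith [hs.1], by linarith [hs.2]⟩
      ⟨by linarith [ht.1], by linarith [ht.2]⟩
    rw [show t + 1 - (s + 1) = t - s by ring] at k2
    rw [abs_sub_comm s t]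
    linarith
  refine ⟨c, ?_, ?_, ?_, ?_, ?_⟩
  · intro x y hxy
    rw [cs, cs]
    exact intervalIntegral.integral_mono_on zero_le_one (bi' x) (bi' y)
      (fun s _ => bm (by linarith))
  · have h1 := intervalIntegral.continuous_primitive bi 0
    have : c = fun t => (∫ s in (0:ℝ)..(t+1), b s) - ∫ s in (0:ℝ)..t, b s := by
      funext t
      rw [intervalIntegral.integral_interval_sub_left (bi _ _) (bi _ _)]
    rw [this]
    exact (h1.comp (by fun_prop)).sub h1
  · intro t
    exact intervalIntegral.integral_nonneg (by linarith) (fun s _ => b0 s)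
  · intro R hR
    exact ⟨2 * b (R + 1), by have := b0 (R+1); positivity, cl R⟩
  · intro R
    refine mono _ _ _ _ le_rfl ?_ (bP R)
    rw [cs]
    have : b R = ∫ s in (0:ℝ)..1, b R := by simp
    rw [this]
    exact intervalIntegral.integral_mono_on zero_le_one (by simp) (bi' R)
      (fun s hs => bm (by linarith [hs.1]))


/-- cut-off -/
def chi {n : ℕ} {r : ℝ} (R : ℝ) (x : Hist n r) : ℝ := max 0 (min 1 (R + 1 - ‖x‖))

/-- truncated right-hand side -/
def trunc {n l : ℕ} {r : ℝ} (R : ℝ) (F : ℝ → Euc l → Hist n r → Euc n) :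
    ℝ → Euc l → Hist n r → Euc n := fun t d x => chi R x • F t d x

section TR
variable {n l : ℕ} {r : ℝ} {hr : 0 < r} {D : Set (Euc l)}
    {F : ℝ → Euc l → Hist n r → Euc n}

theorem chi_nonneg (R : ℝ) (x : Hist n r) : 0 ≤ chi R x := le_max_left _ _
theorem chi_le_one (R : ℝ) (x : Hist n r) : chi R x ≤ 1 := max_le zero_le_one (min_le_left _ _)
theorem chi_one {R : ℝ} {x : Hist n r} (h : ‖x‖ ≤ R) : chi R x = 1 := by
  rw [chi, min_eq_left (by linarith), max_eq_right zero_le_one]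
theorem chi_zero {R : ℝ} {x : Hist n r} (h : R + 1 ≤ ‖x‖) : chi R x = 0 := by
  rw [chi, max_eq_left]
  exact (min_le_right _ _).trans (by linarith)
theorem chi_cont (R : ℝ) : Continuous (chi R : Hist n r → ℝ) := by unfold chi; fun_prop
theorem chi_lip (R : ℝ) (x y : Hist n r) : |chi R x - chi R y| ≤ ‖x - y‖ := by
  unfold chi
  rw [max_comm 0, max_comm 0, min_comm 1, min_comm 1]
  refine (abs_max_sub_max_le_abs _ _ _).trans ((abs_min_sub_min_le_max _ _ _ _).trans ?_)
  rw [sub_self, abs_zero, max_eq_left (abs_nonneg _)]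
  have := abs_norm_sub_norm_le x y
  rw [show R + 1 - ‖x‖ - (R + 1 - ‖y‖) = -(‖x‖ - ‖y‖) by ring, abs_neg]
  exact this

theorem trunc_bdd (hc : CL hr D F) (R T : ℝ) (hR : 0 ≤ R) : ∃ M, 0 ≤ M ∧
    ∀ t ∈ Icc 0 T, ∀ d ∈ D, ∀ x : Hist n r, ‖trunc R F t d x‖ ≤ M := by
  obtain ⟨M, M0, hM⟩ := hc.bdd (max (R + 1) T) (le_max_of_le_left (by linarith))
  refine ⟨M, M0, fun t ht d hd x => ?_⟩
  rcases le_total (R + 1) ‖x‖ with h | h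
  · rw [trunc, chi_zero h]; simpa using M0
  · rw [trunc, norm_smul, Real.norm_eq_abs, abs_of_nonneg (chi_nonneg _ _)]
    have := hM t ⟨ht.1, ht.2.trans (le_max_right _ _)⟩ d hd x (h.trans (le_max_left _ _))
    calc _ ≤ 1 * M := mul_le_mul (chi_le_one _ _) this (norm_nonneg _) zero_le_one
      _ = M := one_mul M

theorem trunc_osl (hc : CL hr D F) (R T : ℝ) (hR : 0 ≤ R) : ∃ L, 0 ≤ L ∧
    ∀ t ∈ Icc 0 T, ∀ d ∈ D, ∀ x y : Hist n r,
      ⟪x (zz hr) - y (zz hr), trunc R F t d x - trunc R F t d y⟫ ≤ L * ‖x - y‖ ^ 2 := by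
  obtain ⟨M, M0, hM⟩ := hc.bdd (max (R + 1) T) (le_max_of_le_left (by linarith))
  obtain ⟨L, L0, hL⟩ := hc.osl (max (R + 1) T) (le_max_of_le_left (by linarith))
  refine ⟨L + M, by positivity, fun t ht d hd x y => ?_⟩
  have ht' : t ∈ Icc 0 (max (R + 1) T) := ⟨ht.1, ht.2.trans (le_max_right _ _)⟩
  -- one-sided version
  have key : ∀ x y : Hist n r, ‖x‖ ≤ R + 1 → R + 1 ≤ ‖y‖ →
      ⟪x (zz hr) - y (zz hr), chi R x • F t d x⟫ ≤ M * ‖x - y‖ ^ 2 := by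
    intro x y hx hy
    have h1 := hM t ht' d hd x (hx.trans (le_max_left _ _))
    have h2 := (x - y).norm_coe_le_norm (zz hr)
    rw [ContinuousMap.sub_apply] at h2
    have h3 := chi_lip R x y
    rw [chi_zero hy, sub_zero] at h3
    refine (real_inner_le_norm _ _).trans ?_
    rw [norm_smul, Real.norm_eq_abs]
    calc _ ≤ ‖x - y‖ * (‖x - y‖ * M) := by gcongr
      _ = _ := by ring
  have sqn : 0 ≤ ‖x - y‖ ^ 2 := by positivity
  simp only [trunc]
  rcases le_total (R + 1) ‖y‖ with hy | hy
  · rcases le_total (R + 1) ‖x‖ with hx | hx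
    · rw [chi_zero hx, chi_zero hy]; simp; positivity
    · rw [chi_zero hy, zero_smul, sub_zero]
      have := key x y hx hy
      nlinarith
  · rcases le_total (R + 1) ‖x‖ with hx | hx
    · rw [chi_zero hx, zero_smul, zero_sub, ← inner_neg_neg, neg_neg, neg_sub]
      have := key y x hy hx
      rw [norm_sub_rev] at this
      nlinarith
    · have e : chi R x • F t d x - chi R y • F t d y =
        chi R x • (F t d x - F t d y) + (chi R x - chi R y) • F t d y := by
        rw [smul_sub, sub_smul]; abel
      rw [e, inner_add_right, real_inner_smul_right, real_inner_smul_right]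
      have h1 := hL t ht' d hd x y (hx.trans (le_max_left _ _)) (hy.trans (le_max_left _ _))
      have h2 := hM t ht' d hd y (hy.trans (le_max_left _ _))
      have h3 := chi_lip R x y
      have h4 : chi R x * ⟪x (zz hr) - y (zz hr), F t d x - F t d y⟫ ≤ L * ‖x - y‖ ^ 2 := by
        have a := chi_nonneg R x
        have b := chi_le_one R x
        have c : 0 ≤ L * ‖x - y‖ ^ 2 := by positivity
        calc _ ≤ chi R x * (L * ‖x - y‖ ^ 2) := by gcongr
          _ ≤ 1 * (L * ‖x - y‖ ^ 2) := by gcongr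
          _ = _ := one_mul _
      have h5 : (chi R x - chi R y) * ⟪x (zz hr) - y (zz hr), F t d y⟫ ≤ M * ‖x - y‖ ^ 2 := by
        refine (le_abs_self _).trans ?_
        rw [abs_mul]
        have h6 := (x - y).norm_coe_le_norm (zz hr)
        rw [ContinuousMap.sub_apply] at h6
        have h7 : |⟪x (zz hr) - y (zz hr), F t d y⟫| ≤ ‖x - y‖ * M :=
          (abs_real_inner_le_norm _ _).trans (by gcongr)
        calc _ ≤ ‖x - y‖ * (‖x - y‖ * M) := by gcongr
          _ = _ := by ring
      linarith

theorem CL.trunc (hc : CL hr D F) (R : ℝ) (hR : 0 ≤ R) : CL hr D (trunc R F) where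
  zero := fun t ht d hd => by rw [_root_.trunc, hc.zero t ht d hd, smul_zero]
  osl := fun T _ => by
    obtain ⟨L, L0, hL⟩ := trunc_osl hc R T hR
    exact ⟨L, L0, fun t ht d hd x y _ _ => hL t ht d hd x y⟩
  bdd := fun T _ => by
    obtain ⟨L, L0, hL⟩ := trunc_bdd hc R T hR
    exact ⟨L, L0, fun t ht d hd x _ => hL t ht d hd x⟩
  cont := fun t ht d hd => (chi_cont R).smul (hc.cont t ht d hd)
  meas := fun d hd φ hφ =>
    ((chi_cont R).comp hφ).aestronglyMeasurable.smul (hc.meas d hd φ hφ)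
  right := fun t ht d hd x φ hφ =>
    (((chi_cont R).tendsto x).comp hφ).smul (hc.right t ht d hd x φ hφ)

theorem psol_trunc {d : ℝ → Euc l} {t0 t1 R : ℝ} {x : C(ℝ, Euc n)}
    (h : ∀ s ∈ Icc t0 t1, ‖hst r x s‖ ≤ R) : PSol (trunc R F) d t0 t1 x ↔ PSol F d t0 t1 x := by
  have : ∀ t ∈ Icc t0 t1, ∫ s in t0..t, trunc R F s (d s) (hst r x s) =
      ∫ s in t0..t, F s (d s) (hst r x s) := by
    intro t ht
    apply intervalIntegral.integral_congr
    intro s hs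
    rw [uIcc_of_le ht.1] at hs
    simp only [trunc]
    rw [chi_one (h s ⟨hs.1, hs.2.trans ht.2⟩), one_smul]
  constructor
  · intro h1 t ht; rw [h1 t ht, this t ht]
  · intro h1 t ht; rw [h1 t ht, this t ht]

theorem exists_trunc (hc : CL hr D F) {d : ℝ → Euc l} (hd : InMD D d) {t0 t1 R : ℝ} (hR : 0 ≤ R)
    (h0 : 0 ≤ t0) (h01 : t0 ≤ t1) (x0 : Hist n r) :
    ∃ x, hst r x t0 = x0 ∧ PSol (trunc R F) d t0 t1 x := by
  obtain ⟨L, L0, hL⟩ := trunc_osl hc R t1 hR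
  obtain ⟨M, M0, hM⟩ := trunc_bdd hc R t1 hR
  have hct := hc.trunc R hR
  classical
  let G : ℝ → Hist n r → Euc n := fun s x => if s ∈ Icc t0 t1 then trunc R F s (d s) x else 0
  have mem : ∀ s ∈ Icc t0 t1, s ∈ Icc 0 t1 := fun s hs => ⟨h0.trans hs.1, hs.2⟩
  suffices hh : ∃ x : C(ℝ, Euc n), hst r x t0 = x0 ∧
      ∀ t ∈ Icc t0 t1, x t = x t0 + ∫ s in t0..t, G s (hst r x s) by
    obtain ⟨x, hx1, hx2⟩ := hh
    refine ⟨x, hx1, fun t ht => ?_⟩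
    rw [hx2 t ht]
    congr 1
    apply intervalIntegral.integral_congr
    intro s hs
    rw [uIcc_of_le ht.1] at hs
    simp only [G]
    rw [if_pos ⟨hs.1, hs.2.trans ht.2⟩]
  refine exists_sol hr (G := G) x0 t0 (M := M) (L := L) ?_ ?_ L0 ?_ ?_ h01
  · intro φ hφ
    have h1 := hct.meas d hd φ hφ
    have h2 : (fun s => G s (φ s)) =
        (Icc t0 t1).indicator (fun s => trunc R F s (d s) (φ s)) := by
      funext s; simp only [G, indicator]
    rw [h2, aestronglyMeasurable_indicator_iff measurableSet_Icc]
    exact h1.mono_measure (Measure.restrict_mono (fun s hs => mem_Ici.2 (h0.trans hs.1)) le_rfl)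
  · intro s x
    simp only [G]
    split_ifs with h
    · exact hM s (mem s h) _ (hd.2 s) x
    · simpa using M0
  · intro s x y
    simp only [G]
    split_ifs with h
    · exact hL s (mem s h) _ (hd.2 s) x y
    · simp; positivity
  · intro s
    simp only [G]
    split_ifs with h
    · exact hct.cont s (mem s h).1 _ (hd.2 s)
    · exact continuous_const

/-- Continuous dependence, including existence. -/
theorem psol_near (hc : CL hr D F) {d : ℝ → Euc l} (hd : InMD D d) {t0 t1 : ℝ}
    (h0 : 0 ≤ t0) (h01 : t0 ≤ t1) {x : C(ℝ, Euc n)} (hx : PSol F d t0 t1 x) {ε : ℝ} (hε : 0 < ε) :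
    ∃ δ > 0, ∀ z0 : Hist n r, ‖z0 - hst r x t0‖ ≤ δ → ∃ z, hst r z t0 = z0 ∧ PSol F d t0 t1 z ∧
      ∀ t ∈ Icc t0 t1, ‖hst r z t - hst r x t‖ ≤ ε := by
  wlog hε1 : ε ≤ 1 generalizing ε
  · obtain ⟨δ, hδ, h⟩ := this zero_lt_one le_rfl
    refine ⟨δ, hδ, fun z0 hz0 => ?_⟩
    obtain ⟨z, a, b, c⟩ := h z0 hz0
    exact ⟨z, a, b, fun t ht => (c t ht).trans (by linarith)⟩
  obtain ⟨R, R0, hR1, hR⟩ := hst_bdd (r := r) x t0 t1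
  obtain ⟨L, L0, hL⟩ := trunc_osl hc (R + 1) t1 (by linarith)
  have hct := hc.trunc (R + 1) (by linarith)
  refine ⟨ε / Real.exp (L * (t1 - t0)), by positivity, fun z0 hz0 => ?_⟩
  obtain ⟨z, hz1, hz2⟩ := exists_trunc hc hd (R := R + 1) (by linarith) h0 h01 z0
  have hxt : PSol (trunc (R + 1) F) d t0 t1 x :=
    (psol_trunc fun s hs => (hR s hs).trans (by linarith)).2 hx
  obtain ⟨R', R0', hR1', hR'⟩ := hst_bdd (r := r) z t0 t1
  have key : ∀ t ∈ Icc t0 t1, ‖hst r z t - hst r x t‖ ≤ ε := by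
    intro t ht
    have := hz2.dist hct hd h0 hxt (T := t1) (R := max R R') (L := L) le_rfl
      (fun s hs => (hR' s hs).trans (le_max_right R R'))
      (fun s hs => (hR s hs).trans (le_max_left R R')) L0
      (fun t ht d hd x y _ _ => hL t ht d hd x y) t ht
    rw [hz1] at this
    refine this.trans ?_
    have h1 : Real.exp (L * (t - t0)) ≤ Real.exp (L * (t1 - t0)) := by
      have := ht.2
      gcongr
    calc _ ≤ Real.exp (L * (t1 - t0)) * (ε / Real.exp (L * (t1 - t0))) := by gcongr
      _ = ε := by field_simp
  refine ⟨z, hz1, (psol_trunc fun s hs => ?_).1 hz2, key⟩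
  have h1 := key s hs
  have h2 := hR s hs
  have := norm_add_le (hst r z s - hst r x s) (hst r x s)
  rw [sub_add_cancel] at this
  linarith

theorem lip_dense (hr : 0 < r) (x : Hist n r) {δ : ℝ} (hδ : 0 < δ) :
    ∃ z : Hist n r, ‖z - x‖ ≤ δ ∧ ∃ M : ℝ, 0 ≤ M ∧ ∀ a b, ‖z a - z b‖ ≤ M * |(a:ℝ) - b| := by
  obtain ⟨η, hη, hu⟩ := Metric.uniformContinuous_iff.1 (ext0_uc hr x 0) δ hδ
  set X := ext0 hr x 0 with hX
  have Xx : ∀ θ : Icc (-r) (0:ℝ), X θ = x θ := fun θ => by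
    have := congrArg (fun g : Hist n r => g θ) (ext0_hst hr x 0)
    simpa [hst_apply] using this
  have Xb : ∀ s, ‖X s‖ ≤ ‖x‖ := fun s => x.norm_coe_le_norm _
  set e := η / 2 with he
  have e0 : 0 < e := by positivity
  have ii : ∀ a b, IntervalIntegrable X volume a b := fun a b => X.continuous.intervalIntegrable a b
  have Ic : Continuous fun θ : ℝ => ∫ s in θ..(θ + e), X s := by
    have h1 := intervalIntegral.continuous_primitive ii 0
    have : (fun θ : ℝ => ∫ s in θ..(θ + e), X s) =
      fun t => (∫ s in (0:ℝ)..(t+e), X s) - ∫ s in (0:ℝ)..t, X s := by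
      funext t
      rw [intervalIntegral.integral_interval_sub_left (ii _ _) (ii _ _)]
    rw [this]
    exact (h1.comp (by fun_prop)).sub h1
  let z : Hist n r := ⟨fun θ => e⁻¹ • ∫ s in (θ:ℝ)..(θ + e), X s,
    (Ic.comp continuous_subtype_val).const_smul e⁻¹⟩
  have zap : ∀ θ, z θ = e⁻¹ • ∫ s in (θ:ℝ)..(θ + e), X s := fun _ => rfl
  refine ⟨z, ?_, e⁻¹ * (2 * ‖x‖), by positivity, fun a b => ?_⟩
  · rw [ContinuousMap.norm_le _ hδ.le]
    intro θ
    rw [ContinuousMap.sub_apply, zap]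
    have e1 : x θ = e⁻¹ • ∫ s in (θ:ℝ)..(θ + e), x θ := by
      rw [intervalIntegral.integral_const, smul_smul, add_sub_cancel_left, inv_mul_cancel₀ e0.ne',
        one_smul]
    rw [e1, ← smul_sub, ← intervalIntegral.integral_sub (ii _ _) (by simp), norm_smul, norm_inv,
      Real.norm_eq_abs, abs_of_pos e0]
    have := intervalIntegral.norm_integral_le_of_norm_le_const (a := (θ:ℝ)) (b := θ + e)
      (f := fun s => X s - x θ) (C := δ) (fun s hs => by
        rw [uIoc_of_le (by linarith)] at hs
        rw [← Xx, ← dist_eq_norm]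
        apply (hu _).le
        rw [Real.dist_eq, abs_of_pos (by linarith [hs.1])]
        linarith [hs.2])
    rw [add_sub_cancel_left, abs_of_pos e0] at this
    calc _ ≤ e⁻¹ * (δ * e) := by gcongr
      _ = δ := by field_simp
  · rw [zap, zap, ← smul_sub, norm_smul, norm_inv, Real.norm_eq_abs, abs_of_pos e0]
    have e1 : (∫ s in (a:ℝ)..(a + e), X s) - ∫ s in (b:ℝ)..(b + e), X s =
        (∫ u in (a:ℝ)..b, X u) - ∫ u in ((a:ℝ)+e)..(b+e), X u := by
      rw [← intervalIntegral.integral_add_adjacent_intervals (ii a b) (ii b (a+e)),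
        ← intervalIntegral.integral_add_adjacent_intervals (ii b (a + e)) (ii (a+e) (b+e))]
      abel
    have k : ∀ p q : ℝ, ‖∫ u in p..q, X u‖ ≤ ‖x‖ * |q - p| := fun p q =>
      intervalIntegral.norm_integral_le_of_norm_le_const fun u _ => Xb u
    have k1 := k a b
    have k2 := k (a+e) (b+e)
    rw [show (b:ℝ) + e - (a + e) = b - a by ring] at k2
    rw [e1, mul_assoc, abs_sub_comm (a:ℝ) b]
    gcongr
    refine (norm_sub_le _ _).trans ?_
    linarith
end TR


theorem lip_chain {w : ℝ → ℝ} {a b K δ : ℝ} (hδ : 0 < δ)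
    (h : ∀ s ∈ Icc a b, ∀ t ∈ Icc a b, s ≤ t → t - s ≤ δ → |w t - w s| ≤ K * (t - s)) :
    ∀ s ∈ Icc a b, ∀ t ∈ Icc a b, s ≤ t → |w t - w s| ≤ K * (t - s) := by
  have : ∀ N : ℕ, ∀ s ∈ Icc a b, ∀ t ∈ Icc a b, s ≤ t → t - s ≤ (N + 1) * δ →
      |w t - w s| ≤ K * (t - s) := by
    intro N
    induction N with
    | zero => intro s hs t ht hst hN; exact h s hs t ht hst (by simpa using hN)
    | succ N ih =>
      intro s hs t ht hst hN
      push_cast at hN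
      rcases le_total (t - s) δ with h1 | h1
      · exact h s hs t ht hst h1
      · have m : t - δ ∈ Icc a b := ⟨by linarith [hs.1], by linarith [ht.2]⟩
        have k1 := ih s hs (t - δ) m (by linarith) (by linarith)
        have k2 := h (t - δ) m t ht (by linarith) (by linarith)
        have := abs_add_le (w t - w (t - δ)) (w (t - δ) - w s)
        rw [sub_add_sub_cancel] at this
        linarith
  intro s hs t ht hst
  obtain ⟨N, hN⟩ := exists_nat_gt ((t - s) / δ)
  rw [div_lt_iff₀ hδ] at hN
  exact this N s hs t ht hst (by linarith)

section LY
variable {n l : ℕ} {r : ℝ} {hr : 0 < r} {D : Set (Euc l)}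
    {F : ℝ → Euc l → Hist n r → Euc n} {V : ℝ → Hist n r → ℝ} {ρ qt : ℝ → ℝ}

theorem deriv_le_dini (hr : 0 < r) {x : C(ℝ, Euc n)} {t w' c : ℝ} {v : Euc n}
    (hx : HasDerivAt x v t) (hw : HasDerivAt (fun s => V s (hst r x s)) w' t)
    (hd : diniH V t (hst r x t) v ≤ (c : EReal)) : w' ≤ c := by
  have hy := hst_Ehist_tendsto hr x t v hx.hasDerivWithinAt
  have hp : Tendsto (fun h : ℝ => (h, h⁻¹ • (hst r x (t + h) - Ehist h (hst r x t) v)))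
      (𝓝[>] 0) ((𝓝[>] (0:ℝ)) ×ˢ 𝓝 0) := tendsto_id.prodMk hy
  have hs : Tendsto (fun h : ℝ => (V (t + h) (hst r x (t + h)) - V t (hst r x t)) / h)
      (𝓝[>] 0) (𝓝 w') := by
    have := hw.tendsto_slope_zero_right
    refine this.congr fun h => ?_
    rw [smul_eq_mul]; ring
  have hs2 : Tendsto (fun h : ℝ => (((V (t + h) (hst r x (t + h)) - V t (hst r x t)) / h : ℝ) : EReal))
      (𝓝[>] 0) (𝓝 (w' : EReal)) := (continuous_coe_real_ereal.tendsto w').comp hs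
  have e1 := hs2.limsup_eq
  have e2 := Filter.limsup_le_limsup_of_le hp (u := fun p : ℝ × Hist n r =>
      (((V (t + p.1) (Ehist p.1 (hst r x t) v + p.1 • p.2) - V t (hst r x t)) / p.1 : ℝ) : EReal))
  rw [← Filter.limsup_comp] at e2
  have e3 : (w' : EReal) ≤ diniH V t (hst r x t) v := by
    rw [← e1]
    refine le_trans (le_of_eq ?_) e2
    apply Filter.limsup_congr
    filter_upwards [self_mem_nhdsWithin] with h h0
    have h0' : (0:ℝ) < h := h0
    simp only [Function.comp]
    rw [smul_smul, mul_inv_cancel₀ h0'.ne', one_smul, add_sub_cancel]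
  exact_mod_cast e3.trans hd

theorem ly_ineq (hc : CL hr D F) (hV : AlmostLipschitzOn r V) (hV0 : ∀ t x, 0 ≤ V t x)
    (hρ : ContinuousOn ρ (Ici 0)) (hq : ContinuousOn qt (Ici 0))
    (hdini : ∀ t, 0 ≤ t → ∀ x, ∀ d ∈ D, diniH V t x (F t d x) ≤ ((qt t - ρ (V t x) : ℝ) : EReal))
    {d : ℝ → Euc l} (hd : InMD D d) {t0 t1 : ℝ} (h0 : 0 ≤ t0) {x : C(ℝ, Euc n)}
    (hx : PSol F d t0 t1 x) {M0 : ℝ} (hM0 : 0 ≤ M0)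
    (hlip : ∀ a b, ‖hst r x t0 a - hst r x t0 b‖ ≤ M0 * |(a:ℝ) - b|) :
    ContinuousOn (fun t => V t (hst r x t)) (Icc t0 t1) ∧
    ∀ s ∈ Icc t0 t1, ∀ t ∈ Icc t0 t1, s ≤ t → V t (hst r x t) - V s (hst r x s) ≤
      ∫ u in s..t, (qt u - ρ (V u (hst r x u))) := by
  rcases lt_or_ge t1 t0 with h10 | h01
  · rw [Icc_eq_empty (not_le.2 h10)]; simp
  obtain ⟨R, R0, hR1, hR⟩ := hst_bdd (r := r) x t0 t1
  obtain ⟨M1, M10, hM1⟩ := hc.bdd R R0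
  have h1 : 0 ≤ t1 := h0.trans h01
  have ii := cl_ii hc hd x h0 h1
  have pl : ∀ s ∈ Icc t0 t1, ∀ t ∈ Icc t0 t1, ‖x t - x s‖ ≤ M1 * |t - s| := fun s hs t ht =>
    path_lip ii hx (fun u hu => hM1 u ⟨h0.trans hu.1, hu.2.trans hR1⟩ _ (hd.2 u) _ (hR u hu)) hs ht
  have il : ∀ s ∈ Icc (t0 - r) t0, ∀ t ∈ Icc (t0 - r) t0, ‖x t - x s‖ ≤ M0 * |t - s| := by
    intro s hs t ht
    have := hlip ⟨t - t0, by linarith [ht.1], by linarith [ht.2]⟩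
      ⟨s - t0, by linarith [hs.1], by linarith [hs.2]⟩
    simpa [hst_apply] using this
  have xl : ∀ s ∈ Icc (t0 - r) t1, ∀ t ∈ Icc (t0 - r) t1, ‖x t - x s‖ ≤ (M0 + M1) * |t - s| := by
    have : ∀ s ∈ Icc (t0 - r) t1, ∀ t ∈ Icc (t0 - r) t1, s ≤ t →
        ‖x t - x s‖ ≤ (M0 + M1) * |t - s| := by
      intro s hs t ht hst
      rw [abs_of_nonneg (by linarith)]
      have p0 : 0 ≤ M0 * (t - s) := mul_nonneg hM0 (by linarith)
      have p1 : 0 ≤ M1 * (t - s) := mul_nonneg M10 (by linarith)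
      rcases le_total t t0 with ht0 | ht0
      · have := il s ⟨hs.1, hst.trans ht0⟩ t ⟨ht.1, ht0⟩
        rw [abs_of_nonneg (by linarith)] at this; linarith
      · rcases le_total t0 s with hs0 | hs0
        · have := pl s ⟨hs0, hs.2⟩ t ⟨ht0, ht.2⟩
          rw [abs_of_nonneg (by linarith)] at this; linarith
        · have a := il s ⟨hs.1, hs0⟩ t0 ⟨by linarith, le_rfl⟩
          have b := pl t0 ⟨le_rfl, h01⟩ t ⟨ht0, ht.2⟩
          rw [abs_of_nonneg (by linarith)] at a b
          have c := norm_add_le (x t - x t0) (x t0 - x s)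
          rw [sub_add_sub_cancel] at c
          nlinarith
    intro s hs t ht
    rcases le_total s t with h | h
    · exact this s hs t ht h
    · rw [norm_sub_rev, abs_sub_comm]; exact this t ht s hs h
  have hl : ∀ t ∈ Icc t0 t1, LipschitzWith (Real.toNNReal (M0 + M1))
      (fun θ : Icc (-r) (0:ℝ) => hst r x t θ) := by
    intro t ht
    apply LipschitzWith.of_dist_le_mul
    intro a b
    rw [dist_eq_norm, hst_apply, hst_apply, Real.coe_toNNReal _ (by positivity), Subtype.dist_eq,
      Real.dist_eq]
    have := xl (t + b) ⟨by linarith [b.2.1, ht.1], by linarith [b.2.2, ht.2]⟩ (t + a)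
      ⟨by linarith [a.2.1, ht.1], by linarith [a.2.2, ht.2]⟩
    rwa [add_sub_add_left_eq_sub] at this
  have hsh : ∀ s ∈ Icc t0 t1, ∀ t ∈ Icc t0 t1, ‖hst r x t - hst r x s‖ ≤ (M0 + M1) * |t - s| := by
    intro s hs t ht
    rw [ContinuousMap.norm_le _ (by positivity)]
    intro θ
    rw [ContinuousMap.sub_apply, hst_apply, hst_apply]
    have := xl (s + θ) ⟨by linarith [θ.2.1, hs.1], by linarith [θ.2.2, hs.2]⟩ (t + θ)
      ⟨by linarith [θ.2.1, ht.1], by linarith [θ.2.2, ht.2]⟩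
    rwa [add_sub_add_right_eq_sub] at this
  obtain ⟨Vc, LV, P, G, LVm, Pm, Gm, G1, hP1, hP2⟩ := hV
  set K := |LV R| * (M0 + M1) + |P R| * (1 + (M0 + M1)) with hK
  have K0 : 0 ≤ K := by positivity
  have wl : ∀ s ∈ Icc t0 t1, ∀ t ∈ Icc t0 t1, s ≤ t →
      |V t (hst r x t) - V s (hst r x s)| ≤ K * (t - s) := by
    have Gp : 0 < G (R + (M0 + M1)) := by linarith [G1 (R + (M0 + M1))]
    refine lip_chain (w := fun t => V t (hst r x t)) (δ := 1 / G (R + (M0 + M1)))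
      (by positivity) ?_
    intro s hs t ht hle hδ
    have k1 := hP1 R R0 t ⟨h0.trans ht.1, ht.2.trans hR1⟩ (hst r x s) (hst r x t) (hR s hs) (hR t ht)
    have k2 := hP2 R R0 (M0 + M1) (by positivity) (hst r x s) (hR s hs) (hl s hs) s
      ⟨h0.trans hs.1, hs.2.trans hR1⟩ (t - s) (by linarith) hδ
    rw [add_sub_cancel] at k2
    have k3 := hsh s hs t ht
    rw [abs_of_nonneg (by linarith)] at k3
    have k4 : LV R * ‖hst r x t - hst r x s‖ ≤ |LV R| * ((M0 + M1) * (t - s)) := by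
      apply mul_le_mul (le_abs_self _) k3 (norm_nonneg _) (abs_nonneg _)
    have k5 : (t - s) * P R * (1 + (M0 + M1)) ≤ (t - s) * |P R| * (1 + (M0 + M1)) := by
      have : 0 ≤ t - s := by linarith
      gcongr
      exact le_abs_self _
    have := abs_add_le (V t (hst r x t) - V t (hst r x s)) (V t (hst r x s) - V s (hst r x s))
    rw [sub_add_sub_cancel] at this
    rw [hK]
    nlinarith
  have wlip : LipschitzOnWith (Real.toNNReal K) (fun t => V t (hst r x t)) (Icc t0 t1) := by
    apply LipschitzOnWith.of_dist_le_mul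
    intro s hs t ht
    rw [Real.dist_eq, Real.dist_eq, Real.coe_toNNReal _ K0]
    rcases le_total s t with h | h
    · rw [abs_sub_comm, abs_sub_comm s t, abs_of_nonneg (sub_nonneg.2 h)]; exact wl s hs t ht h
    · rw [abs_of_nonneg (sub_nonneg.2 h)]; exact wl t ht s hs h
  have wc := wlip.continuousOn
  refine ⟨wc, fun s hs t ht hst => ?_⟩
  have sub : Icc s t ⊆ Icc t0 t1 := Icc_subset_Icc hs.1 ht.2
  refine ineq_of_ae_deriv hst (wlip.mono sub) ?_ ?_
  · apply ContinuousOn.intervalIntegrable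
    rw [uIcc_of_le hst]
    refine (hq.mono fun u hu => h0.trans (sub hu).1).sub ?_
    exact hρ.comp (wc.mono sub) (fun u _ => hV0 _ _)
  · filter_upwards [path_deriv h01 ii hx] with u hu hus w' hw'
    have hu' : u ∈ Ioo t0 t1 := ⟨hs.1.trans_lt hus.1, hus.2.trans_le ht.2⟩
    exact deriv_le_dini hr (hu hu') hw' (hdini u (h0.trans hu'.1.le) _ _ (hd.2 u))

/-- scalar consequences -/
theorem scalar_bound {w : ℝ → ℝ} {t0 t1 Q : ℝ} (h0 : 0 ≤ t0) (hwc : ContinuousOn w (Icc t0 t1))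
    (hw0 : ∀ t, 0 ≤ w t)
    (hρ : IsPosDef ρ) (hq : ContinuousOn qt (Ici 0)) (hq0 : ∀ t, 0 ≤ t → 0 ≤ qt t)
    (hQ : ∀ s t, 0 ≤ s → s ≤ t → ∫ u in s..t, qt u ≤ Q)
    (h : ∀ s ∈ Icc t0 t1, ∀ t ∈ Icc t0 t1, s ≤ t → w t - w s ≤ ∫ u in s..t, (qt u - ρ (w u))) :
    (∀ s ∈ Icc t0 t1, ∀ t ∈ Icc t0 t1, s ≤ t → w t ≤ w s + ∫ u in s..t, qt u) ∧
    (∀ t ∈ Icc t0 t1, w t ≤ w t0 + Q) ∧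
    ∀ C ε m T1, 0 < ε → 0 < m → 0 ≤ T1 → w t0 ≤ C → (∀ v ∈ Icc (ε / 2) (C + Q), m ≤ ρ v) →
      (∀ s t, T1 ≤ s → s ≤ t → ∫ u in s..t, qt u ≤ ε / 2) →
      ∀ t ∈ Icc t0 t1, t0 + (T1 + (C + Q + 1) / m) ≤ t → w t ≤ ε := by
  have qi : ∀ s t, 0 ≤ s → s ≤ t → IntervalIntegrable qt volume s t := fun s t hs hst => by
    apply ContinuousOn.intervalIntegrable
    rw [uIcc_of_le hst]
    exact hq.mono fun u hu => hs.trans hu.1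
  have ri : ∀ s ∈ Icc t0 t1, ∀ t ∈ Icc t0 t1, s ≤ t →
      IntervalIntegrable (fun u => ρ (w u)) volume s t := fun s hs t ht hst => by
    apply ContinuousOn.intervalIntegrable
    rw [uIcc_of_le hst]
    exact hρ.1.comp (hwc.mono (Icc_subset_Icc hs.1 ht.2)) (fun u _ => hw0 u)
  have A : ∀ s ∈ Icc t0 t1, ∀ t ∈ Icc t0 t1, s ≤ t → w t ≤ w s + ∫ u in s..t, qt u := by
    intro s hs t ht hst
    have h1 := h s hs t ht hst
    rw [intervalIntegral.integral_sub (qi s t (h0.trans hs.1) hst) (ri s hs t ht hst)] at h1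
    have h2 : 0 ≤ ∫ u in s..t, ρ (w u) :=
      intervalIntegral.integral_nonneg hst fun u _ => hρ.2.2.2 _ (hw0 u)
    linarith
  have B : ∀ t ∈ Icc t0 t1, w t ≤ w t0 + Q := fun t ht => by
    have := A t0 ⟨le_rfl, ht.1.trans ht.2⟩ t ht ht.1
    linarith [hQ t0 t h0 ht.1]
  refine ⟨A, B, ?_⟩
  intro C ε m T1 hε hm hT1 hC hmρ hqε t ht hτ
  have Q0 : 0 ≤ Q := by
    have := hQ 0 0 le_rfl le_rfl; simpa using this
  have C0 : 0 ≤ C := (hw0 _).trans hC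
  set s0 := t0 + T1 with hs0
  have p : 0 ≤ (C + Q + 1) / m := by positivity
  have s0t : s0 ≤ t := by linarith
  have s0m : s0 ∈ Icc t0 t1 := ⟨by linarith, s0t.trans ht.2⟩
  have ex : ∃ s ∈ Icc s0 t, w s ≤ ε / 2 := by
    by_contra hcon
    push Not at hcon
    have h1 := h s0 s0m t ht s0t
    rw [intervalIntegral.integral_sub (qi s0 t (h0.trans s0m.1) s0t) (ri s0 s0m t ht s0t)] at h1
    have h2 : m * (t - s0) ≤ ∫ u in s0..t, ρ (w u) := by
      have : ∫ u in s0..t, m = m * (t - s0) := by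
        rw [intervalIntegral.integral_const, smul_eq_mul, mul_comm]
      rw [← this]
      apply intervalIntegral.integral_mono_on s0t (by simp) (ri s0 s0m t ht s0t)
      intro u hu
      apply hmρ
      refine ⟨(hcon u hu).le, ?_⟩
      have := B u ⟨s0m.1.trans hu.1, hu.2.trans ht.2⟩
      linarith
    have h3 := A t0 ⟨le_rfl, ht.1.trans ht.2⟩ s0 s0m s0m.1
    have h4 : (∫ u in t0..s0, qt u) + ∫ u in s0..t, qt u ≤ Q := by
      rw [intervalIntegral.integral_add_adjacent_intervals (qi _ _ h0 s0m.1)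
        (qi _ _ (h0.trans s0m.1) s0t)]
      exact hQ _ _ h0 ht.1
    have h5 : C + Q + 1 ≤ m * (t - s0) := by
      have : (C + Q + 1) / m ≤ t - s0 := by linarith
      rw [div_le_iff₀ hm] at this
      linarith
    have := hw0 t
    linarith
  obtain ⟨s, hs, hws⟩ := ex
  have h1 := A s ⟨s0m.1.trans hs.1, hs.2.trans ht.2⟩ t ht hs.2
  have h2 := hqε s t (by linarith [hs.1]) hs.2
  linarith

theorem alip_cont (hV : AlmostLipschitzOn r V) {t : ℝ} (ht : 0 ≤ t) : Continuous (V t) := by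
  have : ContinuousOn ((fun pr : ℝ × Hist n r => V pr.1 pr.2) ∘ fun x : Hist n r => (t, x))
    univ := hV.1.comp (by fun_prop) (fun x _ => ⟨ht, trivial⟩)
  exact continuousOn_univ.1 this

/-- the Lyapunov estimates for arbitrary solutions -/
theorem ly_general (hc : CL hr D F) (hV : AlmostLipschitzOn r V) (hV0 : ∀ t x, 0 ≤ V t x)
    (hρ : IsPosDef ρ) (hq : ContinuousOn qt (Ici 0)) (hq0 : ∀ t, 0 ≤ t → 0 ≤ qt t)
    (hqi : IntegrableOn qt (Ici 0))
    (hdini : ∀ t, 0 ≤ t → ∀ x, ∀ d ∈ D, diniH V t x (F t d x) ≤ ((qt t - ρ (V t x) : ℝ) : EReal)) :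
    ∃ Q, 0 ≤ Q ∧ (∀ d, InMD D d → ∀ t0 t1, 0 ≤ t0 → ∀ x, PSol F d t0 t1 x → ∀ t ∈ Icc t0 t1,
      V t (hst r x t) ≤ V t0 (hst r x t0) + Q) ∧
    ∀ C ε, 0 ≤ C → 0 < ε → ∃ τ, 0 ≤ τ ∧ ∀ d, InMD D d → ∀ t0 t1, 0 ≤ t0 → ∀ x, PSol F d t0 t1 x →
      V t0 (hst r x t0) ≤ C → ∀ t ∈ Icc t0 t1, t0 + τ ≤ t → V t (hst r x t) ≤ ε := by
  have qi : ∀ s t, 0 ≤ s → 0 ≤ t → IntervalIntegrable qt volume s t := fun s t hs ht => by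
    apply ContinuousOn.intervalIntegrable
    exact hq.mono fun u hu => (le_min hs ht).trans hu.1
  set Q := ∫ u in Ici 0, qt u with hQdef
  have hQ : ∀ s t, 0 ≤ s → s ≤ t → ∫ u in s..t, qt u ≤ Q := by
    intro s t hs hst
    rw [intervalIntegral.integral_of_le hst]
    apply setIntegral_mono_set hqi
    · rw [EventuallyLE, ae_restrict_iff' measurableSet_Ici]
      exact ae_of_all _ fun u hu => hq0 u hu
    · exact (Filter.Eventually.of_forall fun u (hu : u ∈ Ioc s t) => (hs.trans hu.1.le : u ∈ Ici 0))
  have Q0 : 0 ≤ Q := by have := hQ 0 0 le_rfl le_rfl; simpa using this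
  -- tails
  have tail : ∀ ε > 0, ∃ T1, 0 ≤ T1 ∧ ∀ s t, T1 ≤ s → s ≤ t → ∫ u in s..t, qt u ≤ ε := by
    intro ε hε
    have lim := intervalIntegral_tendsto_integral_Ioi 0 (hqi.mono_set Ioi_subset_Ici_self) tendsto_id
    obtain ⟨T, hT0, hT⟩ := ((lim.eventually_const_lt (sub_lt_self _ hε)).and
      (eventually_ge_atTop 0)).exists
    refine ⟨T, hT, fun s t hs hst => ?_⟩
    have e1 := intervalIntegral.integral_add_adjacent_intervals (qi 0 T le_rfl hT)
      (qi T s hT (hT.trans hs))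
    have e2 := intervalIntegral.integral_add_adjacent_intervals (qi 0 s le_rfl (hT.trans hs))
      (qi s t (hT.trans hs) (hT.trans (hs.trans hst)))
    have e3 : 0 ≤ ∫ u in T..s, qt u :=
      intervalIntegral.integral_nonneg hs fun u hu => hq0 u (hT.trans hu.1)
    have e4 := hQ 0 t le_rfl (hT.trans (hs.trans hst))
    rw [hQdef, integral_Ici_eq_integral_Ioi] at e4
    simp only [id] at hT0
    linarith
  -- approximation
  have app : ∀ d, InMD D d → ∀ t0 t1, 0 ≤ t0 → ∀ x, PSol F d t0 t1 x → ∀ t ∈ Icc t0 t1, ∀ η > 0,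
      ∃ z M0, 0 ≤ M0 ∧ PSol F d t0 t1 z ∧ (∀ a b, ‖hst r z t0 a - hst r z t0 b‖ ≤ M0 * |(a:ℝ) - b|) ∧
        V t0 (hst r z t0) < V t0 (hst r x t0) + η ∧ V t (hst r x t) < V t (hst r z t) + η := by
    intro d hd t0 t1 h0 x hx t ht η hη
    have c1 := (alip_cont hV h0).tendsto (hst r x t0)
    have c2 := (alip_cont hV (h0.trans ht.1)).tendsto (hst r x t)
    rw [Metric.tendsto_nhds_nhds] at c1 c2
    obtain ⟨δ1, hδ1, k1⟩ := c1 η hη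
    obtain ⟨δ2, hδ2, k2⟩ := c2 η hη
    obtain ⟨δ, hδ, k⟩ := psol_near hc hd h0 (ht.1.trans ht.2) hx (ε := min (δ1 / 2) (δ2 / 2))
      (by positivity)
    obtain ⟨z0, hz0, M0, hM0, hl⟩ := lip_dense hr (hst r x t0) hδ
    obtain ⟨z, hz1, hz2, hz3⟩ := k z0 hz0
    refine ⟨z, M0, hM0, hz2, by rw [hz1]; exact hl, ?_, ?_⟩
    · have := hz3 t0 ⟨le_rfl, ht.1.trans ht.2⟩
      have := k1 (x := hst r z t0) (by
        rw [dist_eq_norm]; linarith [min_le_left (δ1 / 2) (δ2 / 2)])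
      rw [Real.dist_eq] at this
      linarith [(abs_lt.1 this).2]
    · have := hz3 t ht
      have := k2 (x := hst r z t) (by
        rw [dist_eq_norm]; linarith [min_le_right (δ1 / 2) (δ2 / 2)])
      rw [Real.dist_eq] at this
      linarith [(abs_lt.1 this).1]
  have sc : ∀ d, InMD D d → ∀ t0 t1, 0 ≤ t0 → ∀ z, PSol F d t0 t1 z → ∀ M0, 0 ≤ M0 →
      (∀ a b, ‖hst r z t0 a - hst r z t0 b‖ ≤ M0 * |(a:ℝ) - b|) → _ :=
    fun d hd t0 t1 h0 z hz M0 hM0 hl =>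
      scalar_bound h0 (ly_ineq hc hV hV0 hρ.1 hq hdini hd h0 hz hM0 hl).1
        (fun t => hV0 _ _) hρ hq hq0 hQ (ly_ineq hc hV hV0 hρ.1 hq hdini hd h0 hz hM0 hl).2
  refine ⟨Q, Q0, ?_, ?_⟩
  · intro d hd t0 t1 h0 x hx t ht
    apply le_of_forall_pos_le_add
    intro η hη
    obtain ⟨z, M0, hM0, hz, hl, a, b⟩ := app d hd t0 t1 h0 x hx t ht (η / 2) (by positivity)
    have := (sc d hd t0 t1 h0 z hz M0 hM0 hl).2.1 t ht
    linarith
  · intro C ε hC hε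
    obtain ⟨T1, hT1, hT⟩ := tail (ε / 2 / 2) (by positivity)
    have exm : ∃ m, 0 < m ∧ ∀ v ∈ Icc (ε / 2 / 2) (C + 1 + Q), m ≤ ρ v := by
      rcases (Icc (ε / 2 / 2) (C + 1 + Q)).eq_empty_or_nonempty with h | h
      · exact ⟨1, one_pos, by rw [h]; simp⟩
      · have pos : ∀ v ∈ Icc (ε / 2 / 2) (C + 1 + Q), 0 < v := fun v hv =>
          lt_of_lt_of_le (by positivity) hv.1
        obtain ⟨v, hv, hmin⟩ := isCompact_Icc.exists_isMinOn h
          (hρ.1.mono fun v hv => mem_Ici.2 (pos v hv).le)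
        exact ⟨ρ v, hρ.2.2.1 v (pos v hv), fun u hu => hmin hu⟩
    obtain ⟨m, hm, hmρ⟩ := exm
    refine ⟨T1 + (C + 1 + Q + 1) / m, by positivity, ?_⟩
    intro d hd t0 t1 h0 x hx hx0 t ht hτ
    obtain ⟨z, M0, hM0, hz, hl, a, b⟩ := app d hd t0 t1 h0 x hx t ht (min 1 (ε / 2)) (by positivity)
    have := (sc d hd t0 t1 h0 z hz M0 hM0 hl).2.2 (C + 1) (ε / 2) m T1 (by positivity) hm hT1
      (by linarith [min_le_left 1 (ε / 2)]) hmρ hT t ht hτ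
    linarith [min_le_right 1 (ε / 2)]
end LY



section GLO
variable {n l : ℕ} {r : ℝ} {hr : 0 < r} {D : Set (Euc l)}
    {F : ℝ → Euc l → Hist n r → Euc n}

theorem exists_on (hc : CL hr D F) {d : ℝ → Euc l} (hd : InMD D d) {t0 T M : ℝ} (h0 : 0 ≤ t0)
    (h01 : t0 ≤ T) (x0 : Hist n r)
    (ap : ∀ t1 ≤ T, ∀ x, hst r x t0 = x0 → PSol F d t0 t1 x →
      ∀ t ∈ Icc t0 t1, ‖hst r x t‖ ≤ M) (hM : ‖x0‖ ≤ M) :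
    ∃ x, hst r x t0 = x0 ∧ PSol F d t0 T x := by
  have M0 : 0 ≤ M := (norm_nonneg _).trans hM
  obtain ⟨x, hx0, hx⟩ := exists_trunc hc hd (R := M + 1) (by linarith) h0 h01 x0
  refine ⟨x, hx0, ?_⟩
  have gc : Continuous fun t => ‖hst r x t‖ := (hst_continuous r x).norm
  rw [← psol_trunc (R := M + 1)]
  · exact hx
  by_contra hcon
  push Not at hcon
  obtain ⟨tb, htb, hb⟩ := hcon
  have cs : IsCompact (Icc t0 T ∩ {t | M + 1 ≤ ‖hst r x t‖}) :=
    isCompact_Icc.inter_right (isClosed_le continuous_const gc)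
  obtain ⟨s, hs, hmin⟩ := cs.exists_isLeast ⟨tb, htb, hb.le⟩
  have hs2 : M + 1 ≤ ‖hst r x s‖ := hs.2
  have lt : t0 < s := by
    rcases hs.1.1.eq_or_lt with h | h
    · rw [← h, hx0] at hs2; linarith
    · exact h
  have key : ∀ t ∈ Ico t0 s, ‖hst r x t‖ ≤ M := by
    intro t ht
    have hb : ∀ u ∈ Icc t0 t, ‖hst r x u‖ ≤ M + 1 := by
      intro u hu
      by_contra hh
      push Not at hh
      have := hmin (a := u) ⟨⟨hu.1, by linarith [hu.2, ht.2, hs.1.2]⟩, hh.le⟩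
      linarith [hu.2, ht.2]
    exact ap t (by linarith [ht.2, hs.1.2]) x hx0
      ((psol_trunc hb).1 (hx.mono (by linarith [ht.2, hs.1.2]))) t ⟨ht.1, le_rfl⟩
  have : ‖hst r x s‖ ≤ M := by
    have h1 : Tendsto (fun t => ‖hst r x t‖) (𝓝[<] s) (𝓝 ‖hst r x s‖) :=
      gc.continuousAt.mono_left nhdsWithin_le_nhds
    refine le_of_tendsto h1 ?_
    filter_upwards [Ico_mem_nhdsLT lt] with t ht using key t ht
  linarith

theorem exists_global (hc : CL hr D F) {d : ℝ → Euc l} (hd : InMD D d) {t0 : ℝ} (h0 : 0 ≤ t0)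
    (x0 : Hist n r)
    (ap : ∀ T, t0 ≤ T → ∃ M, ‖x0‖ ≤ M ∧ ∀ t1 ≤ T, ∀ x, hst r x t0 = x0 → PSol F d t0 t1 x →
      ∀ t ∈ Icc t0 t1, ‖hst r x t‖ ≤ M) :
    ∃ x, hst r x t0 = x0 ∧ ∀ t1, PSol F d t0 t1 x := by
  have : ∀ N : ℕ, ∃ x, hst r x t0 = x0 ∧ PSol F d t0 (t0 + N) x := by
    intro N
    have hN : t0 ≤ t0 + N := by simp
    obtain ⟨M, hM, h⟩ := ap (t0 + N) hN
    exact exists_on hc hd h0 hN x0 h hM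
  choose X hX0 hX using this
  have agree0 : ∀ N K : ℕ, N ≤ K → ∀ t ∈ Icc t0 (t0 + N), hst r (X N) t = hst r (X K) t := by
    intro N K hNK
    have : (N:ℝ) ≤ K := by exact_mod_cast hNK
    exact (hX N).unique hc hd h0 ((hX K).mono (by linarith)) (by rw [hX0, hX0])
  have agree : ∀ N K : ℕ, N ≤ K → ∀ t ∈ Icc (t0 - r) (t0 + N), X N t = X K t := by
    intro N K hNK t ht
    rcases le_total t t0 with h | h
    · have := agree0 N K hNK t0 ⟨le_rfl, by simp⟩
      have := congrArg (fun g : Hist n r => g ⟨t - t0, by linarith [ht.1], by linarith⟩) this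
      simpa [hst_apply] using this
    · have := agree0 N K hNK t ⟨h, ht.2⟩
      have := congrArg (fun g : Hist n r => g (zz hr)) this
      simpa [hst_apply, zz] using this
  have agree' : ∀ N K : ℕ, ∀ t, t0 - r ≤ t → t ≤ t0 + N → t ≤ t0 + K → X N t = X K t := by
    intro N K t h1 h2 h3
    rcases le_total N K with h | h
    · exact agree N K h t ⟨h1, h2⟩
    · exact (agree K N h t ⟨h1, h3⟩).symm
  set Z : ℝ → Euc n := fun t => X ⌈|t - t0|⌉₊ (max t (t0 - r)) with hZ
  have hZe : ∀ (N : ℕ) t, t ≤ t0 + N → Z t = X N (max t (t0 - r)) := by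
    intro N t ht
    have h1 := Nat.le_ceil |t - t0|
    have h2 := le_abs_self (t - t0)
    have h3 := abs_nonneg (t - t0)
    have h4 : (0:ℝ) ≤ N := Nat.cast_nonneg _
    exact agree' _ _ _ (le_max_right _ _) (max_le (by linarith) (by linarith))
      (max_le ht (by linarith))
  have Zc : Continuous Z := by
    rw [continuous_iff_continuousAt]
    intro t
    obtain ⟨N, hN⟩ := exists_nat_gt (t - t0)
    have : ContinuousAt (fun t => X N (max t (t0 - r))) t := by
      apply Continuous.continuousAt; fun_prop
    refine this.congr ?_
    filter_upwards [eventually_lt_nhds (show t < t0 + N by linarith)] with s hs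
    exact (hZe N s hs.le).symm
  have hh : ∀ (N : ℕ) t, t ∈ Icc t0 (t0 + N) → hst r ⟨Z, Zc⟩ t = hst r (X N) t := by
    intro N t ht
    ext1 θ
    rw [hst_apply, hst_apply]
    have := hZe N (t + θ) (by linarith [θ.2.2, ht.2])
    rw [max_eq_left (by linarith [θ.2.1, ht.1])] at this
    exact this
  refine ⟨⟨Z, Zc⟩, by rw [hh 0 t0 (by simp), hX0], ?_⟩
  intro t1 t ht
  obtain ⟨N, hN⟩ := exists_nat_gt (t - t0)
  have e1 := hZe N t (by linarith)
  have e2 := hZe N t0 (by simp)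
  rw [max_eq_left (by linarith [ht.1])] at e1
  rw [max_eq_left (by linarith [ht.1])] at e2
  show Z t = Z t0 + _
  rw [e1, e2, hX N t ⟨ht.1, by linarith⟩]
  congr 1
  apply intervalIntegral.integral_congr
  intro s hs
  rw [uIcc_of_le ht.1] at hs
  simp only
  rw [hh N s ⟨hs.1, by linarith [hs.2]⟩]

theorem kinf_le {a : ℝ → ℝ} (ha : IsKinf a) (C : ℝ) : ∃ K, 0 ≤ K ∧ ∀ s, a s ≤ C → s ≤ K := by
  obtain ⟨K, hK⟩ := (ha.2.2.2.eventually_gt_atTop C).exists_forall_of_atTop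
  refine ⟨max K 0, le_max_right _ _, fun s hs => ?_⟩
  by_contra h
  push Not at h
  have := hK s ((le_max_left _ _).trans h.le)
  linarith

theorem rgaos_of_ly {Y : Type*} [NormedAddCommGroup Y] [NormedSpace ℝ Y] {H : ℝ → Hist n r → Y}
    {V : ℝ → Hist n r → ℝ} {a₁ a₂ β μ : ℝ → ℝ} {Q : ℝ}
    (hc : CL hr D F) (hH0 : ∀ t : ℝ, 0 ≤ t → H t 0 = 0)
    (hHL : ∀ T, 0 ≤ T → ∀ R, 0 ≤ R → ∃ LH, 0 ≤ LH ∧ ∀ t ∈ Icc (0:ℝ) T, ∀ τ ∈ Icc (0:ℝ) T,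
      ∀ x y : Hist n r, ‖x‖ ≤ R → ‖y‖ ≤ R → ‖H t x - H τ y‖ ≤ LH * (|t - τ| + ‖x - y‖))
    (ha₁ : IsKinf a₁) (ha₂ : IsKinf a₂) (hβ : IsKplus β) (hμ : IsKplus μ)
    (hV0 : ∀ t x, 0 ≤ V t x)
    (hV : ∀ t : ℝ, 0 ≤ t → ∀ x : Hist n r,
      max (a₁ ‖H t x‖) (a₁ (μ t * ‖x‖)) ≤ V t x ∧ V t x ≤ a₂ (β t * ‖x‖))
    (hQ : ∀ d, InMD D d → ∀ t0 t1, 0 ≤ t0 → ∀ x, PSol F d t0 t1 x → ∀ t ∈ Icc t0 t1,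
      V t (hst r x t) ≤ V t0 (hst r x t0) + Q)
    (hat : ∀ C ε, 0 ≤ C → 0 < ε → ∃ τ, 0 ≤ τ ∧ ∀ d, InMD D d → ∀ t0 t1, 0 ≤ t0 → ∀ x,
      PSol F d t0 t1 x →
      V t0 (hst r x t0) ≤ C → ∀ t ∈ Icc t0 t1, t0 + τ ≤ t → V t (hst r x t) ≤ ε) :
    RGAOSrfde r D F H := by
  have vb : ∀ T, 0 ≤ T → ∀ s, 0 ≤ s → ∃ C, 0 ≤ C ∧ ∀ t ∈ Icc 0 T, ∀ x : Hist n r, ‖x‖ ≤ s →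
      V t x ≤ C := by
    intro T hT s hs
    obtain ⟨B, hB⟩ := isCompact_Icc.exists_bound_of_continuousOn
      (hβ.1.mono (fun t (ht : t ∈ Icc 0 T) => mem_Ici.2 ht.1))
    have B0 : 0 ≤ B := (norm_nonneg _).trans (hB 0 ⟨le_rfl, hT⟩)
    have mo : ∀ x y, 0 ≤ x → x ≤ y → a₂ x ≤ a₂ y := fun x y hx hxy =>
      ha₂.2.1.monotoneOn hx (hx.trans hxy) hxy
    refine ⟨a₂ (B * s), by rw [← ha₂.2.2.1]; exact mo _ _ le_rfl (by positivity), ?_⟩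
    intro t ht x hx
    refine (hV t ht.1 x).2.trans (mo _ _ (mul_nonneg (hβ.2 t ht.1).le (norm_nonneg _)) ?_)
    have := hB t ht
    rw [Real.norm_eq_abs] at this
    exact mul_le_mul ((le_abs_self _).trans this) hx (norm_nonneg _) B0
  have ap : ∀ T, 0 ≤ T → ∀ s, 0 ≤ s → ∃ M, 0 ≤ M ∧ ∀ d, InMD D d → ∀ t0 t1, 0 ≤ t0 → t1 ≤ T → ∀ x,
      PSol F d t0 t1 x → ‖hst r x t0‖ ≤ s → ∀ t ∈ Icc t0 t1, ‖hst r x t‖ ≤ M := by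
    intro T hT s hs
    obtain ⟨C, hC, h⟩ := vb T hT s hs
    obtain ⟨K, K0, hK⟩ := kinf_le ha₁ (C + Q)
    obtain ⟨tm, htm, hmin⟩ := isCompact_Icc.exists_isMinOn ⟨0, le_rfl, hT⟩
      (hμ.1.mono (fun t (ht : t ∈ Icc 0 T) => mem_Ici.2 ht.1))
    have m0 := hμ.2 tm htm.1
    refine ⟨K / μ tm, by positivity, ?_⟩
    intro d hd t0 t1 h0 h1 x hx hx0 t ht
    have e1 := hQ d hd t0 t1 h0 x hx t ht
    have e2 := h t0 ⟨h0, by linarith [ht.1, ht.2]⟩ _ hx0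
    have e3 := hK _ ((le_max_right _ _).trans
      ((hV t (h0.trans ht.1) (hst r x t)).1.trans (by linarith)))
    rw [le_div_iff₀ m0, mul_comm]
    have : μ tm ≤ μ t := hmin ⟨h0.trans ht.1, ht.2.trans h1⟩
    nlinarith [norm_nonneg (hst r x t)]
  have ex : ∀ t0 x0 d, 0 ≤ t0 → InMD D d → ∃ x, hst r x t0 = x0 ∧ ∀ t1, PSol F d t0 t1 x := by
    intro t0 x0 d h0 hd
    refine exists_global hc hd h0 x0 fun T hT => ?_
    obtain ⟨M, M0, hM⟩ := ap T (h0.trans hT) ‖x0‖ (norm_nonneg _)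
    refine ⟨max M ‖x0‖, le_max_right _ _, ?_⟩
    intro t1 h1 x hx0 hx t ht
    exact (hM d hd t0 t1 h0 h1 x hx (by rw [hx0]) t ht).trans (le_max_left _ _)
  have exX : ∃ X : ℝ → Hist n r → (ℝ → Euc l) → C(ℝ, Euc n), ∀ t0 x0 d, 0 ≤ t0 → InMD D d →
      hst r (X t0 x0 d) t0 = x0 ∧ ∀ t1, PSol F d t0 t1 (X t0 x0 d) := by
    classical
    refine ⟨fun t0 x0 d => if h : 0 ≤ t0 ∧ InMD D d then (ex t0 x0 d h.1 h.2).choose else 0, ?_⟩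
    intro t0 x0 d h0 hd
    simp only [dif_pos (And.intro h0 hd)]
    exact (ex t0 x0 d h0 hd).choose_spec
  obtain ⟨X, hX⟩ := exX
  have a1le : ∀ s ε, 0 ≤ s → 0 ≤ ε → a₁ s ≤ a₁ ε → s ≤ ε := fun s ε hs hε h =>
    (ha₁.2.1.le_iff_le hs hε).1 h
  have a1pos : ∀ ε, 0 < ε → 0 < a₁ ε := fun ε hε => by
    rw [← ha₁.2.2.1]; exact ha₁.2.1 (mem_Ici.2 le_rfl) (mem_Ici.2 hε.le) hε
  have att : ∀ ε, 0 < ε → ∀ T, 0 ≤ T → ∀ R, 0 ≤ R → ∃ τ, 0 ≤ τ ∧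
      ∀ t₀ ∈ Icc (0:ℝ) T, ∀ x₀ : Hist n r, ‖x₀‖ ≤ R → ∀ d, InMD D d →
        ∀ t : ℝ, t₀ + τ ≤ t → ‖H t (hst r (X t₀ x₀ d) t)‖ ≤ ε := by
    intro ε hε T hT R hR
    obtain ⟨C, hC, h⟩ := vb T hT R hR
    obtain ⟨τ, hτ, hh⟩ := hat C (a₁ ε) hC (a1pos ε hε)
    refine ⟨τ, hτ, ?_⟩
    intro t0 ht0 x0 hx0 d hd t ht
    obtain ⟨e, p⟩ := hX t0 x0 d ht0.1 hd
    have := hh d hd t0 t ht0.1 _ (p t) (by rw [e]; exact h t0 ht0 x0 hx0) t ⟨by linarith, le_rfl⟩ ht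
    exact a1le _ _ (norm_nonneg _) hε.le ((le_max_left _ _).trans
      ((hV t (by linarith [ht0.1]) _).1.trans this))
  refine ⟨fun t0 x0 d => X t0 x0 d, fun t0 x0 d => hst r (X t0 x0 d), fun _ _ _ => ⊤, ?_, ?_, ?_, ?_⟩
  · intro t0 h0 x0 d hd
    obtain ⟨e, p⟩ := hX t0 x0 d h0 hd
    refine ⟨by have := rfde_of_psol p; rwa [e] at this, ?_⟩
    intro tm y ψ hy
    refine ⟨le_top, fun t ht0 ht => ?_⟩
    obtain ⟨Z, z0, z1, z2⟩ := psol_of_rfde hr hy ht0 ht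
    rw [← z1 t ⟨ht0, le_rfl⟩]
    exact z2.unique hc hd h0 (p t) (by rw [e, z0]) t ⟨ht0, le_rfl⟩
  · intro T hT s hs
    obtain ⟨M, M0, hM⟩ := ap (T + T) (by linarith) s hs
    refine ⟨M, ?_⟩
    intro t0 ht0 ξ hξ x0 hx0 d hd
    obtain ⟨e, p⟩ := hX t0 x0 d ht0.1 hd
    exact ⟨EReal.coe_lt_top _, hM d hd t0 (t0 + ξ) ht0.1 (by linarith [ht0.2, hξ.2]) _ (p _)
      (by rw [e]; exact hx0) _ ⟨by linarith [hξ.1], le_rfl⟩⟩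
  · intro ε hε T hT
    constructor
    · obtain ⟨C, hC, h⟩ := vb T hT ε hε.le
      obtain ⟨K, K0, hK⟩ := kinf_le ha₁ (C + Q)
      refine ⟨K, ?_⟩
      intro t0 ht0 x0 hx0 d hd t ht _
      obtain ⟨e, p⟩ := hX t0 x0 d ht0.1 hd
      have e1 := hQ d hd t0 t ht0.1 _ (p t) t ⟨ht, le_rfl⟩
      have e2 := h t0 ht0 _ hx0
      rw [e] at e1
      exact hK _ ((le_max_left _ _).trans ((hV t (ht0.1.trans ht) _).1.trans (by linarith)))
    · obtain ⟨τ, hτ, hA⟩ := att ε hε T hT 1 zero_le_one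
      obtain ⟨M, M0, hM⟩ := ap (T + τ) (by linarith) 1 zero_le_one
      set R := max (T + τ) M with hR
      have R0 : 0 ≤ R := M0.trans (le_max_right _ _)
      obtain ⟨L, L0, hL⟩ := hc.osl R R0
      obtain ⟨LH, LH0, hLH⟩ := hHL (T + τ) (by linarith) M M0
      set E := LH * Real.exp (L * (T + τ)) with hE
      have E0 : 0 ≤ E := by positivity
      refine ⟨min 1 (ε / (E + 1)), by positivity, ?_⟩
      intro t0 ht0 x0 hx0 d hd t ht _
      obtain ⟨e, p⟩ := hX t0 x0 d ht0.1 hd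
      rcases le_total (t0 + τ) t with h | h
      · exact hA t0 ht0 x0 (hx0.trans (min_le_left _ _)) d hd t h
      have tT : t ≤ T + τ := by linarith [ht0.2]
      have xb := hM d hd t0 t ht0.1 tT _ (p t) (by rw [e]; exact hx0.trans (min_le_left _ _))
      have z : ∀ s, hst r (0 : C(ℝ, Euc n)) s = 0 := fun s => by ext1 θ; rfl
      have di := (p t).dist hc hd ht0.1 (PSol.zero hc hd ht0.1) (T := R)
        (tT.trans (le_max_left _ _)) (R := R) (fun s hs => (xb s hs).trans (le_max_right _ _))
        (fun s hs => by rw [z, norm_zero]; exact R0) L0 hL t ⟨ht, le_rfl⟩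
      rw [z, z, sub_zero, sub_zero, e] at di
      have t00 : 0 ≤ t := ht0.1.trans ht
      have hh := hLH t ⟨t00, tT⟩ t ⟨t00, tT⟩ (hst r (X t0 x0 d) t) 0 (xb t ⟨ht, le_rfl⟩) (by simpa)
      rw [hH0 t t00, sub_zero, sub_zero, sub_self, abs_zero, zero_add] at hh
      calc _ ≤ _ := hh
        _ ≤ LH * (Real.exp (L * (T + τ)) * (ε / (E + 1))) := by
          gcongr
          refine di.trans ?_
          have : L * (t - t0) ≤ L * (T + τ) := by gcongr; linarith [ht0.1]
          have := Real.exp_le_exp.2 this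
          have := hx0.trans (min_le_right _ _)
          gcongr
        _ = ε * (E / (E + 1)) := by rw [hE]; ring
        _ ≤ ε * 1 := by gcongr; rw [div_le_one (by positivity)]; linarith
        _ = ε := mul_one _
  · intro ε hε T hT R hR
    obtain ⟨τ, hτ, h⟩ := att ε hε T hT R hR
    exact ⟨τ, hτ, fun t0 ht0 x0 hx0 d hd t ht _ => h t0 ht0 x0 hx0 d hd t ht⟩
end GLO



open scoped Manifold ContDiff in
theorem smooth_select {p m : ℕ} (S : ℝ × Euc p → Set (Euc m)) (hS : ∀ z, Convex ℝ (S z))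
    (hloc : ∀ z, ∃ c, ∀ᶠ y in 𝓝 z, c ∈ S y) : ∃ g : ℝ × Euc p → Euc m, ContDiff ℝ 1 g ∧ ∀ z, g z ∈ S z := by
  obtain ⟨g, hg⟩ := exists_contMDiffMap_forall_mem_convex_of_local_const (n := 1)
    (I := 𝓘(ℝ, ℝ × Euc p)) (F := Euc m) (t := S) hS hloc
  exact ⟨g, contMDiff_iff_contDiff.1 g.contMDiff, hg⟩

theorem hull_fin {m : ℕ} {A : Set (Euc m)} {x : Euc m} (hx : x ∈ convexHull ℝ A) :
    ∃ (N : ℕ) (u : Fin N → Euc m) (lam : Fin N → ℝ), (∀ i, u i ∈ A) ∧ (∀ i, 0 ≤ lam i) ∧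
      (∑ i, lam i) = 1 ∧ ∑ i, lam i • u i = x := by
  obtain ⟨ι, _, w, z, h1, h2, h3, h4⟩ := mem_convexHull_iff_exists_fintype.1 hx
  let e := (Fintype.equivFin ι).symm
  refine ⟨Fintype.card ι, z ∘ e, w ∘ e, fun i => h3 _, fun i => h1 _, ?_, ?_⟩
  · rw [← h2]; exact e.sum_comp w
  · rw [← h4]; exact e.sum_comp (fun i => w i • z i)

section CA
variable {n l m : ℕ} {Y : Type*} [NormedAddCommGroup Y] [NormedSpace ℝ Y]
    {r : ℝ} {hr : 0 < r} {D : Set (Euc l)} {U : Set (Euc m)}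
    {f : ℝ → Euc l → Hist n r → Euc m → Euc n} {H : ℝ → Hist n r → Y}

theorem c_imp_a (hS : HypS r hr D U f H) {p : ℕ} {V : ℝ → Hist n r → ℝ} {a₁ a₂ β μ : ℝ → ℝ}
    {Ψ : ℝ → Euc p → Euc m → EReal} {Φ : ℝ → Hist n r → Euc p} {q ρ : ℝ → ℝ}
    (h : ORCLFrfde r D U f H V a₁ a₂ β μ Ψ Φ q ρ) :
    ∃ kf : ℝ → Hist n r → Euc m, GoodFeedback r U kf ∧
    RGAOSrfde r D (fun t d x => f t d x (kf t x)) H := by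
  obtain ⟨hV, hV0, ha₁, ha₂, hβ, hμ, hVb, hq, hρ, -, hΨ0, hΨu, hΦc, hΦL, hΦ0, hinf, hdi⟩ := h
  have hS' := hS
  obtain ⟨-, hH0, -, -, -, -, -, -, hDc, hDn, hUcl, hUcv, hU0, hHL⟩ := hS'
  set Q : ℝ → ℝ := fun t => q (max t 0) + Real.exp (-(max t 0)) with hQ
  have Qc : Continuous Q := by
    have : Continuous fun t : ℝ => q (max t 0) :=
      hq.1.comp_continuous (by fun_prop) (fun t => mem_Ici.2 (le_max_right _ _))
    exact this.add (by fun_prop)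
  have Qgt : ∀ t, q (max t 0) < Q t := fun t => by
    simp only [hQ]; linarith [Real.exp_pos (-(max t 0))]
  set A : ℝ × Euc p → Set (Euc m) := fun z => {u | u ∈ U ∧ Ψ (max z.1 0) z.2 u < (Q z.1 : ℝ)} with hA
  set S : ℝ × Euc p → Set (Euc m) := fun z => {u | (z.2 = 0 → u = 0) ∧ (z.2 ≠ 0 → u ∈ convexHull ℝ (A z))}
    with hSdef
  have AU : ∀ z, convexHull ℝ (A z) ⊆ U := fun z => convexHull_min (fun u hu => hu.1) hUcv
  -- openness
  have op : ∀ z u, u ∈ A z → ∀ᶠ y in 𝓝 z, u ∈ A y := by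
    intro z u hu
    obtain ⟨y, hy1, hy2⟩ := EReal.lt_iff_exists_real_btwn.1 hu.2
    have c1 : Tendsto (fun w : ℝ × Euc p => (max w.1 0, w.2)) (𝓝 z)
        (𝓝[Ici 0 ×ˢ univ] (max z.1 0, z.2)) := by
      refine tendsto_nhdsWithin_iff.2 ⟨?_, Eventually.of_forall fun w =>
        ⟨mem_Ici.2 (le_max_right _ _), trivial⟩⟩
      exact Continuous.tendsto (by fun_prop) z
    have e1 := c1.eventually (hΨu u hu.1 (max z.1 0, z.2) ⟨mem_Ici.2 (le_max_right _ _), trivial⟩ y hy1)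
    have e2 : ∀ᶠ w : ℝ × Euc p in 𝓝 z, y < Q w.1 :=
      (Qc.comp continuous_fst).continuousAt.eventually_const_lt (by exact_mod_cast hy2)
    filter_upwards [e1, e2] with w h1 h2
    exact ⟨hu.1, lt_trans h1 (by exact_mod_cast h2)⟩
  have Sc : ∀ z, Convex ℝ (S z) := by
    intro z
    by_cases hz : z.2 = 0
    · have : S z = {0} := by ext u; simp [hSdef, hz]
      rw [this]; exact convex_singleton 0
    · have : S z = convexHull ℝ (A z) := by ext u; simp [hSdef, hz]
      rw [this]; exact convex_convexHull _ _
  have Sl : ∀ z, ∃ c, ∀ᶠ y in 𝓝 z, c ∈ S y := by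
    intro z
    by_cases hz : z.2 = 0
    · refine ⟨0, ?_⟩
      have : (0 : Euc m) ∈ A z := by
        refine ⟨hU0, ?_⟩
        rw [hz, hΨ0 _ (le_max_right _ _)]
        exact_mod_cast (hq.2.1 _ (le_max_right z.1 0)).trans_lt (Qgt z.1)
      filter_upwards [op z 0 this] with w hw
      exact ⟨fun _ => rfl, fun _ => subset_convexHull _ _ hw⟩
    · have := (hinf (max z.1 0) (le_max_right _ _) z.2).trans_lt
        (b := ((q (max z.1 0) : ℝ) : EReal)) (c := (Q z.1 : ℝ)) (by exact_mod_cast Qgt z.1)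
      obtain ⟨u, hu⟩ := iInf_lt_iff.1 this
      refine ⟨u.1, ?_⟩
      have ne : ∀ᶠ y : ℝ × Euc p in 𝓝 z, y.2 ≠ 0 :=
        continuous_snd.continuousAt.eventually_ne hz
      filter_upwards [op z u.1 ⟨u.2, hu⟩, ne] with w hw hn
      exact ⟨fun h => absurd h hn, fun _ => subset_convexHull _ _ hw⟩
  obtain ⟨g, gd, gS⟩ := smooth_select S Sc Sl
  have gU : ∀ z, g z ∈ U := by
    intro z
    by_cases hz : z.2 = 0
    · rw [(gS z).1 hz]; exact hU0
    · exact AU z ((gS z).2 hz)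
  have hk : GoodFeedback r U (fun t x => g (t, Φ t x)) := by
    refine ⟨fun t x => gU _, ?_, ?_, ?_⟩
    · exact gd.continuous.comp_continuousOn (continuousOn_fst.prodMk hΦc)
    · intro T hT R hR
      obtain ⟨L, hL⟩ := hΦL T hT R hR
      have Lb : ∀ t ∈ Icc 0 T, ∀ x : Hist n r, ‖x‖ ≤ R → ‖Φ t x‖ ≤ |L| * R := by
        intro t ht x hx
        have := hL t ht x 0 hx (by simpa)
        rw [hΦ0 t ht.1, sub_zero, sub_zero] at this
        exact this.trans (mul_le_mul (le_abs_self _) hx (norm_nonneg _) (abs_nonneg _))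
      obtain ⟨K, hK⟩ := gd.contDiffOn.exists_lipschitzOnWith one_ne_zero
        ((convex_Icc (0:ℝ) T).prod (convex_closedBall (0 : Euc p) (|L| * R)))
        (isCompact_Icc.prod (isCompact_closedBall _ _))
      refine ⟨K * |L|, ?_⟩
      intro t ht x y hx hy
      have := hK.dist_le_mul (t, Φ t x) ⟨ht, by simpa using Lb t ht x hx⟩
        (t, Φ t y) ⟨ht, by simpa using Lb t ht y hy⟩
      rw [Prod.dist_eq, dist_self, max_eq_right dist_nonneg, dist_eq_norm, dist_eq_norm] at this
      have h2 := hL t ht x y hx hy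
      calc _ ≤ _ := this
        _ ≤ K * (|L| * ‖x - y‖) := by
          gcongr
          exact h2.trans (mul_le_mul_of_nonneg_right (le_abs_self _) (norm_nonneg _))
        _ = _ := by ring
    · intro t ht
      exact (gS _).1 (hΦ0 t ht)
  refine ⟨_, hk, ?_⟩
  have hc := CL_of hr hS hk
  have dini : ∀ t, 0 ≤ t → ∀ x, ∀ d ∈ D, diniH V t x (f t d x (g (t, Φ t x))) ≤
      ((Q t - ρ (V t x) : ℝ) : EReal) := by
    intro t ht x d hd
    have ex : ∃ (N : ℕ) (u : Fin N → Euc m) (lam : Fin N → ℝ), (∀ i, u i ∈ U ∧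
        Ψ t (Φ t x) (u i) ≤ (Q t : ℝ)) ∧ (∀ i, 0 ≤ lam i) ∧
        (∑ i, lam i) = 1 ∧ ∑ i, lam i • u i = g (t, Φ t x) := by
      by_cases hz : Φ t x = 0
      · refine ⟨1, fun _ => 0, fun _ => 1, fun _ => ⟨hU0, ?_⟩, fun _ => zero_le_one, by simp, ?_⟩
        · rw [hz, hΨ0 t ht]
          have := (hq.2.1 _ (le_max_right t 0)).trans_lt (Qgt t)
          exact_mod_cast this.le
        · rw [(gS (t, Φ t x)).1 hz]; simp
      · obtain ⟨N, u, lam, h1, h2, h3, h4⟩ := hull_fin ((gS (t, Φ t x)).2 hz)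
        refine ⟨N, u, lam, fun i => ⟨(h1 i).1, ?_⟩, h2, h3, h4⟩
        have := (h1 i).2.le
        simp only [max_eq_left ht] at this
        exact this
    obtain ⟨N, u, lam, h1, h2, h3, h4⟩ := ex
    have := hdi t ht x N u (fun i => (h1 i).1) lam h2 h3 d hd
    rw [h4] at this
    refine this.trans ?_
    calc _ ≤ ((-ρ (V t x) : ℝ) : EReal) + (Q t : ℝ) := by
          gcongr
          exact iSup_le fun i => (h1 i).2
      _ = _ := by rw [← EReal.coe_add]; congr 1; ring
  have Q0 : ∀ t, 0 ≤ t → 0 ≤ Q t := fun t ht =>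
    ((hq.2.1 _ (le_max_right t 0)).trans (Qgt t).le)
  have Qi : IntegrableOn Q (Ici 0) := by
    have : IntegrableOn (fun t => q t + Real.exp (-t)) (Ici 0) :=
      hq.2.2.1.add ((integrableOn_Ici_iff_integrableOn_Ioi).2 (integrableOn_exp_neg_Ioi 0))
    refine this.congr_fun (fun t ht => ?_) measurableSet_Ici
    simp only [hQ]
    rw [max_eq_left (mem_Ici.1 ht)]
  obtain ⟨B, B0, hB, hat⟩ := ly_general hc hV hV0 hρ Qc.continuousOn Q0 Qi dini
  exact rgaos_of_ly hc hH0 hHL ha₁ ha₂ hβ hμ hV0 hVb hB hat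
end CA



section FLO
variable {n l : ℕ} {r : ℝ} {hr : 0 < r} {D : Set (Euc l)}
    {F : ℝ → Euc l → Hist n r → Euc n} {Y : Type*} [NormedAddCommGroup Y] [NormedSpace ℝ Y]
    {H : ℝ → Hist n r → Y} {S : ℝ → Hist n r → (ℝ → Euc l) → C(ℝ, Euc n)}

structure FLOW (D : Set (Euc l)) (F : ℝ → Euc l → Hist n r → Euc n) (H : ℝ → Hist n r → Y)
    (S : ℝ → Hist n r → (ℝ → Euc l) → C(ℝ, Euc n)) : Prop where
  init : ∀ t0 x0 d, 0 ≤ t0 → InMD D d → hst r (S t0 x0 d) t0 = x0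
  sol : ∀ t0 x0 d, 0 ≤ t0 → InMD D d → ∀ t1, PSol F d t0 t1 (S t0 x0 d)
  rfc : ∀ R, 0 ≤ R → ∃ M, 0 ≤ M ∧ ∀ t0 ∈ Icc 0 R, ∀ x0 : Hist n r, ‖x0‖ ≤ R → ∀ d, InMD D d →
    ∀ t ∈ Icc t0 (t0 + R), ‖hst r (S t0 x0 d) t‖ ≤ M
  att : ∀ ε, 0 < ε → ∀ R, 0 ≤ R → ∃ τ, 0 ≤ τ ∧ ∀ t0 ∈ Icc 0 R, ∀ x0 : Hist n r, ‖x0‖ ≤ R →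
    ∀ d, InMD D d → ∀ t, t0 + τ ≤ t → ‖H t (hst r (S t0 x0 d) t)‖ ≤ ε

theorem flow_of_rgaos (hr : 0 < r) (h : RGAOSrfde r D F H) : ∃ S, FLOW D F H S := by
  obtain ⟨X, Φ, tm, hs, hf, -, ha⟩ := h
  have top : ∀ t0 x0 d, 0 ≤ t0 → InMD D d → ∀ t : ℝ, (t : EReal) < tm t0 x0 d := by
    intro t0 x0 d h0 hd t
    have hT : 0 ≤ max t0 |t| := h0.trans (le_max_left _ _)
    obtain ⟨M, hM⟩ := hf (max t0 |t|) hT ‖x0‖ (norm_nonneg _)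
    refine lt_of_le_of_lt ?_ (hM t0 ⟨h0, le_max_left _ _⟩ (max t0 |t|) ⟨hT, le_rfl⟩ x0 le_rfl d hd).1
    have : t ≤ t0 + max t0 |t| := by linarith [le_abs_self t, le_max_right t0 |t|]
    exact_mod_cast this
  have ex : ∀ t0 x0 d, 0 ≤ t0 → InMD D d → ∃ X : C(ℝ, Euc n), hst r X t0 = x0 ∧
      (∀ t, t0 ≤ t → hst r X t = Φ t0 x0 d t) ∧ ∀ t1, PSol F d t0 t1 X := fun t0 x0 d h0 hd =>
    psol_of_rfde_top hr (hs t0 h0 x0 d hd).1 (top t0 x0 d h0 hd)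
  have exX : ∃ S : ℝ → Hist n r → (ℝ → Euc l) → C(ℝ, Euc n), ∀ t0 x0 d, 0 ≤ t0 → InMD D d →
      hst r (S t0 x0 d) t0 = x0 ∧
      (∀ t, t0 ≤ t → hst r (S t0 x0 d) t = Φ t0 x0 d t) ∧ ∀ t1, PSol F d t0 t1 (S t0 x0 d) := by
    classical
    refine ⟨fun t0 x0 d => if h : 0 ≤ t0 ∧ InMD D d then (ex t0 x0 d h.1 h.2).choose else 0, ?_⟩
    intro t0 x0 d h0 hd
    simp only [dif_pos (And.intro h0 hd)]
    exact (ex t0 x0 d h0 hd).choose_spec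
  obtain ⟨S, hS⟩ := exX
  refine ⟨S, fun t0 x0 d h0 hd => (hS t0 x0 d h0 hd).1, fun t0 x0 d h0 hd => (hS t0 x0 d h0 hd).2.2,
    ?_, ?_⟩
  · intro R hR
    obtain ⟨M, hM⟩ := hf R hR R hR
    refine ⟨max M 0, le_max_right _ _, fun t0 ht0 x0 hx0 d hd t ht => ?_⟩
    rw [(hS t0 x0 d ht0.1 hd).2.1 t ht.1]
    have := (hM t0 ht0 (t - t0) ⟨by linarith [ht.1], by linarith [ht.2]⟩ x0 hx0 d hd).2
    rw [add_sub_cancel] at this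
    exact this.trans (le_max_left _ _)
  · intro ε hε R hR
    obtain ⟨τ, hτ, hh⟩ := ha ε hε R hR R hR
    refine ⟨τ, hτ, fun t0 ht0 x0 hx0 d hd t ht => ?_⟩
    rw [(hS t0 x0 d ht0.1 hd).2.1 t (by linarith)]
    exact hh t0 ht0 x0 hx0 d hd t ht (top t0 x0 d ht0.1 hd t)

theorem FLOW.zero (hc : CL hr D F) (hS : FLOW D F H S) {t0 t : ℝ} {d : ℝ → Euc l} (h0 : 0 ≤ t0)
    (hd : InMD D d) (ht : t0 ≤ t) : hst r (S t0 0 d) t = 0 := by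
  have z : ∀ s, hst r (0 : C(ℝ, Euc n)) s = 0 := fun s => by ext1 θ; rfl
  rw [(hS.sol t0 0 d h0 hd t).unique hc hd h0 (PSol.zero hc hd h0)
    (by rw [hS.init t0 0 d h0 hd, z]) t ⟨ht, le_rfl⟩, z]

def cat (t1 : ℝ) (d d' : ℝ → Euc l) : ℝ → Euc l := fun s => if s < t1 then d s else d' s

open Classical in
theorem cat_md {t1 : ℝ} {d d' : ℝ → Euc l} (h : InMD D d) (h' : InMD D d') : InMD D (cat t1 d d') := by
  constructor
  · exact Measurable.ite measurableSet_Iio h.1 h'.1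
  · intro t; unfold cat; split_ifs
    · exact h.2 t
    · exact h'.2 t

/-- concatenation property -/
theorem FLOW.cat (hc : CL hr D F) (hS : FLOW D F H S) {t0 t1 t : ℝ} {x0 : Hist n r}
    {d d' : ℝ → Euc l} (h0 : 0 ≤ t0) (hd : InMD D d) (hd' : InMD D d') (h1 : t0 ≤ t1) (ht : t1 ≤ t) :
    hst r (S t1 (hst r (S t0 x0 d) t1) d') t = hst r (S t0 x0 (cat t1 d d')) t := by
  have hdd := cat_md (t1 := t1) hd hd'
  have p1 : PSol F (_root_.cat t1 d d') t0 t1 (S t0 x0 d) :=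
    (hS.sol t0 x0 d h0 hd t1).congr_d fun s hs => by simp [_root_.cat, hs.2]
  have e1 := p1.unique hc hdd h0 (hS.sol t0 x0 _ h0 hdd t1)
    (by rw [hS.init _ _ _ h0 hd, hS.init _ _ _ h0 hdd]) t1 ⟨h1, le_rfl⟩
  have p2 : PSol F d' t1 t (S t0 x0 (_root_.cat t1 d d')) :=
    ((hS.sol t0 x0 _ h0 hdd t).shift hc hdd h0 h1).congr_d fun s hs => by
      simp [_root_.cat, not_lt.2 hs.1]
  exact (hS.sol t1 _ d' (h0.trans h1) hd' t).unique hc hd' (h0.trans h1) p2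
    (by rw [hS.init _ _ _ (h0.trans h1) hd', e1]) t ⟨ht, le_rfl⟩

theorem FLOW.cocycle (hc : CL hr D F) (hS : FLOW D F H S) {t0 t1 t : ℝ} {x0 : Hist n r}
    {d : ℝ → Euc l} (h0 : 0 ≤ t0) (hd : InMD D d) (h1 : t0 ≤ t1) (ht : t1 ≤ t) :
    hst r (S t1 (hst r (S t0 x0 d) t1) d) t = hst r (S t0 x0 d) t := by
  rw [hS.cat hc h0 hd hd h1 ht]
  congr 2
  funext s; simp [_root_.cat]

/-- Lipschitz dependence -/
theorem FLOW.lip (hc : CL hr D F) (hS : FLOW D F H S) (R : ℝ) (hR : 0 ≤ R) (T : ℝ) : ∃ E M, 1 ≤ E ∧ 0 ≤ M ∧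
    ∀ t0 ∈ Icc 0 R, ∀ x y : Hist n r, ‖x‖ ≤ R → ‖y‖ ≤ R → ∀ d, InMD D d → ∀ t ∈ Icc t0 (t0 + T),
    ‖hst r (S t0 x d) t‖ ≤ M ∧ ‖hst r (S t0 x d) t - hst r (S t0 y d) t‖ ≤ E * ‖x - y‖ := by
  obtain ⟨M, M0, hM⟩ := hS.rfc (R + |T|) (by positivity)
  obtain ⟨L, L0, hL⟩ := hc.osl (R + |T| + M) (by positivity)
  have a0 := abs_nonneg T
  have a1 := le_abs_self T
  refine ⟨Real.exp (L * |T|), M, Real.one_le_exp (by positivity), M0, ?_⟩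
  intro t0 ht0 x y hx hy d hd t ht
  have b : ∀ x : Hist n r, ‖x‖ ≤ R → ∀ s ∈ Icc t0 t, ‖hst r (S t0 x d) s‖ ≤ M := fun x hx s hs =>
    hM t0 ⟨ht0.1, by linarith [ht0.2]⟩ x (by linarith) d hd s
      ⟨hs.1, by linarith [hs.2, ht.2, ht0.1, ht0.2]⟩
  refine ⟨b x hx t ⟨ht.1, le_rfl⟩, ?_⟩
  have := (hS.sol t0 x d ht0.1 hd t).dist hc hd ht0.1 (hS.sol t0 y d ht0.1 hd t)
    (T := R + |T| + M) (by linarith [ht.2, ht0.2])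
    (R := R + |T| + M) (fun s hs => (b x hx s hs).trans (by linarith))
    (fun s hs => (b y hy s hs).trans (by linarith)) L0 hL t ⟨ht.1, le_rfl⟩
  rw [hS.init _ _ _ ht0.1 hd, hS.init _ _ _ ht0.1 hd] at this
  refine this.trans ?_
  gcongr
  linarith [ht.2]

/-- modulus of the flow -/
theorem FLOW.mod (hc : CL hr D F) (hS : FLOW D F H S) (R : ℝ) (hR : 0 ≤ R) : ∃ M, 0 ≤ M ∧
    ∀ t0 ∈ Icc 0 R, ∀ x : Hist n r, ‖x‖ ≤ R → ∀ d, InMD D d → ∀ h ∈ Icc (0:ℝ) 1, ∀ ω,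
    (∀ a b : Icc (-r) (0:ℝ), |(a:ℝ) - b| ≤ h → ‖x a - x b‖ ≤ ω) → ∀ s ∈ Icc 0 h,
    ‖hst r (S t0 x d) (t0 + s) - x‖ ≤ M * h + ω := by
  obtain ⟨E, M1, -, M10, h1⟩ := hS.lip hc R hR 1
  obtain ⟨M, M0, hM⟩ := hc.bdd (R + 1 + M1) (by positivity)
  refine ⟨M, M0, ?_⟩
  intro t0 ht0 x hx d hd h hh ω hω s hs
  have ω0 : 0 ≤ ω := (norm_nonneg _).trans (hω (zz hr) (zz hr) (by simpa using hh.1))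
  have ini := hS.init t0 x d ht0.1 hd
  have ps := hS.sol t0 x d ht0.1 hd (t0 + 1)
  have lip : ∀ u ∈ Icc t0 (t0 + 1), ‖S t0 x d u - S t0 x d t0‖ ≤ M * |u - t0| := fun u hu =>
    path_lip (cl_ii hc hd _ ht0.1 (by linarith [ht0.1])) ps (fun u hu =>
      hM u ⟨ht0.1.trans hu.1, by linarith [hu.2, ht0.2]⟩ _ (hd.2 u) _
        ((h1 t0 ht0 x x hx hx d hd u hu).1.trans (by linarith)))
      ⟨le_rfl, by linarith⟩ hu
  have old : ∀ θ : Icc (-r) (0:ℝ), S t0 x d (t0 + θ) = x θ := fun θ => by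
    rw [← hst_apply r, ini]
  have old0 : S t0 x d t0 = x (zz hr) := by rw [← old]; simp [zz]
  rw [ContinuousMap.norm_le _ (by have := hh.1; positivity)]
  intro θ
  rw [ContinuousMap.sub_apply, hst_apply]
  rcases le_total (s + θ) 0 with hθ | hθ
  · have := old ⟨s + θ, by linarith [θ.2.1, hs.1], hθ⟩
    simp only at this
    rw [add_assoc, this]
    have := hω ⟨s + θ, by linarith [θ.2.1, hs.1], hθ⟩ θ
      (by simp only [add_sub_cancel_right]; rw [abs_of_nonneg hs.1]; exact hs.2)
    have : 0 ≤ M * h := mul_nonneg M0 hh.1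
    linarith
  · have e1 := lip (t0 + s + θ) ⟨by linarith, by linarith [θ.2.2, hs.2, hh.2]⟩
    have e2 := hω (zz hr) θ (by
      simp only [zz, zero_sub, abs_neg]; rw [abs_of_nonpos θ.2.2]; linarith [hs.2])
    rw [old0] at e1
    rw [abs_of_nonneg (by linarith)] at e1
    have e3 : M * (t0 + s + θ - t0) ≤ M * h := by gcongr; linarith [θ.2.2, hs.2]
    have := norm_add_le (S t0 x d (t0 + s + θ) - x (zz hr)) (x (zz hr) - x θ)
    rw [sub_add_sub_cancel] at this
    linarith
end FLO



section UQ
variable {n l : ℕ} {r : ℝ} {hr : 0 < r} {D : Set (Euc l)}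
    {F : ℝ → Euc l → Hist n r → Euc n} {Y : Type*} [NormedAddCommGroup Y] [NormedSpace ℝ Y]
    {H : ℝ → Hist n r → Y} {S : ℝ → Hist n r → (ℝ → Euc l) → C(ℝ, Euc n)}

structure GG (D : Set (Euc l)) (S : ℝ → Hist n r → (ℝ → Euc l) → C(ℝ, Euc n))
    (g : ℝ → Hist n r → ℝ) : Prop where
  nn : ∀ t, 0 ≤ t → ∀ x, 0 ≤ g t x
  zero : ∀ t, 0 ≤ t → g t 0 = 0
  lip : ∀ R, 0 ≤ R → ∃ C, 0 ≤ C ∧ ∀ t ∈ Icc 0 R, ∀ s ∈ Icc 0 R, ∀ x y : Hist n r, ‖x‖ ≤ R → ‖y‖ ≤ R →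
    |g t x - g s y| ≤ C * (|t - s| + ‖x - y‖)
  att : ∀ ε, 0 < ε → ∀ R, 0 ≤ R → ∃ τ, 0 ≤ τ ∧ ∀ t0 ∈ Icc 0 R, ∀ x0 : Hist n r, ‖x0‖ ≤ R →
    ∀ d, InMD D d → ∀ t, t0 + τ ≤ t → g t (hst r (S t0 x0 d) t) ≤ ε

theorem exists_g (hS : FLOW D F H S) (hH0 : ∀ t : ℝ, 0 ≤ t → H t 0 = 0)
    (hHL : ∀ T, 0 ≤ T → ∀ R, 0 ≤ R → ∃ LH, 0 ≤ LH ∧ ∀ t ∈ Icc (0:ℝ) T, ∀ τ ∈ Icc (0:ℝ) T,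
      ∀ x y : Hist n r, ‖x‖ ≤ R → ‖y‖ ≤ R → ‖H t x - H τ y‖ ≤ LH * (|t - τ| + ‖x - y‖)) :
    ∃ μ : ℝ → ℝ, IsKplus μ ∧ GG D S (fun t x => ‖H t x‖ + μ t * ‖x‖) := by
  obtain ⟨c, cm, cc, c0, cl, cP⟩ := lemmaM
    (fun R C => ∀ t0 ∈ Icc 0 R, ∀ x0 : Hist n r, ‖x0‖ ≤ R → ∀ d, InMD D d →
      ∀ t ∈ Icc t0 (t0 + R), R * ‖hst r (S t0 x0 d) t‖ ≤ C) (by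
      intro R R' C C' hR hC h t0 ht0 x0 hx0 d hd t ht
      have := h t0 ⟨ht0.1, ht0.2.trans hR⟩ x0 (hx0.trans hR) d hd t ⟨ht.1, by linarith [ht.2]⟩
      refine le_trans ?_ (this.trans hC)
      gcongr) (by
      intro R hR
      obtain ⟨M, M0, hM⟩ := hS.rfc R hR
      exact ⟨R * M, fun t0 ht0 x0 hx0 d hd t ht => by
        have := hM t0 ht0 x0 hx0 d hd t ht
        gcongr⟩)
  have cp : ∀ t, 0 < 1 + c t := fun t => by linarith [c0 t]
  have μ1 : ∀ t, 1 / (1 + c t) ≤ 1 := fun t => by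
    rw [div_le_one (cp t)]; linarith [c0 t]
  have μ0 : ∀ t, 0 < 1 / (1 + c t) := fun t => one_div_pos.2 (cp t)
  refine ⟨fun t => 1 / (1 + c t), ⟨?_, fun t _ => μ0 t⟩, ?_, ?_, ?_, ?_⟩
  · exact (continuous_const.div (continuous_const.add cc) fun t => (cp t).ne').continuousOn
  · intro t ht x; have := (μ0 t).le; positivity
  · intro t ht; simp [hH0 t ht]
  · intro R hR
    obtain ⟨LH, L0, hL⟩ := hHL R hR R hR
    obtain ⟨K, K0, hK⟩ := cl R hR
    refine ⟨LH + K * R + 1, by positivity, ?_⟩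
    intro t ht s hs x y hx hy
    have e1 := hL t ht s hs x y hx hy
    have e2 := (abs_norm_sub_norm_le (H t x) (H s y)).trans e1
    have e3 := abs_norm_sub_norm_le x y
    have e4 : |1 / (1 + c t) - 1 / (1 + c s)| ≤ K * |t - s| := by
      rw [div_sub_div _ _ (cp t).ne' (cp s).ne', abs_div, abs_of_pos (mul_pos (cp t) (cp s)),
        div_le_iff₀ (mul_pos (cp t) (cp s))]
      have := hK s hs t ht
      rw [abs_sub_comm s t] at this
      have e : 1 * (1 + c s) - (1 + c t) * 1 = c s - c t := by ring
      rw [e]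
      have h1 : 1 ≤ (1 + c t) * (1 + c s) := by nlinarith [c0 t, c0 s]
      have : 0 ≤ K * |t - s| := by positivity
      nlinarith
    have e5 : |1 / (1 + c t) * ‖x‖ - 1 / (1 + c s) * ‖y‖| ≤ K * |t - s| * R + ‖x - y‖ := by
      have : 1 / (1 + c t) * ‖x‖ - 1 / (1 + c s) * ‖y‖ = (1 / (1 + c t) - 1 / (1 + c s)) * ‖x‖ +
        1 / (1 + c s) * (‖x‖ - ‖y‖) := by ring
      rw [this]
      refine (abs_add_le _ _).trans (add_le_add ?_ ?_)
      · rw [abs_mul, abs_norm]; gcongr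
      · rw [abs_mul, abs_of_pos (μ0 s)]
        calc _ ≤ 1 * ‖x - y‖ := by gcongr; exact μ1 s
          _ = _ := one_mul _
    have : ‖H t x‖ + 1 / (1 + c t) * ‖x‖ - (‖H s y‖ + 1 / (1 + c s) * ‖y‖) =
      (‖H t x‖ - ‖H s y‖) + (1 / (1 + c t) * ‖x‖ - 1 / (1 + c s) * ‖y‖) := by ring
    rw [this]
    refine (abs_add_le _ _).trans ((add_le_add e2 e5).trans ?_)
    have := abs_nonneg (t - s)
    have := norm_nonneg (x - y)
    have : 0 ≤ K * R * ‖x - y‖ := by positivity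
    nlinarith
  · intro ε hε R hR
    obtain ⟨τ, τ0, hτ⟩ := hS.att (ε / 2) (by positivity) R hR
    refine ⟨max τ (max R (2 / ε)), τ0.trans (le_max_left _ _), ?_⟩
    intro t0 ht0 x0 hx0 d hd t ht
    have h1 := hτ t0 ht0 x0 hx0 d hd t (by linarith [le_max_left τ (max R (2 / ε))])
    have hR' : R ≤ t := by
      linarith [le_max_right τ (max R (2 / ε)), le_max_left R (2 / ε), ht0.1]
    have hε' : 2 / ε ≤ t := by
      linarith [le_max_right τ (max R (2 / ε)), le_max_right R (2 / ε), ht0.1]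
    have h2 := cP t t0 ⟨ht0.1, ht0.2.trans hR'⟩ x0 (hx0.trans hR') d hd t
      ⟨ht0.2.trans hR', by linarith [ht0.1]⟩
    set N := ‖hst r (S t0 x0 d) t‖ with hN
    have N0 : 0 ≤ N := norm_nonneg _
    have h3 : 1 / (1 + c t) * N ≤ ε / 2 := by
      rw [one_div, inv_mul_le_iff₀ (cp t)]
      rw [div_le_iff₀ hε] at hε'
      have : 2 * N ≤ ε * t * N := by nlinarith
      have := c0 t
      nlinarith
    show ‖H t (hst r (S t0 x0 d) t)‖ + 1 / (1 + c t) * N ≤ ε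
    linarith

def ww (S : ℝ → Hist n r → (ℝ → Euc l) → C(ℝ, Euc n)) (g : ℝ → Hist n r → ℝ) (η t : ℝ)
    (x : Hist n r) (τ : ℝ) (d : ℝ → Euc l) : ℝ :=
  Real.exp (τ - t) * max 0 (g τ (hst r (S t x d) τ) - η)

def UU (D : Set (Euc l)) (S : ℝ → Hist n r → (ℝ → Euc l) → C(ℝ, Euc n)) (g : ℝ → Hist n r → ℝ)
    (η t : ℝ) (x : Hist n r) : ℝ :=
  sSup {y | ∃ τ d, t ≤ τ ∧ InMD D d ∧ y = ww S g η t x τ d}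

def PP (D : Set (Euc l)) (S : ℝ → Hist n r → (ℝ → Euc l) → C(ℝ, Euc n)) (U : ℝ → Hist n r → ℝ)
    (R C : ℝ) : Prop :=
  (∀ t ∈ Icc 0 R, ∀ x y : Hist n r, ‖x‖ ≤ R → ‖y‖ ≤ R → |U t x - U t y| ≤ C * ‖x - y‖) ∧
  (∀ t ∈ Icc 0 R, ∀ h ∈ Icc (0:ℝ) 1, ∀ x : Hist n r, ‖x‖ ≤ R → ∀ ω, 0 ≤ ω →
    (∀ d, InMD D d → ∀ s ∈ Icc 0 h, ‖hst r (S t x d) (t + s) - x‖ ≤ ω) →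
    |U (t + h) x - U t x| ≤ C * (h + ω))

structure LF (D : Set (Euc l)) (S : ℝ → Hist n r → (ℝ → Euc l) → C(ℝ, Euc n))
    (U : ℝ → Hist n r → ℝ) : Prop where
  nn : ∀ t x, 0 ≤ U t x
  zero : ∀ t, 0 ≤ t → U t 0 = 0
  dec : ∀ t h, 0 ≤ t → 0 ≤ h → ∀ x d, InMD D d →
    U (t + h) (hst r (S t x d) (t + h)) ≤ Real.exp (-h) * U t x
  lip : ∀ R, 0 ≤ R → ∃ C, PP D S U R C

theorem PP.mono {U : ℝ → Hist n r → ℝ} (R R' C C' : ℝ) (hR : R' ≤ R) (hC : C ≤ C')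
    (h : PP D S U R C) : PP D S U R' C' := by
  refine ⟨fun t ht x y hx hy => ?_, fun t ht h' hh x hx ω hω hb => ?_⟩
  · exact (h.1 t ⟨ht.1, ht.2.trans hR⟩ x y (hx.trans hR) (hy.trans hR)).trans (by gcongr)
  · refine (h.2 t ⟨ht.1, ht.2.trans hR⟩ h' hh x (hx.trans hR) ω hω hb).trans ?_
    have := hh.1
    gcongr

theorem exp_le_two {h : ℝ} (h0 : 0 ≤ h) (h1 : h ≤ 1) : Real.exp h ≤ 1 + 2 * h := by
  have := Real.abs_exp_sub_one_sub_id_le (x := h) (by rw [abs_of_nonneg h0]; exact h1)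
  have := (abs_le.1 this).2
  nlinarith

theorem max_lip (a b η : ℝ) : max 0 (a - η) ≤ max 0 (b - η) + |a - b| := by
  apply max_le
  · positivity
  · have := le_max_right 0 (b - η)
    have := le_abs_self (a - b)
    linarith

theorem LF_UU (hc : CL hr D F) (hS : FLOW D F H S) (hD : D.Nonempty) {g : ℝ → Hist n r → ℝ}
    (hg : GG D S g) {η : ℝ} (hη : 0 < η) :
    LF D S (UU D S g η) ∧ ∀ t, 0 ≤ t → ∀ x, max 0 (g t x - η) ≤ UU D S g η t x := by
  obtain ⟨d0, hd0⟩ := hD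
  have md0 : InMD D (fun _ => d0) := ⟨measurable_const, fun _ => hd0⟩
  have wnn : ∀ t x τ d, 0 ≤ ww S g η t x τ d := fun t x τ d => by unfold ww; positivity
  -- Lipschitz estimate at the level of ww
  have wl : ∀ R, 0 ≤ R → ∃ C, 0 ≤ C ∧ ∀ t ∈ Icc 0 R, ∀ x y : Hist n r, ‖x‖ ≤ R → ‖y‖ ≤ R →
      ∀ τ d, t ≤ τ → InMD D d → ww S g η t x τ d ≤ ww S g η t y τ d + C * ‖x - y‖ := by
    intro R hR
    obtain ⟨T, T0, hT⟩ := hg.att η hη R hR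
    obtain ⟨E, M, E1, M0, hE⟩ := hS.lip hc R hR T
    obtain ⟨C, C0, hC⟩ := hg.lip (R + T + M) (by positivity)
    refine ⟨Real.exp T * (C * E), by positivity, ?_⟩
    intro t ht x y hx hy τ d hτ hd
    have t0 := ht.1
    rcases le_total (t + T) τ with h | h
    · have h1 : ww S g η t x τ d = 0 := by
        unfold ww
        rw [max_eq_left (by linarith [hT t ht x hx d hd τ h]), mul_zero]
      rw [h1]
      have := wnn t y τ d
      positivity
    · have ex := hE t ht x y hx hy d hd τ ⟨hτ, h⟩
      have ey := hE t ht y x hy hx d hd τ ⟨hτ, h⟩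
      have τR : τ ∈ Icc 0 (R + T + M) := ⟨ht.1.trans hτ, by linarith [ht.2]⟩
      have := hC τ τR τ τR _ _ (ex.1.trans (show M ≤ R + T + M by linarith))
        (ey.1.trans (show M ≤ R + T + M by linarith))
      rw [sub_self, abs_zero, zero_add] at this
      have h2 : |g τ (hst r (S t x d) τ) - g τ (hst r (S t y d) τ)| ≤ C * (E * ‖x - y‖) :=
        this.trans (by gcongr; exact ex.2)
      have h3 := max_lip (g τ (hst r (S t x d) τ)) (g τ (hst r (S t y d) τ)) η
      unfold ww
      have h4 : Real.exp (τ - t) ≤ Real.exp T := Real.exp_le_exp.2 (by linarith)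
      calc _ ≤ Real.exp (τ - t) * (max 0 (g τ (hst r (S t y d) τ) - η) + C * (E * ‖x - y‖)) := by
            gcongr; linarith
        _ = Real.exp (τ - t) * max 0 (g τ (hst r (S t y d) τ) - η)
            + Real.exp (τ - t) * (C * (E * ‖x - y‖)) := by ring
        _ ≤ Real.exp (τ - t) * max 0 (g τ (hst r (S t y d) τ) - η)
            + Real.exp T * (C * (E * ‖x - y‖)) := by gcongr
        _ = _ := by ring
  have w0 : ∀ t, 0 ≤ t → ∀ τ d, t ≤ τ → InMD D d → ww S g η t 0 τ d = 0 := by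
    intro t ht τ d hτ hd
    unfold ww
    rw [hS.zero hc ht hd hτ, hg.zero τ (ht.trans hτ), max_eq_left (by linarith), mul_zero]
  have bdd : ∀ t, 0 ≤ t → ∀ x, BddAbove {y | ∃ τ d, t ≤ τ ∧ InMD D d ∧ y = ww S g η t x τ d} := by
    intro t ht x
    obtain ⟨C, C0, hC⟩ := wl (t + ‖x‖) (by positivity)
    refine ⟨C * ‖x‖, ?_⟩
    rintro y ⟨τ, d, hτ, hd, rfl⟩
    have := hC t ⟨ht, by linarith [norm_nonneg x]⟩ x 0 (by linarith) (by simp; positivity) τ d hτ hd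
    rw [w0 t ht τ d hτ hd, sub_zero, zero_add] at this
    exact this
  have leU : ∀ t, 0 ≤ t → ∀ x τ d, t ≤ τ → InMD D d → ww S g η t x τ d ≤ UU D S g η t x :=
    fun t ht x τ d hτ hd => le_csSup (bdd t ht x) ⟨τ, d, hτ, hd, rfl⟩
  have Ule : ∀ t x C, (∀ τ d, t ≤ τ → InMD D d → ww S g η t x τ d ≤ C) → UU D S g η t x ≤ C := by
    intro t x C h
    refine csSup_le (s := {y | ∃ τ d, t ≤ τ ∧ InMD D d ∧ y = ww S g η t x τ d})
      ⟨_, t, _, le_rfl, md0, rfl⟩ ?_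
    rintro y ⟨τ, d, hτ, hd, rfl⟩
    exact h τ d hτ hd
  have Unn : ∀ t x, 0 ≤ UU D S g η t x := by
    intro t x
    apply Real.sSup_nonneg
    rintro y ⟨τ, d, hτ, hd, rfl⟩
    exact wnn _ _ _ _
  have U0 : ∀ t, 0 ≤ t → UU D S g η t 0 = 0 := fun t ht =>
    le_antisymm (Ule t 0 0 fun τ d hτ hd => (w0 t ht τ d hτ hd).le) (Unn _ _)
  have low : ∀ t, 0 ≤ t → ∀ x, max 0 (g t x - η) ≤ UU D S g η t x := by
    intro t ht x
    have := leU t ht x t _ le_rfl md0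
    unfold ww at this
    rwa [hS.init t x _ ht md0, sub_self, Real.exp_zero, one_mul] at this
  have dec : ∀ t h, 0 ≤ t → 0 ≤ h → ∀ x d, InMD D d →
      UU D S g η (t + h) (hst r (S t x d) (t + h)) ≤ Real.exp (-h) * UU D S g η t x := by
    intro t h ht hh x d hd
    apply Ule
    intro τ d' hτ hd'
    have := leU t ht x τ _ (by linarith) (cat_md (t1 := t + h) hd hd')
    unfold ww at this ⊢
    rw [hS.cat hc ht hd hd' (by linarith) hτ]
    calc _ = Real.exp (-h) * (Real.exp (τ - t) *
          max 0 (g τ (hst r (S t x (cat (t + h) d d')) τ) - η)) := by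
            rw [← mul_assoc, ← Real.exp_add]; congr 2; ring
      _ ≤ _ := by gcongr
  have Ulip : ∀ R, 0 ≤ R → ∃ C, 0 ≤ C ∧ ∀ t ∈ Icc 0 R, ∀ x y : Hist n r, ‖x‖ ≤ R → ‖y‖ ≤ R →
      UU D S g η t x ≤ UU D S g η t y + C * ‖x - y‖ := by
    intro R hR
    obtain ⟨C, C0, hC⟩ := wl R hR
    refine ⟨C, C0, fun t ht x y hx hy => Ule _ _ _ fun τ d hτ hd => ?_⟩
    exact (hC t ht x y hx hy τ d hτ hd).trans (by gcongr; exact leU t ht.1 y τ d hτ hd)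
  refine ⟨⟨Unn, U0, dec, ?_⟩, low⟩
  intro R hR
  obtain ⟨E, M, E1, M0, hE⟩ := hS.lip hc R hR 1
  obtain ⟨Λ, Λ0, hΛ⟩ := Ulip (R + 1 + M) (by positivity)
  obtain ⟨C, C0, hC⟩ := hg.lip (R + 1 + M) (by positivity)
  set R1 := R + 1 + M with hR1
  have R10 : 0 ≤ R1 := by positivity
  refine ⟨3 * Λ + 2 * Λ * R1 + 2 * C * R1 + C, ?_, ?_⟩
  · intro t ht x y hx hy
    have ht' : t ∈ Icc 0 R1 := ⟨ht.1, by linarith [ht.2]⟩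
    have e1 := hΛ t ht' x y (by linarith) (by linarith)
    have e2 := hΛ t ht' y x (by linarith) (by linarith)
    rw [norm_sub_rev y x] at e2
    have p : 0 ≤ (2 * Λ + 2 * Λ * R1 + 2 * C * R1 + C) * ‖x - y‖ := by positivity
    rw [abs_le]
    constructor <;> nlinarith
  · intro t ht h hh x hx ω hω hb
    have t0 := ht.1
    have h0 := hh.1
    have tR : t + h ∈ Icc 0 R1 := ⟨by linarith, by linarith [ht.2, hh.2]⟩
    have xR : ‖x‖ ≤ R1 := by linarith
    have FM : ∀ d, InMD D d → ∀ s ∈ Icc 0 h, ‖hst r (S t x d) (t + s)‖ ≤ R1 := fun d hd s hs =>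
      (hE t ht x x hx hx d hd (t + s) ⟨by linarith [hs.1], by linarith [hs.2, hh.2]⟩).1.trans
        (by linarith)
    have hmem : h ∈ Icc 0 h := ⟨h0, le_rfl⟩
    set u1 := UU D S g η (t + h) x with hu1
    set u0 := UU D S g η t x with hu0
    have u10 : 0 ≤ u1 := Unn _ _
    have u00 : 0 ≤ u0 := Unn _ _
    have p1 : 0 ≤ Λ * ω := by positivity
    have p2 : 0 ≤ Λ * R1 := by positivity
    have p3 : 0 ≤ Λ * R1 * h := by positivity
    have p4 : 0 ≤ Λ * R1 * ω := by positivity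
    have p5 : 0 ≤ C * R1 * h := by positivity
    have p6 : 0 ≤ C * R1 * ω := by positivity
    have p7 : 0 ≤ C * h := by positivity
    have p8 : 0 ≤ C * ω := by positivity
    have p9 : 0 ≤ Λ * h := by positivity
    have u1b : u1 ≤ Λ * R1 := by
      have := hΛ (t + h) tR x 0 xR (by simpa)
      rw [U0 _ tR.1, sub_zero, zero_add] at this
      exact this.trans (by gcongr)
    have eh := exp_le_two h0 hh.2
    rw [abs_le]
    constructor
    · -- lower
      suffices u0 ≤ u1 + (3 * Λ + 2 * Λ * R1 + 2 * C * R1 + C) * (h + ω) by linarith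
      apply Ule
      intro τ d hτ hd
      rcases le_total (t + h) τ with hτh | hτh
      · have e1 : ww S g η t x τ d =
            Real.exp h * ww S g η (t + h) (hst r (S t x d) (t + h)) τ d := by
          unfold ww
          rw [hS.cocycle hc t0 hd (by linarith) hτh, ← mul_assoc, ← Real.exp_add]
          congr 2; ring
        have e2 := leU (t + h) tR.1 (hst r (S t x d) (t + h)) τ d hτh hd
        have e3 := hΛ (t + h) tR (hst r (S t x d) (t + h)) x (FM d hd h hmem) xR
        have e4 := hb d hd h hmem
        have e5 : Λ * ‖hst r (S t x d) (t + h) - x‖ ≤ Λ * ω := by gcongr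
        rw [e1]
        calc _ ≤ (1 + 2 * h) * (u1 + Λ * ω) := by
              gcongr
              · exact wnn _ _ _ _
              · linarith
          _ ≤ _ := by
              have : h * u1 ≤ h * (Λ * R1) := by gcongr
              have : h * (Λ * ω) ≤ 1 * (Λ * ω) := by gcongr; exact hh.2
              nlinarith
      · have sm : τ - t ∈ Icc 0 h := ⟨by linarith, by linarith⟩
        have f1 := FM d hd _ sm
        have f2 := hb d hd _ sm
        rw [add_sub_cancel] at f1 f2
        set y := hst r (S t x d) τ with hy
        have τR : τ ∈ Icc 0 R1 := ⟨by linarith, by linarith [tR.2]⟩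
        have g1 := hC τ τR (t + h) tR y x f1 xR
        have g2 := hC τ τR τ τR y 0 f1 (by simpa)
        rw [hg.zero τ τR.1, sub_self, abs_zero, zero_add, sub_zero, sub_zero] at g2
        have g3 := (le_abs_self _).trans g2
        have g4 : g τ y ≤ C * R1 := g3.trans (by gcongr)
        have g5 := max_lip (g τ y) (g (t + h) x) η
        have g6 := low (t + h) tR.1 x
        have g7 : |τ - (t + h)| ≤ h := by rw [abs_le]; constructor <;> linarith
        have g8 : C * (|τ - (t + h)| + ‖y - x‖) ≤ C * (h + ω) := by gcongr
        have g9 : max 0 (g τ y - η) ≤ C * R1 := max_le (by positivity) (by linarith)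
        have g10 := exp_le_two sm.1 (sm.2.trans hh.2)
        have g11 : 0 ≤ max 0 (g τ y - η) := le_max_left _ _
        show Real.exp (τ - t) * max 0 (g τ y - η) ≤ _
        calc _ ≤ (1 + 2 * h) * max 0 (g τ y - η) := by
              gcongr; linarith [sm.2]
          _ = max 0 (g τ y - η) + 2 * h * max 0 (g τ y - η) := by ring
          _ ≤ (u1 + C * (h + ω)) + 2 * h * (C * R1) := by
              gcongr; linarith
          _ ≤ _ := by nlinarith
    · -- upper
      have e1 := dec t h t0 h0 x _ md0
      have e2 := hΛ (t + h) tR x (hst r (S t x (fun _ => d0)) (t + h)) xR (FM _ md0 h hmem)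
      rw [norm_sub_rev] at e2
      have e4 := hb _ md0 h hmem
      have e5 : Λ * ‖hst r (S t x (fun _ => d0)) (t + h) - x‖ ≤ Λ * ω := by gcongr
      have e6 : Real.exp (-h) * u0 ≤ 1 * u0 := by
        gcongr; exact Real.exp_le_one_iff.2 (by linarith)
      nlinarith
end UQ



theorem tsum_diff {f g b : ℕ → ℝ} (hf : Summable f) (hg : Summable g) (hb : Summable b)
    (h : ∀ q, |f q - g q| ≤ b q) : |∑' q, f q - ∑' q, g q| ≤ ∑' q, b q := by
  rw [← hf.tsum_sub hg]
  rw [← Real.norm_eq_abs]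
  exact tsum_of_norm_bounded hb.hasSum fun q => by rw [Real.norm_eq_abs]; exact h q

theorem kinf_sum {c : ℕ → ℝ} (c0 : ∀ q, 0 < c q) (hc : Summable c) :
    (∀ s, Summable fun q : ℕ => c q * max 0 (s - 1 / ((q:ℝ) + 1))) ∧
    IsKinf (fun s => ∑' q : ℕ, c q * max 0 (s - 1 / ((q:ℝ) + 1))) := by
  have pq : ∀ q : ℕ, 0 < 1 / ((q:ℝ) + 1) := fun q => by positivity
  have sm : ∀ s, Summable fun q : ℕ => c q * max 0 (s - 1 / ((q:ℝ) + 1)) := by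
    intro s
    refine Summable.of_nonneg_of_le (fun q => mul_nonneg (c0 q).le (le_max_left _ _)) (fun q => ?_)
      (hc.mul_right |s|)
    refine mul_le_mul_of_nonneg_left (max_le (abs_nonneg _) ?_) (c0 q).le
    linarith [le_abs_self s, pq q]
  refine ⟨sm, ?_, ?_, ?_, ?_⟩
  · refine Continuous.continuousOn (LipschitzWith.continuous (K := Real.toNNReal (∑' q, c q)) ?_)
    refine LipschitzWith.of_le_add_mul _ fun s t => ?_
    rw [Real.coe_toNNReal _ (tsum_nonneg fun q => (c0 q).le), ← tsum_mul_right,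
      ← (sm t).tsum_add (hc.mul_right _)]
    refine (sm s).tsum_le_tsum (fun q => ?_) ((sm t).add (hc.mul_right _))
    rw [← mul_add, Real.dist_eq]
    exact mul_le_mul_of_nonneg_left (max_lip _ _ _) (c0 q).le
  · intro s hs t ht hst
    have t0 : 0 < t := lt_of_le_of_lt hs hst
    obtain ⟨q, hq⟩ := exists_nat_one_div_lt t0
    refine Summable.tsum_lt_tsum (i := q) (fun j => ?_) ?_ (sm s) (sm t)
    · exact mul_le_mul_of_nonneg_left (max_le_max le_rfl (by linarith)) (c0 j).le
    · refine mul_lt_mul_of_pos_left ?_ (c0 q)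
      rw [max_eq_right (by linarith : 0 ≤ t - 1 / ((q:ℝ) + 1))]
      exact max_lt (by linarith) (by linarith)
  · simp only [zero_sub]
    have : ∀ q : ℕ, max 0 (-(1 / ((q:ℝ) + 1))) = 0 := fun q => max_eq_left (by linarith [pq q])
    simp only [this, mul_zero, tsum_zero]
  · have h1 : Tendsto (fun s : ℝ => c 0 * (s - 1)) atTop atTop :=
      (tendsto_atTop_add_const_right _ _ tendsto_id).const_mul_atTop (c0 0)
    refine tendsto_atTop_mono (fun s => ?_) h1
    have := (sm s).le_tsum 0 (fun j _ => mul_nonneg (c0 j).le (le_max_left _ _))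
    refine le_trans ?_ this
    refine mul_le_mul_of_nonneg_left ?_ (c0 0).le
    simp

section VV
variable {n l : ℕ} {r : ℝ} {hr : 0 < r} {D : Set (Euc l)}
    {F : ℝ → Euc l → Hist n r → Euc n} {Y : Type*} [NormedAddCommGroup Y] [NormedSpace ℝ Y]
    {H : ℝ → Hist n r → Y} {S : ℝ → Hist n r → (ℝ → Euc l) → C(ℝ, Euc n)}

theorem exists_V (hc : CL hr D F) (hS : FLOW D F H S) (hD : D.Nonempty) {g : ℝ → Hist n r → ℝ}
    (hg : GG D S g) : ∃ V a, LF D S V ∧ IsKinf a ∧ ∀ t, 0 ≤ t → ∀ x, a (g t x) ≤ V t x := by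
  have hη : ∀ q : ℕ, 0 < 1 / ((q:ℝ) + 1) := fun q => by positivity
  set U : ℕ → ℝ → Hist n r → ℝ := fun q => UU D S g (1 / ((q:ℝ) + 1)) with hU
  have hL : ∀ q, LF D S (U q) := fun q => (LF_UU hc hS hD hg (hη q)).1
  have hlow : ∀ q : ℕ, ∀ t, 0 ≤ t → ∀ x, max 0 (g t x - 1 / ((q:ℝ) + 1)) ≤ U q t x :=
    fun q => (LF_UU hc hS hD hg (hη q)).2
  choose Λ Λm Λc Λ0 Λl ΛP using fun q => lemmaM (PP D S (U q)) PP.mono (hL q).lip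
  set c : ℕ → ℝ := fun q => (1 / 2) ^ q / (1 + Λ q q) with hcdef
  have c0 : ∀ q, 0 < c q := fun q => by have := Λ0 q q; simp only [c]; positivity
  have chalf : ∀ q, c q ≤ (1 / 2) ^ q := fun q =>
    div_le_self (by positivity) (by linarith [Λ0 q q])
  have sg : Summable fun q : ℕ => (1 / 2 : ℝ) ^ q := summable_geometric_two
  have sc : Summable c := Summable.of_nonneg_of_le (fun q => (c0 q).le) chalf sg
  have sΛ : ∀ R, Summable fun q => c q * Λ q R := by
    intro R
    refine Summable.of_norm_bounded_eventually_nat sg ?_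
    filter_upwards [eventually_ge_atTop ⌈R⌉₊] with q hq
    have hRq : R ≤ q := Nat.ceil_le.1 hq
    rw [Real.norm_eq_abs, abs_of_nonneg (mul_nonneg (c0 q).le (Λ0 q R))]
    have := Λ0 q q
    calc c q * Λ q R ≤ c q * (1 + Λ q q) := by
          refine mul_le_mul_of_nonneg_left ?_ (c0 q).le
          linarith [Λm q hRq]
      _ = _ := by simp only [c]; field_simp
  have sU : ∀ t, 0 ≤ t → ∀ x, Summable fun q => c q * U q t x := by
    intro t ht x
    refine Summable.of_nonneg_of_le (fun q => mul_nonneg (c0 q).le ((hL q).nn t x)) (fun q => ?_)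
      ((sΛ (t + ‖x‖)).mul_right ‖x‖)
    have := (ΛP q (t + ‖x‖)).1 t ⟨ht, by linarith [norm_nonneg x]⟩ x 0 (by linarith)
      (by simp; positivity)
    rw [(hL q).zero t ht, sub_zero, sub_zero] at this
    rw [mul_assoc]
    exact mul_le_mul_of_nonneg_left ((le_abs_self _).trans this) (c0 q).le
  obtain ⟨sa, ha⟩ := kinf_sum c0 sc
  refine ⟨fun t x => ∑' q, c q * U q t x, _, ⟨?_, ?_, ?_, ?_⟩, ha, ?_⟩
  · exact fun t x => tsum_nonneg fun q => mul_nonneg (c0 q).le ((hL q).nn t x)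
  · intro t ht
    simp only [fun q => (hL q).zero t ht, mul_zero, tsum_zero]
  · intro t h ht hh x d hd
    show ∑' q, _ ≤ _ * ∑' q, _
    rw [← tsum_mul_left]
    refine (sU _ (by linarith) _).tsum_le_tsum (fun q => ?_) ((sU t ht x).mul_left _)
    have := mul_le_mul_of_nonneg_left ((hL q).dec t h ht hh x d hd) (c0 q).le
    linarith
  · intro R hR
    refine ⟨∑' q, c q * Λ q R, ?_, ?_⟩
    · intro t ht x y hx hy
      rw [← tsum_mul_right]
      refine tsum_diff (sU t ht.1 x) (sU t ht.1 y) ((sΛ R).mul_right _) fun q => ?_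
      rw [← mul_sub, abs_mul, abs_of_pos (c0 q), mul_assoc]
      exact mul_le_mul_of_nonneg_left ((ΛP q R).1 t ht x y hx hy) (c0 q).le
    · intro t ht h hh x hx ω hω hb
      rw [← tsum_mul_right]
      refine tsum_diff (sU _ (add_nonneg ht.1 hh.1) x) (sU t ht.1 x) ((sΛ R).mul_right _) fun q => ?_
      rw [← mul_sub, abs_mul, abs_of_pos (c0 q), mul_assoc]
      exact mul_le_mul_of_nonneg_left ((ΛP q R).2 t ht h hh x hx ω hω hb) (c0 q).le
  · intro t ht x
    exact (sa _).tsum_le_tsum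
      (fun q => mul_le_mul_of_nonneg_left (hlow q t ht x) (c0 q).le) (sU t ht x)

end VV



theorem Ehist_diff {n : ℕ} {r h : ℝ} (hr : 0 < r) (x : Hist n r) (v w : Euc n) (h0 : 0 ≤ h) :
    ‖Ehist h x v - Ehist h x w‖ ≤ h * ‖v - w‖ := by
  rw [ContinuousMap.norm_le _ (by positivity)]
  intro θ
  have hr' : -r ≤ 0 := by linarith
  simp only [Ehist, dif_pos hr', ContinuousMap.sub_apply, ContinuousMap.coe_mk]
  split_ifs with h1
  · rw [sub_self, norm_zero]; positivity
  · rw [add_sub_add_left_eq_sub, ← smul_sub, norm_smul, Real.norm_eq_abs,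
      abs_of_nonneg (by linarith)]
    have := θ.2.2
    gcongr
    linarith

section VP
variable {n l : ℕ} {r : ℝ} {hr : 0 < r} {D : Set (Euc l)}
    {F : ℝ → Euc l → Hist n r → Euc n} {Y : Type*} [NormedAddCommGroup Y] [NormedSpace ℝ Y]
    {H : ℝ → Hist n r → Y} {S : ℝ → Hist n r → (ℝ → Euc l) → C(ℝ, Euc n)}
    {V : ℝ → Hist n r → ℝ} {Λ : ℝ → ℝ}

theorem timec (hc : CL hr D F) (hS : FLOW D F H S) (Λ0 : ∀ R, 0 ≤ Λ R)
    (ΛP : ∀ R, PP D S V R (Λ R)) (R : ℝ) (hR : 0 ≤ R) : ∃ M, 0 ≤ M ∧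
    ∀ t ∈ Icc 0 R, ∀ h ∈ Icc (0:ℝ) 1, ∀ x : Hist n r, ‖x‖ ≤ R → ∀ ω, 0 ≤ ω →
    (∀ a b : Icc (-r) (0:ℝ), |(a:ℝ) - b| ≤ h → ‖x a - x b‖ ≤ ω) →
    |V (t + h) x - V t x| ≤ Λ R * (h + (M * h + ω)) := by
  obtain ⟨M, M0, hM⟩ := hS.mod hc R hR
  refine ⟨M, M0, fun t ht h hh x hx ω hω hm => ?_⟩
  have := hh.1
  exact (ΛP R).2 t ht h hh x hx _ (by positivity) fun d hd s hs => hM t ht x hx d hd h hh ω hm s hs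

theorem V_cont (hc : CL hr D F) (hS : FLOW D F H S) (Λ0 : ∀ R, 0 ≤ Λ R)
    (ΛP : ∀ R, PP D S V R (Λ R)) :
    ContinuousOn (fun p : ℝ × Hist n r => V p.1 p.2) (Ici 0 ×ˢ univ) := by
  rintro ⟨t0, x0⟩ ⟨ht0, -⟩
  have ht0 : 0 ≤ t0 := ht0
  rw [Metric.continuousWithinAt_iff]
  intro ε hε
  set R := t0 + ‖x0‖ + 1 with hR
  have R0 : 0 ≤ R := by positivity
  obtain ⟨M, M0, hM⟩ := timec hc hS Λ0 ΛP R R0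
  have hu : UniformContinuous x0 := CompactSpace.uniformContinuous_of_continuous x0.continuous
  have hL := Λ0 R
  set ω := ε / (4 * (1 + Λ R)) with hω
  have ω0 : 0 < ω := by positivity
  obtain ⟨δ, δ0, hδ⟩ := Metric.uniformContinuous_iff.1 hu ω ω0
  refine ⟨min (min 1 δ) (ε / (4 * (1 + Λ R) * (1 + M))), by positivity, ?_⟩
  rintro ⟨t, x⟩ ⟨ht, -⟩ hd
  have ht : 0 ≤ t := ht
  rw [Prod.dist_eq, max_lt_iff, Real.dist_eq, dist_eq_norm] at hd
  simp only [lt_min_iff] at hd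
  obtain ⟨⟨⟨a1, a2⟩, a3⟩, ⟨b1, b2⟩, b3⟩ := hd
  have key : ∀ s s' : ℝ, 0 ≤ s → s ≤ R → s ≤ s' → s' - s = |t - t0| →
      |V s' x0 - V s x0| ≤ Λ R * (|t - t0| + (M * |t - t0| + ω)) := by
    intro s s' h1 h2 h3 h4
    have := hM s ⟨h1, h2⟩ (|t - t0|) ⟨abs_nonneg _, a1.le⟩ x0 (by linarith) ω ω0.le (by
      intro a b hab
      have := hδ (a := a) (b := b) (by rw [Subtype.dist_eq, Real.dist_eq]; linarith)
      rw [dist_eq_norm] at this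
      exact this.le)
    rw [← h4] at this ⊢
    rwa [add_sub_cancel] at this
  have k2 : |V t x0 - V t0 x0| ≤ Λ R * (|t - t0| + (M * |t - t0| + ω)) := by
    rcases le_total t0 t with h | h
    · exact key t0 t ht0 (by linarith [norm_nonneg x0]) h (abs_of_nonneg (by linarith)).symm
    · rw [abs_sub_comm]
      exact key t t0 ht (by linarith [norm_nonneg x0]) h
        (by rw [abs_of_nonpos (by linarith)]; ring)
  have tR : t ∈ Icc 0 R := ⟨ht, by linarith [(abs_lt.1 a1).2, norm_nonneg x0]⟩
  have xR : ‖x‖ ≤ R := by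
    have := norm_le_norm_add_norm_sub' x x0
    linarith
  have k1 := (ΛP R).1 t tR x x0 xR (by linarith)
  rw [Real.dist_eq]
  have e1 : |V t x - V t0 x0| ≤ Λ R * ‖x - x0‖ + Λ R * (|t - t0| + (M * |t - t0| + ω)) := by
    have := abs_add_le (V t x - V t x0) (V t x0 - V t0 x0)
    rw [sub_add_sub_cancel] at this
    linarith
  refine lt_of_le_of_lt e1 ?_
  have c1 : (1 + Λ R) * ω = ε / 4 := by rw [hω]; field_simp
  have c2 : (1 + Λ R) * (1 + M) * |t - t0| < ε / 4 := by
    rw [lt_div_iff₀ (by positivity)] at a3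
    linarith
  have c3 : (1 + Λ R) * ‖x - x0‖ ≤ (1 + Λ R) * (1 + M) * ‖x - x0‖ := by
    have : 0 ≤ (1 + Λ R) * M * ‖x - x0‖ := by positivity
    linarith
  have c4 : (1 + Λ R) * (1 + M) * ‖x - x0‖ < ε / 4 := by
    rw [lt_div_iff₀ (by positivity)] at b3
    linarith
  have := norm_nonneg (x - x0)
  have := abs_nonneg (t - t0)
  have : 0 ≤ M * |t - t0| := by positivity
  nlinarith

theorem V_al (hc : CL hr D F) (hS : FLOW D F H S) (Λ0 : ∀ R, 0 ≤ Λ R) (Λm : Monotone Λ)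
    (ΛP : ∀ R, PP D S V R (Λ R)) : AlmostLipschitzOn r V := by
  obtain ⟨P, Pm, Pc, P0, Pl, PP'⟩ := lemmaM (fun R C => ∀ M : ℝ, 0 ≤ M → ∀ x : Hist n r, ‖x‖ ≤ R →
      LipschitzWith (Real.toNNReal M) (fun θ : Icc (-r) (0:ℝ) => x θ) →
      ∀ t ∈ Icc (0:ℝ) R, ∀ h : ℝ, 0 ≤ h → h ≤ 1 →
        |V (t + h) x - V t x| ≤ h * C * (1 + M)) (by
    intro R R' C C' hR hC h M hM x hx hl t ht s hs hs1
    refine (h M hM x (hx.trans hR) hl t ⟨ht.1, ht.2.trans hR⟩ s hs hs1).trans ?_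
    gcongr) (by
    intro R hR
    obtain ⟨M', M'0, hM'⟩ := timec hc hS Λ0 ΛP R hR
    refine ⟨Λ R * (1 + M'), fun M hM x hx hl t ht h h0 h1 => ?_⟩
    refine (hM' t ht h ⟨h0, h1⟩ x hx (M * h) (by positivity) ?_).trans ?_
    · intro a b hab
      have := hl.dist_le_mul a b
      rw [Real.coe_toNNReal _ hM, dist_eq_norm, Subtype.dist_eq, Real.dist_eq] at this
      exact this.trans (by gcongr)
    · have := Λ0 R
      have : 0 ≤ Λ R * h * M' * M := by positivity
      nlinarith)
  refine ⟨V_cont hc hS Λ0 ΛP, Λ, P, fun _ => 1, Λm, Pm, monotone_const, fun _ => le_rfl, ?_, ?_⟩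
  · intro R hR t ht x y hx hy
    exact (ΛP R).1 t ht y x hy hx
  · intro R hR M hM x hx hl t ht h h0 h1
    exact PP' R M hM x hx hl t ht h h0 (by simpa using h1)

theorem flow_deriv (hc : CL hr D F) (hS : FLOW D F H S) {t : ℝ} (ht : 0 ≤ t) (x : Hist n r)
    {d : Euc l} (hd : d ∈ D) :
    HasDerivWithinAt (S t x fun _ => d) (F t d x) (Ici t) t := by
  have md : InMD D (fun _ : ℝ => d) := ⟨measurable_const, fun _ => hd⟩
  set X := S t x fun _ => d with hX
  have hi : hst r X t = x := hS.init t x _ ht md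
  have hs := hS.sol t x _ ht md (t + 1)
  have c1 : Tendsto (hst r X) (𝓝[>] t) (𝓝 x) := by
    have := (hst_continuous r X).tendsto t
    rw [hi] at this
    exact this.mono_left nhdsWithin_le_nhds
  have h1 : HasDerivWithinAt (fun u => ∫ s in t..u, F s d (hst r X s)) (F t d (hst r X t))
      (Ici t) t := by
    refine intervalIntegral.integral_hasDerivWithinAt_right (t := Ioi t)
      (cl_ii hc md X ht ht) ?_ ?_
    · refine ⟨Ici 0, ?_, hc.meas _ md _ (hst_continuous r X)⟩
      exact mem_of_superset self_mem_nhdsWithin fun s hs => mem_Ici.2 (ht.trans (le_of_lt hs))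
    · have := hc.right t ht d hd x _ c1
      rw [← hi] at this
      exact this
  rw [hi] at h1
  have h2 := h1.const_add (X t)
  refine (h2.congr_of_eventuallyEq ?_ ?_)
  · have : Icc t (t + 1) ∈ 𝓝[≥] t := Icc_mem_nhdsGE (by linarith)
    filter_upwards [this] with s hs'
    exact hs s hs'
  · simp

theorem V_dini (hc : CL hr D F) (hS : FLOW D F H S) (hV : LF D S V) (Λ0 : ∀ R, 0 ≤ Λ R)
    (ΛP : ∀ R, PP D S V R (Λ R)) {t : ℝ} (ht : 0 ≤ t) (x : Hist n r) {d : Euc l} (hd : d ∈ D)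
    (v : Euc n) : diniH V t x v ≤
      ((-V t x + Λ (t + ‖x‖ + 1) * ‖v - F t d x‖ : ℝ) : EReal) := by
  have md : InMD D (fun _ : ℝ => d) := ⟨measurable_const, fun _ => hd⟩
  have hder := flow_deriv hc hS ht x hd
  have hi := hS.init t x _ ht md
  have hdec := fun h hh => hV.dec t h ht hh x _ md
  set X := S t x fun _ => d with hX
  set w := F t d x with hw
  set R := t + ‖x‖ + 1 with hR
  have e1 := hst_Ehist_tendsto hr X t w hder
  rw [hi] at e1
  set q : ℝ → Hist n r := fun h => h⁻¹ • (hst r X (t + h) - Ehist h x w) with hq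
  set B : ℝ × Hist n r → ℝ := fun p => ‖v - w‖ + ‖p.2‖ + ‖q p.1‖ with hB
  have f1 : Tendsto (fun p : ℝ × Hist n r => p.1) ((𝓝[>] (0:ℝ)) ×ˢ 𝓝 0) (𝓝[>] 0) := tendsto_fst
  have f1' : Tendsto (fun p : ℝ × Hist n r => p.1) ((𝓝[>] (0:ℝ)) ×ˢ 𝓝 0) (𝓝 0) :=
    f1.mono_right nhdsWithin_le_nhds
  have f2 : Tendsto (fun p : ℝ × Hist n r => p.2) ((𝓝[>] (0:ℝ)) ×ˢ 𝓝 0) (𝓝 0) := tendsto_snd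
  have tB : Tendsto B ((𝓝[>] (0:ℝ)) ×ˢ 𝓝 0) (𝓝 (‖v - w‖)) := by
    have := ((tendsto_const_nhds (x := ‖v - w‖)).add f2.norm).add (e1.comp f1).norm
    simpa using this
  have tφ : Tendsto (fun p : ℝ × Hist n r => ‖hst r X (t + p.1)‖) ((𝓝[>] (0:ℝ)) ×ˢ 𝓝 0)
      (𝓝 ‖x‖) := by
    have h1 : Tendsto (fun h : ℝ => ‖hst r X (t + h)‖) (𝓝 0) (𝓝 ‖x‖) := by
      have : Continuous fun h : ℝ => ‖hst r X (t + h)‖ :=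
        ((hst_continuous r X).comp (continuous_const.add continuous_id)).norm
      have := this.tendsto 0
      simpa [hi] using this
    exact h1.comp f1'
  have tφB : Tendsto (fun p : ℝ × Hist n r => ‖hst r X (t + p.1)‖ + p.1 * B p)
      ((𝓝[>] (0:ℝ)) ×ˢ 𝓝 0) (𝓝 ‖x‖) := by
    simpa using tφ.add (f1'.mul tB)
  have texp : Tendsto (fun h : ℝ => (Real.exp (-h) - 1) / h) (𝓝[>] 0) (𝓝 (-1)) := by
    have : HasDerivAt (fun h : ℝ => Real.exp (-h)) (Real.exp (-0) * -1) 0 :=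
      (hasDerivAt_neg (0:ℝ)).exp
    have := hasDerivWithinAt_iff_tendsto_slope.1 (this.hasDerivWithinAt (s := Ioi 0))
    rw [diff_singleton_eq_self (by simp)] at this
    simp only [neg_zero, Real.exp_zero, one_mul] at this
    refine this.congr fun h => ?_
    rw [slope_def_field]; simp
  have tfin : Tendsto (fun p : ℝ × Hist n r => (Real.exp (-p.1) - 1) / p.1 * V t x + Λ R * B p)
      ((𝓝[>] (0:ℝ)) ×ˢ 𝓝 0) (𝓝 (-V t x + Λ R * ‖v - w‖)) := by
    have := ((texp.comp f1).mul_const (V t x)).add (tB.const_mul (Λ R))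
    simpa using this
  have tfinE := (continuous_coe_real_ereal.tendsto _).comp tfin
  unfold diniH
  rw [← tfinE.limsup_eq]
  refine limsup_le_limsup ?_
  have hlt : ‖x‖ < R := by linarith
  have ev1 := tφB.eventually (gt_mem_nhds hlt)
  have ev2 := tφ.eventually (gt_mem_nhds hlt)
  have ev3 := f1.eventually self_mem_nhdsWithin
  have ev4 := f1'.eventually (gt_mem_nhds one_pos)
  filter_upwards [ev1, ev2, ev3, ev4] with p p1 p2 p3 p4
  have p0 : 0 < p.1 := p3
  have hdiff : ‖Ehist p.1 x v + p.1 • p.2 - hst r X (t + p.1)‖ ≤ p.1 * B p := by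
    have : Ehist p.1 x v + p.1 • p.2 - hst r X (t + p.1) =
        (Ehist p.1 x v - Ehist p.1 x w) + p.1 • p.2 - p.1 • q p.1 := by
      rw [hq]; simp only []
      rw [smul_inv_smul₀ p0.ne']; abel
    rw [this]
    refine (norm_sub_le _ _).trans ((add_le_add_left (norm_add_le _ _) _).trans ?_)
    rw [norm_smul, norm_smul, Real.norm_eq_abs, abs_of_pos p0]
    have := Ehist_diff hr x v w p0.le
    simp only [hB]
    linarith
  have hn : ‖Ehist p.1 x v + p.1 • p.2‖ ≤ R := by
    have := norm_le_norm_add_norm_sub' (Ehist p.1 x v + p.1 • p.2) (hst r X (t + p.1))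
    linarith
  have hL := (ΛP R).1 (t + p.1) ⟨by linarith, by linarith [norm_nonneg x]⟩ _ _ hn p2.le
  have hL' := (le_abs_self _).trans hL
  have hde := hdec p.1 p0.le
  have hm := mul_le_mul_of_nonneg_left hdiff (Λ0 R)
  show ((_ : ℝ) : EReal) ≤ ((_ : ℝ) : EReal)
  rw [EReal.coe_le_coe_iff, div_le_iff₀ p0]
  have : ((Real.exp (-p.1) - 1) / p.1 * V t x + Λ R * B p) * p.1 =
    (Real.exp (-p.1) - 1) * V t x + Λ R * (p.1 * B p) := by field_simp
  rw [this]
  linarith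

end VP



def emk {m : ℕ} (a : ℝ) (b : Euc m) : Euc (m + 1) :=
  WithLp.toLp 2 (Fin.cons a (fun i => b i) : Fin (m + 1) → ℝ)

def etl {m : ℕ} (φ : Euc (m + 1)) : Euc m := WithLp.toLp 2 (fun i => φ i.succ)

theorem emk_zero {m : ℕ} (a : ℝ) (b : Euc m) : emk a b 0 = a := rfl

theorem etl_emk {m : ℕ} (a : ℝ) (b : Euc m) : etl (emk a b) = b := by
  ext i; simp [etl, emk]

theorem etl_cont {m : ℕ} : Continuous (etl (m := m)) := by
  unfold etl; fun_prop

theorem etl_norm {m : ℕ} (φ : Euc (m + 1)) : ‖etl φ‖ ≤ ‖φ‖ := by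
  have h1 := EuclideanSpace.norm_sq_eq φ
  have h2 := EuclideanSpace.norm_sq_eq (etl φ)
  rw [Fin.sum_univ_succ] at h1
  have h3 : ∀ i, (etl φ) i = φ i.succ := fun i => rfl
  simp only [h3] at h2
  have : ‖etl φ‖ ^ 2 ≤ ‖φ‖ ^ 2 := by
    rw [h1, h2]; have := sq_nonneg ‖φ 0‖; linarith
  exact abs_le_of_sq_le_sq' this (norm_nonneg _) |>.2

theorem emk_norm {m : ℕ} (a : ℝ) (b : Euc m) : ‖emk a b‖ ≤ |a| + ‖b‖ := by
  have h1 := EuclideanSpace.norm_sq_eq (emk a b)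
  have h2 := EuclideanSpace.norm_sq_eq b
  rw [Fin.sum_univ_succ] at h1
  have h3 : ∀ i : Fin m, emk a b i.succ = b i := fun i => rfl
  simp only [h3, emk_zero] at h1
  rw [← h2, Real.norm_eq_abs] at h1
  refine abs_le_of_sq_le_sq' ?_ (by positivity) |>.2
  rw [h1]
  have : 0 ≤ |a| * ‖b‖ := by positivity
  nlinarith

theorem emk_sub {m : ℕ} (a a' : ℝ) (b b' : Euc m) : emk a b - emk a' b' = emk (a - a') (b - b') := by
  ext i
  refine Fin.cases ?_ (fun i => ?_) i <;> simp [emk]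

theorem emk_cont {m : ℕ} : Continuous fun p : ℝ × Euc m => emk p.1 p.2 := by
  refine (PiLp.continuous_toLp 2 _).comp (continuous_pi fun i => ?_)
  refine Fin.cases ?_ (fun i => ?_) i
  · simp only [Fin.cons_zero]; fun_prop
  · simp only [Fin.cons_succ]; fun_prop

theorem kinf_two {Λ : ℝ → ℝ} (Λc : Continuous Λ) (Λm : Monotone Λ) (Λ0 : ∀ R, 0 ≤ Λ R) :
    IsKinf (fun z => z + Λ (2 * z) * z) := by
  refine ⟨by fun_prop, ?_, by simp, ?_⟩
  · intro s hs t ht hst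
    have hs : 0 ≤ s := hs
    have h1 : Λ (2 * s) ≤ Λ (2 * t) := Λm (by linarith)
    have h2 : Λ (2 * s) * s ≤ Λ (2 * t) * t := mul_le_mul h1 hst.le hs (Λ0 _)
    show s + _ < t + _
    linarith
  · refine tendsto_atTop_mono' _ ?_ tendsto_id
    filter_upwards [eventually_ge_atTop 0] with z hz
    have := mul_nonneg (Λ0 (2 * z)) hz
    simp only [id]; linarith

theorem a_imp_b {n l m : ℕ} {Y : Type*} [NormedAddCommGroup Y] [NormedSpace ℝ Y]
    {r : ℝ} {hr : 0 < r} {D : Set (Euc l)} {U : Set (Euc m)}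
    {f : ℝ → Euc l → Hist n r → Euc m → Euc n} {H : ℝ → Hist n r → Y}
    (hS : HypS r hr D U f H) {kf : ℝ → Hist n r → Euc m} (hk : GoodFeedback r U kf)
    (hG : RGAOSrfde r D (fun t d x => f t d x (kf t x)) H) :
    ∃ (V : ℝ → Hist n r → ℝ) (a₁ a₂ β μ : ℝ → ℝ) (p : ℕ)
    (Ψ : ℝ → Euc p → Euc m → EReal) (Φ : ℝ → Hist n r → Euc p)
    (ρ : ℝ → ℝ) (a γ : ℝ → ℝ),
    ORCLFrfde r D U f H V a₁ a₂ β μ Ψ Φ (fun _ => 0) ρ ∧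
    SmallControlRFDE U Ψ (fun _ => 0) a γ := by
  have hc := CL_of hr hS hk
  obtain ⟨-, hH0, -, -, -, -, -, ⟨LU, LUc, LUm, LU0, hLU⟩, hDc, hDn, hUcl, hUcv, hU0, hHL⟩ := hS
  obtain ⟨kU, kc, kl, k0⟩ := hk
  obtain ⟨S, hF⟩ := flow_of_rgaos hr hG
  obtain ⟨μ, hμ, hg⟩ := exists_g hF hH0 hHL
  obtain ⟨V, a₁, hV, ha₁, hlow⟩ := exists_V hc hF hDn hg
  obtain ⟨Λ, Λm, Λc, Λ0, -, ΛP⟩ := lemmaM (PP D S V) PP.mono hV.lip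
  have ha₂ := kinf_two Λc Λm Λ0
  set Ψr : ℝ → Euc (m + 1) → Euc m → ℝ := fun t φ u => Λ (t + |φ 0| + 1) *
    (LU (t + |φ 0| + 2 * ‖etl φ‖ + ‖u - etl φ‖) * (‖u - etl φ‖ - Metric.infDist (etl φ) U)) with hΨ
  have hne : U.Nonempty := ⟨0, hU0⟩
  have hSC : ∀ t : ℝ, ∀ φ : Euc (m + 1), ∃ u ∈ U, ‖u‖ ≤ 2 * (1 * ‖φ‖) ∧ Ψr t φ u = 0 := by
    intro t φ
    obtain ⟨u, hu, hd⟩ := hUcl.exists_infDist_eq_dist hne (etl φ)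
    rw [dist_eq_norm, norm_sub_rev] at hd
    refine ⟨u, hu, ?_, ?_⟩
    · have h1 := Metric.infDist_le_dist_of_mem (x := etl φ) hU0
      rw [dist_eq_norm, sub_zero] at h1
      have h2 := etl_norm φ
      have h3 := norm_le_norm_add_norm_sub' u (etl φ)
      linarith
    · simp only [hΨ, hd, sub_self, mul_zero]
  refine ⟨V, a₁, fun z => z + Λ (2 * z) * z, fun t => 1 + Λ (2 * t), μ, m + 1,
    fun t φ u => ((Ψr t φ u : ℝ) : EReal), fun t x => emk ‖x‖ (kf t x), fun s => s,
    fun s => 2 * s, fun _ => 1, ⟨V_al hc hF Λ0 Λm ΛP, hV.nn, ha₁, ha₂, ?_, hμ, ?_, ?_, ?_, ?_, ?_,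
      ?_, ?_, ?_, ?_, ?_, ?_⟩, ?_, ?_, ?_⟩
  · exact ⟨by fun_prop, fun t _ => by linarith [Λ0 (2 * t)]⟩
  · intro t ht x
    have hx := norm_nonneg x
    have hm := mul_nonneg (hμ.2 t ht).le hx
    have hH := norm_nonneg (H t x)
    have hl := hlow t ht x
    constructor
    · refine max_le (le_trans (ha₁.2.1.monotoneOn ?_ ?_ ?_) hl) (le_trans (ha₁.2.1.monotoneOn ?_ ?_ ?_) hl)
      · exact hH
      · exact mem_Ici.2 (by positivity)
      · linarith
      · exact hm
      · exact mem_Ici.2 (by positivity)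
      · linarith
    · have h1 := (ΛP (t + ‖x‖)).1 t ⟨ht, by linarith⟩ x 0 (by linarith) (by simp; positivity)
      rw [hV.zero t ht, sub_zero, sub_zero] at h1
      refine ((le_abs_self _).trans h1).trans ?_
      show _ ≤ (1 + Λ (2 * t)) * ‖x‖ + Λ (2 * ((1 + Λ (2 * t)) * ‖x‖)) * ((1 + Λ (2 * t)) * ‖x‖)
      have hβ := Λ0 (2 * t)
      have hle : ‖x‖ ≤ (1 + Λ (2 * t)) * ‖x‖ := by nlinarith
      rcases le_total t ‖x‖ with h | h
      · have e1 : Λ (t + ‖x‖) ≤ Λ (2 * ((1 + Λ (2 * t)) * ‖x‖)) := Λm (by linarith)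
        have := mul_le_mul e1 hle hx (Λ0 _)
        linarith
      · have e1 : Λ (t + ‖x‖) ≤ Λ (2 * t) := Λm (by linarith)
        have e2 := mul_le_mul_of_nonneg_right e1 hx
        have e3 := Λ0 (2 * ((1 + Λ (2 * t)) * ‖x‖))
        have : 0 ≤ Λ (2 * ((1 + Λ (2 * t)) * ‖x‖)) * ((1 + Λ (2 * t)) * ‖x‖) := by positivity
        linarith
  · exact ⟨continuousOn_const, fun _ _ => le_rfl, integrableOn_zero, tendsto_const_nhds⟩
  · exact ⟨continuousOn_id, rfl, fun s h => h, fun s h => h⟩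
  · intro t φ u; exact EReal.coe_ne_bot _
  · intro t ht
    have : etl (0 : Euc (m + 1)) = 0 := by ext i; simp [etl]
    simp [hΨ, this, Metric.infDist_zero_of_mem hU0]
  · intro u hu
    apply ContinuousOn.upperSemicontinuousOn
    refine continuous_coe_real_ereal.comp_continuousOn ?_
    have ce : Continuous fun p : ℝ × Euc (m + 1) => etl p.2 := etl_cont.comp continuous_snd
    have c0 : Continuous fun p : ℝ × Euc (m + 1) => p.2 0 := by fun_prop
    refine ContinuousOn.mul (by fun_prop) (ContinuousOn.mul ?_ ?_)
    · refine LUc.comp (Continuous.continuousOn ?_) ?_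
      · fun_prop
      · rintro ⟨t, φ⟩ ⟨ht, -⟩
        have ht : 0 ≤ t := ht
        exact mem_Ici.2 (by positivity)
    · refine Continuous.continuousOn ?_
      exact (continuous_const.sub ce).norm.sub ((Metric.continuous_infDist_pt U).comp ce)
  · exact emk_cont.comp_continuousOn (continuous_snd.norm.continuousOn.prodMk kc)
  · intro T hT R hR
    obtain ⟨L, hL⟩ := kl T hT R hR
    refine ⟨1 + L, fun t ht x y hx hy => ?_⟩
    rw [emk_sub]
    refine (emk_norm _ _).trans ?_
    have := hL t ht x y hx hy
    have := abs_norm_sub_norm_le x y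
    linarith
  · intro t ht
    show emk ‖(0 : Hist n r)‖ (kf t 0) = 0
    have := emk_norm ‖(0 : Hist n r)‖ (kf t 0)
    rw [k0 t ht] at this ⊢
    simpa using this
  · intro t ht φ
    obtain ⟨u, hu, -, h0⟩ := hSC t φ
    exact iInf_le_of_le ⟨u, hu⟩ (by simp only [h0]; rfl)
  · intro t ht x N u hu lam lam0 lam1 d hd
    have hN : Nonempty (Fin N) := by
      by_contra h
      rw [not_nonempty_iff] at h
      simp at lam1
    obtain ⟨i, hi⟩ := Finite.exists_max fun i => ‖u i - kf t x‖
    set w := ∑ i, lam i • u i with hw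
    have wU : w ∈ U := hUcv.sum_mem (fun i _ => lam0 i) lam1 fun i _ => hu i
    have hwk : ‖w - kf t x‖ ≤ ‖u i - kf t x‖ := by
      have : w - kf t x = ∑ i, lam i • (u i - kf t x) := by
        simp only [smul_sub, Finset.sum_sub_distrib, ← Finset.sum_smul, lam1, one_smul, hw]
      rw [this]
      refine (norm_sum_le _ _).trans ?_
      calc _ ≤ ∑ j, lam j * ‖u i - kf t x‖ := by
            refine Finset.sum_le_sum fun j _ => ?_
            rw [norm_smul, Real.norm_eq_abs, abs_of_nonneg (lam0 j)]
            exact mul_le_mul_of_nonneg_left (hi j) (lam0 j)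
        _ = _ := by rw [← Finset.sum_mul, lam1, one_mul]
    have hdi := V_dini hc hF hV Λ0 ΛP ht x hd (f t d x w)
    refine hdi.trans ?_
    refine le_trans ?_ (add_le_add_right (le_iSup (fun i => ((Ψr t (emk ‖x‖ (kf t x)) (u i) : ℝ) : EReal)) i) _)
    rw [← EReal.coe_add, EReal.coe_le_coe_iff]
    simp only [hΨ, etl_emk, emk_zero, abs_norm, Metric.infDist_zero_of_mem (kU t x), sub_zero]
    have e1 := hLU t ht x d hd w wU _ (kU t x)
    have hx := norm_nonneg x
    have e0 := norm_le_norm_add_norm_sub' w (kf t x)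
    have e2 : LU (t + ‖x‖ + ‖w‖ + ‖kf t x‖) ≤ LU (t + ‖x‖ + 2 * ‖kf t x‖ + ‖u i - kf t x‖) := by
      refine LUm (mem_Ici.2 (by positivity)) (mem_Ici.2 (by positivity)) ?_
      linarith
    have e3 := mul_le_mul e2 hwk (norm_nonneg _) (LU0 _ (by positivity))
    have e4 := mul_le_mul_of_nonneg_left (e1.trans e3) (Λ0 (t + ‖x‖ + 1))
    linarith
  · refine ⟨by fun_prop, ?_, by simp, ?_⟩
    · intro s _ t _ h; show 2 * s < 2 * t; linarith
    · exact tendsto_id.const_mul_atTop two_pos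
  · exact ⟨continuousOn_const, fun _ _ => one_pos⟩
  · intro t ht φ
    obtain ⟨u, hu, h1, h0⟩ := hSC t φ
    exact ⟨u, hu, h1, by simp only [h0]; rfl⟩

section Thm49

variable {n l m : ℕ} {Y : Type*} [NormedAddCommGroup Y] [NormedSpace ℝ Y]
  (r : ℝ) (D : Set (Euc l)) (U : Set (Euc m))
  (f : ℝ → Euc l → Hist n r → Euc m → Euc n) (H : ℝ → Hist n r → Y)

/-- Statement (a) of Theorem 4.9: existence of a continuous, completely locally Lipschitz
stabilizing feedback making the closed-loop system RGAOS. -/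
def Thm49a : Prop :=
  ∃ kf : ℝ → Hist n r → Euc m, GoodFeedback r U kf ∧
    RGAOSrfde r D (fun t d x => f t d x (kf t x)) H

/-- Statement (b) of Theorem 4.9: existence of an ORCLF satisfying the small-control
property with q ≡ 0. -/
def Thm49b : Prop :=
  ∃ (V : ℝ → Hist n r → ℝ) (a₁ a₂ β μ : ℝ → ℝ) (p : ℕ)
    (Ψ : ℝ → Euc p → Euc m → EReal) (Φ : ℝ → Hist n r → Euc p)
    (ρ : ℝ → ℝ) (a γ : ℝ → ℝ),
    ORCLFrfde r D U f H V a₁ a₂ β μ Ψ Φ (fun _ => 0) ρ ∧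
    SmallControlRFDE U Ψ (fun _ => 0) a γ

/-- Statement (c) of Theorem 4.9: existence of an ORCLF. -/
def Thm49c : Prop :=
  ∃ (V : ℝ → Hist n r → ℝ) (a₁ a₂ β μ : ℝ → ℝ) (p : ℕ)
    (Ψ : ℝ → Euc p → Euc m → EReal) (Φ : ℝ → Hist n r → Euc p) (q ρ : ℝ → ℝ),
    ORCLFrfde r D U f H V a₁ a₂ β μ Ψ Φ q ρ

/-- Theorem 4.9: under hypotheses (S1)-(S7), statements (a), (b), (c) are equivalent. -/
theorem stmt13 (hr : 0 < r) (hS : HypS r hr D U f H) :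
    (Thm49a r D U f H ↔ Thm49b r D U f H) ∧
    (Thm49b r D U f H ↔ Thm49c r D U f H) := by
  refine ⟨⟨?_, ?_⟩, ⟨?_, ?_⟩⟩
  · rintro ⟨kf, hk, hG⟩
    exact a_imp_b hS hk hG
  · rintro ⟨V, a₁, a₂, β, μ, p, Ψ, Φ, ρ, a, γ, h, -⟩
    exact c_imp_a hS h
  · rintro ⟨V, a₁, a₂, β, μ, p, Ψ, Φ, ρ, a, γ, h, -⟩
    exact ⟨V, a₁, a₂, β, μ, p, Ψ, Φ, _, ρ, h⟩
  · rintro ⟨V, a₁, a₂, β, μ, p, Ψ, Φ, q, ρ, h⟩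
    obtain ⟨kf, hk, hG⟩ := c_imp_a hS h
    exact a_imp_b hS hk hG

end Thm49
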